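/- arXiv:2106.03509 — 2 statements merged into one kernel-verified Lean document; each statement's English description precedes it below -/
import Mathlib

section
/- If n ≥ 10 is an integer and there exists a pair (x,y) ∈ ℤ² with |y| ≥ 2 satisfying (x − F_n·y)(x − L_n·y)·x − y³ = ±1, then n ≤ 1.144·10^{15}. -/
open Real

/-- The golden ratio α = (1+√5)/2. -/
noncomputable def alpha : ℝ := (1 + Real.sqrt 5) / 2

/-- The Lucas sequence: L 0 = 2, L 1 = 1, L (n+2) = L (n+1) + L n. -/
def lucas : ℕ → ℤ
  | 0 => 2
  | 1 => 1
  | n + 2 => lucas (n + 1) + lucas n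

/-- The cubic polynomial f_n(X) = (X − F_n)(X − L_n)X − 1. -/
noncomputable def fpoly (n : ℕ) (X : ℝ) : ℝ :=
  (X - (Nat.fib n : ℝ)) * (X - (lucas n : ℝ)) * X - 1

open Finset PowerSeries in
/-- `a` has weighted `ℓ¹`-norm at most `B` at radius `ρ`. -/
def Maj (ρ : ℝ) (a : PowerSeries ℝ) (B : ℝ) : Prop :=
  ∀ K, ∑ j ∈ range K, |coeff j a| * ρ ^ j ≤ B

namespace Maj
open Finset PowerSeries

variable {ρ A B : ℝ} {a b : PowerSeries ℝ}

lemma nonneg (h : Maj ρ a A) : 0 ≤ A := by simpa using h 0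

lemma mono (h : Maj ρ a A) (hAB : A ≤ B) : Maj ρ a B := fun K => (h K).trans hAB

lemma add (hρ : 0 ≤ ρ) (ha : Maj ρ a A) (hb : Maj ρ b B) : Maj ρ (a + b) (A + B) := by
  intro K
  refine le_trans ?_ (add_le_add (ha K) (hb K))
  rw [← sum_add_distrib]
  refine sum_le_sum fun j _ => ?_
  rw [map_add, ← add_mul]
  exact mul_le_mul_of_nonneg_right (abs_add_le _ _) (by positivity)

lemma neg (ha : Maj ρ a A) : Maj ρ (-a) A := by
  intro K
  simpa using ha K

lemma sub (hρ : 0 ≤ ρ) (ha : Maj ρ a A) (hb : Maj ρ b B) : Maj ρ (a - b) (A + B) := by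
  rw [sub_eq_add_neg]
  exact ha.add hρ hb.neg

lemma mul (hρ : 0 ≤ ρ) (ha : Maj ρ a A) (hb : Maj ρ b B) : Maj ρ (a * b) (A * B) := by
  intro K
  calc ∑ j ∈ range K, |coeff j (a * b)| * ρ ^ j
      ≤ ∑ j ∈ range K, ∑ i ∈ range (j + 1),
          (|coeff i a| * ρ ^ i) * (|coeff (j - i) b| * ρ ^ (j - i)) := by
        refine sum_le_sum fun j _ => ?_
        rw [coeff_mul, Nat.sum_antidiagonal_eq_sum_range_succ
          (fun i l => coeff i a * coeff l b)]
        refine (mul_le_mul_of_nonneg_right (abs_sum_le_sum_abs _ _) (by positivity)).trans ?_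
        rw [sum_mul]
        refine sum_le_sum fun i hi => le_of_eq ?_
        have hij : i ≤ j := Nat.lt_succ_iff.1 (mem_range.1 hi)
        have : ρ ^ j = ρ ^ i * ρ ^ (j - i) := by rw [← pow_add, Nat.add_sub_cancel' hij]
        rw [abs_mul, this]
        ring
    _ = ∑ i ∈ range K, ∑ l ∈ range (K - i),
          (|coeff i a| * ρ ^ i) * (|coeff l b| * ρ ^ l) :=
        sum_range_diag_flip K fun i l => (|coeff i a| * ρ ^ i) * (|coeff l b| * ρ ^ l)
    _ ≤ ∑ i ∈ range K, (|coeff i a| * ρ ^ i) * B := by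
        refine sum_le_sum fun i _ => ?_
        rw [← mul_sum]
        exact mul_le_mul_of_nonneg_left (hb _) (by positivity)
    _ ≤ A * B := by
        rw [← sum_mul]
        exact mul_le_mul_of_nonneg_right (ha K) hb.nonneg

lemma const (c : ℝ) : Maj ρ (C c) |c| := by
  intro K
  rcases K with _ | K
  · simp
  · rw [sum_range_succ']
    simp [coeff_C]

lemma one : Maj ρ 1 1 := by simpa using const (ρ := ρ) 1

lemma X (hρ : 0 ≤ ρ) : Maj ρ (PowerSeries.X : PowerSeries ℝ) ρ := by
  intro K
  rcases K with _ | _ | K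
  · simpa using hρ
  · simpa using hρ
  · rw [sum_range_succ', sum_range_succ']
    simp [coeff_X]

lemma pow (hρ : 0 ≤ ρ) (ha : Maj ρ a A) (n : ℕ) : Maj ρ (a ^ n) (A ^ n) := by
  induction n with
  | zero => simpa using one
  | succ n ih => rw [pow_succ, pow_succ]; exact ih.mul hρ ha

lemma abs_coeff_le (hρ : 0 < ρ) (ha : Maj ρ a A) (k : ℕ) : |coeff k a| ≤ A / ρ ^ k := by
  rw [le_div_iff₀ (by positivity)]
  refine le_trans ?_ (ha (k + 1))
  exact single_le_sum (f := fun j => |coeff j a| * ρ ^ j) (fun j _ => by positivity)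
    (self_mem_range_succ k)

lemma sum {ι : Type*} (hρ : 0 ≤ ρ) (s : Finset ι) (f : ι → PowerSeries ℝ) (g : ι → ℝ)
    (h : ∀ i ∈ s, Maj ρ (f i) (g i)) : Maj ρ (∑ i ∈ s, f i) (∑ i ∈ s, g i) := by
  classical
  induction s using Finset.induction_on with
  | empty => intro K; simp
  | insert i s hi ih =>
    rw [sum_insert hi, sum_insert hi]
    exact (h i (mem_insert_self _ _)).add hρ (ih fun j hj => h j (mem_insert_of_mem hj))

lemma anti {ρ' : ℝ} (hρ' : 0 ≤ ρ') (h : ρ' ≤ ρ) (ha : Maj ρ a A) : Maj ρ' a A := by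
  intro K
  refine le_trans (sum_le_sum fun j _ => ?_) (ha K)
  gcongr

end Maj

open PowerSeries in
lemma exists_fixedPoint {O : Type*} [CommRing O] (Ψ : O⟦X⟧ → O⟦X⟧)
    (h0 : ∀ a, X ∣ a → X ∣ Ψ a)
    (hΨ : ∀ n a b, X ∣ a → X ∣ b → X ^ n ∣ a - b → X ^ (n + 1) ∣ Ψ a - Ψ b) :
    ∃ y : O⟦X⟧, X ∣ y ∧ Ψ y = y ∧ ∀ n, X ^ n ∣ y - Ψ^[n] 0 := by
  have hX : ∀ n, X ∣ Ψ^[n] 0 := by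
    intro n
    induction n with
    | zero => simp
    | succ n ih => rw [Function.iterate_succ_apply']; exact h0 _ ih
  have step : ∀ n, X ^ n ∣ Ψ^[n + 1] 0 - Ψ^[n] 0 := by
    intro n
    induction n with
    | zero => simp
    | succ n ih =>
      rw [Function.iterate_succ_apply' Ψ (n + 1)]
      nth_rw 2 [Function.iterate_succ_apply' Ψ n]
      exact hΨ n _ _ (hX (n + 1)) (hX n) ih
  have step' : ∀ n k, X ^ n ∣ Ψ^[n + k] 0 - Ψ^[n] 0 := by
    intro n k
    induction k with
    | zero => simp
    | succ k ih =>
      have := dvd_add ((pow_dvd_pow X (Nat.le_add_right n k)).trans (step (n + k))) ih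
      simpa [add_assoc] using this
  let y : O⟦X⟧ := PowerSeries.mk fun k => coeff k (Ψ^[k + 1] 0)
  have hy : ∀ n, X ^ n ∣ y - Ψ^[n] 0 := by
    intro n
    rw [X_pow_dvd_iff]
    intro m hm
    have := (X_pow_dvd_iff.1 (step' (m + 1) (n - (m + 1)))) m (Nat.lt_succ_self m)
    rw [Nat.add_sub_cancel' (Nat.succ_le_of_lt hm), map_sub, sub_eq_zero] at this
    rw [map_sub, this]
    simp [y]
  have hXy : X ∣ y := by
    have := dvd_add (hy 1) (by simpa using hX 1)
    simpa using this
  refine ⟨y, hXy, ?_, hy⟩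
  ext k
  have h1 := hΨ k y _ hXy (hX k) (hy k)
  have h2 := hy (k + 1)
  rw [Function.iterate_succ_apply'] at h2
  have h3 := dvd_sub h1 h2
  have := X_pow_dvd_iff.1 h3 k (Nat.lt_succ_self k)
  have e : (Ψ y - Ψ (Ψ^[k] 0) - (y - Ψ (Ψ^[k] 0))) = Ψ y - y := by ring
  rw [e, map_sub, sub_eq_zero] at this
  exact this

/-- Integer polynomials as real power series. -/
noncomputable def toSeries : Polynomial ℤ →+* PowerSeries ℝ :=
  (Polynomial.coeToPowerSeries.ringHom).comp (Polynomial.mapRingHom (Int.castRingHom ℝ))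

lemma coeff_toSeries (p : Polynomial ℤ) (k : ℕ) :
    PowerSeries.coeff k (toSeries p) = (p.coeff k : ℝ) := by
  simp [toSeries, Polynomial.coeToPowerSeries.ringHom_apply]

/-- The length (sum of absolute values of the coefficients) of `p` is at most `B`. -/
def IntMaj (p : Polynomial ℤ) (B : ℝ) : Prop := Maj 1 (toSeries p) B

namespace IntMaj
open Polynomial

lemma nonneg {p : ℤ[X]} {A : ℝ} (h : IntMaj p A) : 0 ≤ A := Maj.nonneg h

lemma mono {p : ℤ[X]} {A B : ℝ} (h : IntMaj p A) (hAB : A ≤ B) : IntMaj p B := Maj.mono h hAB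

lemma add {p q : ℤ[X]} {A B : ℝ} (hp : IntMaj p A) (hq : IntMaj q B) :
    IntMaj (p + q) (A + B) := by
  unfold IntMaj; rw [map_add]; exact Maj.add zero_le_one hp hq

lemma sub {p q : ℤ[X]} {A B : ℝ} (hp : IntMaj p A) (hq : IntMaj q B) :
    IntMaj (p - q) (A + B) := by
  unfold IntMaj; rw [map_sub]; exact Maj.sub zero_le_one hp hq

lemma mul {p q : ℤ[X]} {A B : ℝ} (hp : IntMaj p A) (hq : IntMaj q B) :
    IntMaj (p * q) (A * B) := by
  unfold IntMaj; rw [map_mul]; exact Maj.mul zero_le_one hp hq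

lemma pow {p : ℤ[X]} {A : ℝ} (hp : IntMaj p A) (n : ℕ) : IntMaj (p ^ n) (A ^ n) := by
  unfold IntMaj; rw [map_pow]; exact Maj.pow zero_le_one hp n

lemma zero : IntMaj 0 0 := by intro K; simp

lemma one : IntMaj 1 1 := by unfold IntMaj; rw [map_one]; exact Maj.one

lemma C (c : ℤ) : IntMaj (Polynomial.C c) |(c : ℝ)| := by
  have : toSeries (Polynomial.C c) = PowerSeries.C (c : ℝ) := by
    simp [toSeries]
  unfold IntMaj; rw [this]; exact Maj.const _

lemma X : IntMaj Polynomial.X 1 := by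
  have : toSeries Polynomial.X = PowerSeries.X := by
    simp [toSeries, Polynomial.coeToPowerSeries.ringHom_apply]
  unfold IntMaj; rw [this]; exact Maj.X zero_le_one

lemma natCast (n : ℕ) : IntMaj (n : ℤ[X]) n := by
  simpa using IntMaj.C (n : ℤ)

lemma ofNat (n : ℕ) [n.AtLeastTwo] : IntMaj (OfNat.ofNat n : ℤ[X]) (OfNat.ofNat n : ℝ) := by
  exact natCast (OfNat.ofNat n)

lemma sum {ι : Type*} (s : Finset ι) (f : ι → ℤ[X]) (g : ι → ℝ)
    (h : ∀ i ∈ s, IntMaj (f i) (g i)) : IntMaj (∑ i ∈ s, f i) (∑ i ∈ s, g i) := by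
  unfold IntMaj; rw [map_sum]; exact Maj.sum zero_le_one s _ g h

lemma abs_coeff_le {p : ℤ[X]} {A : ℝ} (hp : IntMaj p A) (k : ℕ) : |(p.coeff k : ℝ)| ≤ A := by
  have := Maj.abs_coeff_le one_pos hp k
  rwa [coeff_toSeries, one_pow, div_one] at this

lemma sum_abs_coeff_le {p : ℤ[X]} {A : ℝ} (hp : IntMaj p A) (K : ℕ) :
    ∑ j ∈ Finset.range K, |(p.coeff j : ℝ)| ≤ A := by
  simpa [coeff_toSeries] using hp K

lemma derivative {p : ℤ[X]} {A : ℝ} {d : ℕ} (hp : IntMaj p A) (hd : p.natDegree ≤ d) :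
    IntMaj (Polynomial.derivative p) (d * A) := by
  intro K
  have h1 : ∀ j, |PowerSeries.coeff j (toSeries (Polynomial.derivative p))| * 1 ^ j
      ≤ d * |(p.coeff (j + 1) : ℝ)| := by
    intro j
    rw [coeff_toSeries, coeff_derivative, one_pow, mul_one]
    push_cast
    rw [abs_mul, mul_comm]
    by_cases hj : j + 1 ≤ d
    · have : |((j : ℝ) + 1)| ≤ d := by
        rw [abs_of_nonneg (by positivity)]; exact_mod_cast hj
      gcongr
    · rw [coeff_eq_zero_of_natDegree_lt (by omega)]; simp
  calc _ ≤ ∑ j ∈ Finset.range K, d * |(p.coeff (j + 1) : ℝ)| := Finset.sum_le_sum fun j _ => h1 j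
    _ ≤ d * ∑ j ∈ Finset.range (K + 1), |(p.coeff j : ℝ)| := by
      rw [← Finset.mul_sum, Finset.sum_range_succ']
      gcongr
      have := abs_nonneg (p.coeff 0 : ℝ)
      linarith
    _ ≤ d * A := by gcongr; exact hp.sum_abs_coeff_le _

end IntMaj

/-- Expansion of an integer polynomial in `t`, at `τ = (P + t) / Q`. -/
noncomputable def serAt (P Q : ℝ) : Polynomial ℤ →+* PowerSeries ℝ :=
  Polynomial.eval₂RingHom ((PowerSeries.C (R := ℝ)).comp (Int.castRingHom ℝ))
    (PowerSeries.C (P / Q) + PowerSeries.C (1 / Q) * PowerSeries.X)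

section serAt
open Polynomial
variable {P Q : ℝ}

lemma serAt_X : serAt P Q X =
    PowerSeries.C (P / Q) + PowerSeries.C (1 / Q) * PowerSeries.X := by
  simp [serAt]

lemma serAt_C (c : ℤ) : serAt P Q (C c) = PowerSeries.C (c : ℝ) := by
  simp [serAt]

lemma constantCoeff_serAt (p : ℤ[X]) :
    PowerSeries.constantCoeff (serAt P Q p) = p.eval₂ (Int.castRingHom ℝ) (P / Q) := by
  have : (PowerSeries.constantCoeff).comp (serAt P Q) =
      Polynomial.eval₂RingHom (Int.castRingHom ℝ) (P / Q) := by
    apply Polynomial.ringHom_ext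
    · intro a; simp
    · simp [serAt_X]
  exact congrArg (fun g => g p) this

lemma derivative_serAt (p : ℤ[X]) :
    PowerSeries.derivative ℝ (serAt P Q p) =
      PowerSeries.C (1 / Q) * serAt P Q (derivative p) := by
  induction p using Polynomial.induction_on' with
  | add p q hp hq => rw [map_add, map_add, hp, hq, derivative_add, map_add, mul_add]
  | monomial n a =>
    have hX : PowerSeries.derivative ℝ (serAt P Q X) = PowerSeries.C (1 / Q) := by
      rw [serAt_X]
      ext k
      rcases k with _ | k <;>
      simp [PowerSeries.coeff_derivative, PowerSeries.coeff_C, PowerSeries.coeff_X]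
    rw [← C_mul_X_pow_eq_monomial, map_mul (serAt P Q), serAt_C, map_pow, derivative_C_mul_X_pow,
      map_mul (serAt P Q), serAt_C, map_pow, Derivation.leibniz, Derivation.leibniz_pow, hX]
    have : PowerSeries.derivative ℝ (PowerSeries.C (a : ℝ)) = 0 := by
      ext k; simp [PowerSeries.coeff_derivative]
    rw [this]
    simp only [smul_eq_mul, mul_zero, add_zero, nsmul_eq_mul, Int.cast_mul, Int.cast_natCast,
      map_mul, map_natCast]
    ring

lemma IntMaj.maj_serAt {p : ℤ[X]} {A ρ : ℝ} (hp : IntMaj p A) (hP : 0 ≤ P) (hQ : P + 1 ≤ Q)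
    (hρ : 0 ≤ ρ) (hρ1 : ρ ≤ 1) : Maj ρ (serAt P Q p) A := by
  have hQ0 : 0 < Q := by linarith
  have hX : Maj ρ (serAt P Q Polynomial.X) 1 := by
    rw [serAt_X]
    refine ((Maj.const _).add hρ ((Maj.const _).mul hρ (Maj.X hρ))).mono ?_
    rw [abs_of_nonneg (by positivity), abs_of_nonneg (by positivity), div_mul_eq_mul_div, ← add_div,
      div_le_one hQ0]
    linarith
  rw [p.as_sum_range_C_mul_X_pow, map_sum]
  refine (Maj.sum hρ _ _ (fun j => |(p.coeff j : ℝ)|) fun j _ => ?_).mono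
    (hp.sum_abs_coeff_le _)
  rw [map_mul, serAt_C, map_pow]
  simpa using (Maj.const (ρ := ρ) ((p.coeff j : ℤ) : ℝ)).mul hρ (hX.pow hρ j)

/-- Homogenisation of an integer polynomial, evaluated at `(P + X, Q)`. -/
noncomputable def shiftHom (P Q : ℤ) (d : ℕ) (p : ℤ[X]) : ℤ[X] :=
  ∑ j ∈ Finset.range (d + 1), C (p.coeff j * Q ^ (d - j)) * (C P + X) ^ j

lemma toSeries_shiftHom {P Q : ℤ} (hQ : Q ≠ 0) {d : ℕ} {p : ℤ[X]} (hd : p.natDegree ≤ d) :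
    toSeries (shiftHom P Q d p) = PowerSeries.C ((Q : ℝ) ^ d) * serAt P Q p := by
  have hQ' : (Q : ℝ) ≠ 0 := by exact_mod_cast hQ
  have hC : ∀ c : ℤ, toSeries (C c) = PowerSeries.C (c : ℝ) := fun c => by
    simp [toSeries]
  have hX : toSeries X = PowerSeries.X := by
    simp [toSeries, Polynomial.coeToPowerSeries.ringHom_apply]
  conv_rhs => rw [p.as_sum_range_C_mul_X_pow' (Nat.lt_succ_of_le hd)]
  rw [shiftHom, map_sum, map_sum, Finset.mul_sum]
  refine Finset.sum_congr rfl fun j hj => ?_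
  have hj' : j ≤ d := Nat.lt_succ_iff.1 (Finset.mem_range.1 hj)
  rw [map_mul toSeries, map_mul (serAt P Q), map_pow (serAt P Q), map_pow toSeries, map_add, hC, hC, hX, serAt_C, serAt_X]
  have h1 : (PowerSeries.C (P : ℝ) + PowerSeries.X) = PowerSeries.C (Q : ℝ) *
      (PowerSeries.C ((P : ℝ) / Q) + PowerSeries.C (1 / (Q : ℝ)) * PowerSeries.X) := by
    rw [mul_add, ← mul_assoc, ← map_mul, ← map_mul, mul_div_cancel₀ _ hQ', mul_one_div_cancel hQ']
    simp
  have h2 : PowerSeries.C ((Q : ℝ) ^ d) =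
      PowerSeries.C ((Q : ℝ) ^ (d - j)) * PowerSeries.C (Q : ℝ) ^ j := by
    rw [← map_pow, ← map_mul, ← pow_add, Nat.sub_add_cancel hj']
  rw [h1, mul_pow, h2]
  push_cast
  rw [map_mul]
  ring

/-- Each order of vanishing of `p` at `P / Q` yields a factor `Q X - P` of `p`. -/
lemma pow_dvd_of_X_pow_dvd_serAt {P Q : ℤ} (hQ : Q ≠ 0) (hPQ : IsCoprime P Q) (k : ℕ) (p : ℤ[X])
    (h : PowerSeries.X ^ k ∣ serAt P Q p) : (C Q * X - C P) ^ k ∣ p := by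
  have hQ' : (Q : ℝ) ≠ 0 := by exact_mod_cast hQ
  have hlin : serAt P Q (C Q * X - C P) = PowerSeries.X := by
    rw [map_sub, map_mul, serAt_C, serAt_C, serAt_X, mul_add, ← mul_assoc, ← map_mul, ← map_mul,
      mul_div_cancel₀ _ hQ', mul_one_div_cancel hQ']
    simp
  induction k with
  | zero => simp
  | succ k ih =>
    obtain ⟨r, rfl⟩ := ih ((pow_dvd_pow _ k.le_succ).trans h)
    rw [map_mul, map_pow, hlin, pow_succ] at h
    have h1 : PowerSeries.X ∣ serAt P Q r :=
      (mul_dvd_mul_iff_left (pow_ne_zero k PowerSeries.X_ne_zero)).1 h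
    rw [PowerSeries.X_dvd_iff, constantCoeff_serAt] at h1
    rw [pow_succ]
    refine mul_dvd_mul_left _ ?_
    have hprim : (C Q * X - C P : ℤ[X]).IsPrimitive := by
      intro c hc
      rw [C_dvd_iff_dvd_coeff] at hc
      have h0 := hc 0
      have h1 := hc 1
      have e0 : (C Q * X - C P : ℤ[X]).coeff 0 = -P := by
        rw [coeff_sub, coeff_C_mul, coeff_X_zero, coeff_C_zero]; ring
      have e1 : (C Q * X - C P : ℤ[X]).coeff 1 = Q := by
        rw [coeff_sub, coeff_C_mul, coeff_X_one, coeff_C_of_ne_zero one_ne_zero]; ring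
      rw [e0, dvd_neg] at h0
      rw [e1] at h1
      exact hPQ.isUnit_of_dvd' h0 h1
    rw [IsPrimitive.Int.dvd_iff_map_cast_dvd_map_cast _ _ hprim]
    have hroot : (r.map (Int.castRingHom ℚ)).IsRoot ((P : ℚ) / Q) := by
      rw [IsRoot, eval_map]
      have : ((r.eval₂ (Int.castRingHom ℚ) ((P : ℚ) / Q) : ℚ) : ℝ) = 0 := by
        rw [← h1, ← eq_ratCast (Rat.castHom ℝ), Polynomial.hom_eval₂,
          show (Rat.castHom ℝ).comp (Int.castRingHom ℚ) = Int.castRingHom ℝ from RingHom.ext_int _ _]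
        simp
      exact_mod_cast this
    obtain ⟨g, hg⟩ := dvd_iff_isRoot.2 hroot
    have hQq : (Q : ℚ) ≠ 0 := by exact_mod_cast hQ
    refine ⟨C (1 / (Q : ℚ)) * g, ?_⟩
    rw [hg]
    rw [Polynomial.map_sub, Polynomial.map_mul, map_C, map_C, map_X]
    have e1 : (C (Q : ℚ) * X - C (P : ℚ) : ℚ[X]) = C (Q : ℚ) * (X - C ((P : ℚ) / Q)) := by
      rw [mul_sub, ← C_mul, mul_div_cancel₀ _ hQq]
    have e2 : C (Q : ℚ) * C (1 / (Q : ℚ)) = 1 := by rw [← C_mul, mul_one_div_cancel hQq, C_1]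
    change _ = (C (Q : ℚ) * X - C (P : ℚ)) * _
    rw [e1]
    linear_combination (-(X - C ((P : ℚ) / Q)) * g) * e2

lemma pow_le_of_X_pow_dvd_serAt {P Q : ℤ} (hQ : 0 < Q) (hPQ : IsCoprime P Q) {k : ℕ} {p : ℤ[X]}
    {A : ℝ} (hp : IntMaj p A) (hp0 : p ≠ 0) (h : PowerSeries.X ^ k ∣ serAt P Q p) :
    (Q : ℝ) ^ k ≤ A := by
  obtain ⟨r, rfl⟩ := pow_dvd_of_X_pow_dvd_serAt hQ.ne' hPQ k p h
  have hr : r ≠ 0 := right_ne_zero_of_mul hp0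
  have hl : (C Q * X - C P : ℤ[X]).leadingCoeff = Q := by
    rw [sub_eq_add_neg, ← C_neg]; exact leadingCoeff_linear hQ.ne'
  have h1 : ((C Q * X - C P) ^ k * r).leadingCoeff = Q ^ k * r.leadingCoeff := by
    rw [leadingCoeff_mul, leadingCoeff_pow, hl]
  have h2 := hp.abs_coeff_le ((C Q * X - C P) ^ k * r).natDegree
  rw [coeff_natDegree, h1] at h2
  refine le_trans ?_ h2
  have h3 : (1 : ℝ) ≤ |(r.leadingCoeff : ℝ)| := by
    exact_mod_cast Int.one_le_abs (leadingCoeff_ne_zero.2 hr)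
  push_cast
  rw [abs_mul, abs_of_nonneg (by positivity)]
  exact le_mul_of_one_le_right (by positivity) h3

end serAt

/-- `cubicRed s₁ s₂ s₃ j` lists the coordinates of `a ^ (j + 2)` in the basis `1, a, a ^ 2`,
for `a` a root of `X ^ 3 - s₁ X ^ 2 + s₂ X - s₃`. -/
def cubicRed {R : Type*} [CommRing R] (s₁ s₂ s₃ : R) : ℕ → R × R × R
  | 0 => (0, 0, 1)
  | j + 1 =>
    let t := cubicRed s₁ s₂ s₃ j
    (s₃ * t.2.2, t.1 - s₂ * t.2.2, t.2.1 + s₁ * t.2.2)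

section cubicRed
open Polynomial

lemma pow_eq_cubicRed {R S : Type*} [CommRing R] [CommRing S] (g : R →+* S) {s₁ s₂ s₃ : R} {a : S}
    (ha : a ^ 3 - g s₁ * a ^ 2 + g s₂ * a - g s₃ = 0) (j : ℕ) :
    a ^ (j + 2) = g (cubicRed s₁ s₂ s₃ j).1 + g (cubicRed s₁ s₂ s₃ j).2.1 * a +
      g (cubicRed s₁ s₂ s₃ j).2.2 * a ^ 2 := by
  induction j with
  | zero => simp [cubicRed]
  | succ j ih =>
    rw [show j + 1 + 2 = (j + 2) + 1 by ring, pow_succ, ih]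
    simp only [cubicRed, map_mul, map_sub, map_add]
    linear_combination (g (cubicRed s₁ s₂ s₃ j).2.2) * ha

variable {s₁ s₂ s₃ : ℤ[X]}

lemma natDegree_cubicRed (h1 : s₁.natDegree ≤ 2) (h2 : s₂.natDegree ≤ 4) (h3 : s₃.natDegree ≤ 6)
    (j : ℕ) : (cubicRed s₁ s₂ s₃ j).1.natDegree ≤ 2 * j + 4 ∧
      (cubicRed s₁ s₂ s₃ j).2.1.natDegree ≤ 2 * j + 2 ∧
      (cubicRed s₁ s₂ s₃ j).2.2.natDegree ≤ 2 * j := by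
  induction j with
  | zero => simp [cubicRed]
  | succ j ih =>
    obtain ⟨hA, hB, hC⟩ := ih
    simp only [cubicRed]
    refine ⟨?_, ?_, ?_⟩
    · exact (natDegree_mul_le).trans (by omega)
    · refine (natDegree_sub_le _ _).trans (max_le (by omega) ?_)
      exact (natDegree_mul_le).trans (by omega)
    · refine (natDegree_add_le _ _).trans (max_le (by omega) ?_)
      exact (natDegree_mul_le).trans (by omega)

lemma intMaj_cubicRed (h1 : IntMaj s₁ 20) (h2 : IntMaj s₂ 100) (h3 : IntMaj s₃ 27)
    (j : ℕ) : IntMaj (cubicRed s₁ s₂ s₃ j).1 (2 ^ (7 * j)) ∧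
      IntMaj (cubicRed s₁ s₂ s₃ j).2.1 (2 ^ (7 * j)) ∧
      IntMaj (cubicRed s₁ s₂ s₃ j).2.2 (2 ^ (7 * j)) := by
  induction j with
  | zero =>
    simp only [cubicRed, mul_zero, pow_zero]
    exact ⟨IntMaj.zero.mono zero_le_one, IntMaj.zero.mono zero_le_one, IntMaj.one⟩
  | succ j ih =>
    obtain ⟨hA, hB, hC⟩ := ih
    have e : (2 : ℝ) ^ (7 * (j + 1)) = 128 * 2 ^ (7 * j) := by
      rw [mul_add, pow_add]; norm_num; ring
    have hM : (0 : ℝ) ≤ 2 ^ (7 * j) := by positivity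
    simp only [cubicRed]
    rw [e]
    exact ⟨(h3.mul hC).mono (by linarith), (hA.sub (h2.mul hC)).mono (by linarith),
      (hB.add (h1.mul hC)).mono (by linarith)⟩

open Int.Matrix in
attribute [local instance] Matrix.seminormedAddCommGroup in
/-- Auxiliary polynomials: `c + e a = a ^ (2 μ) (x₀ + x₁ a + x₂ a ^ 2)` for all roots `a`. -/
theorem exists_auxiliary {μ : ℕ} (hμ : 1 ≤ μ)
    (hd1 : s₁.natDegree ≤ 2) (hd2 : s₂.natDegree ≤ 4) (hd3 : s₃.natDegree ≤ 6)
    (h1 : IntMaj s₁ 20) (h2 : IntMaj s₂ 100) (h3 : IntMaj s₃ 27) :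
    ∃ (x : Fin 3 → ℤ[X]) (c e : ℤ[X]), x ≠ 0 ∧ (∀ i, IntMaj (x i) (2 ^ (150 * μ))) ∧
      c.natDegree ≤ 7 * μ + 3 ∧ e.natDegree ≤ 7 * μ + 1 ∧
      IntMaj c (2 ^ (150 * μ)) ∧ IntMaj e (2 ^ (150 * μ)) ∧
      ∀ (S : Type) [CommRing S] (g : ℤ[X] →+* S) (a : S),
        a ^ 3 - g s₁ * a ^ 2 + g s₂ * a - g s₃ = 0 →
        g c + g e * a = a ^ (2 * μ) * (g (x 0) + g (x 1) * a + g (x 2) * a ^ 2) := by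
  obtain ⟨j₀, hj₀⟩ : ∃ j₀, 2 * μ = j₀ + 2 := ⟨2 * μ - 2, by omega⟩
  set T : Fin 3 → ℤ[X] × ℤ[X] × ℤ[X] := fun i => cubicRed s₁ s₂ s₃ (j₀ + i) with hT
  have hTd : ∀ i, (T i).1.natDegree ≤ 4 * μ + 4 ∧ (T i).2.1.natDegree ≤ 4 * μ + 2 ∧
      (T i).2.2.natDegree ≤ 4 * μ := by
    intro i
    obtain ⟨a1, a2, a3⟩ := natDegree_cubicRed hd1 hd2 hd3 (j₀ + i)
    have := i.2
    exact ⟨a1.trans (by omega), a2.trans (by omega), a3.trans (by omega)⟩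
  have hTM : ∀ i, IntMaj (T i).1 (2 ^ (14 * μ)) ∧ IntMaj (T i).2.1 (2 ^ (14 * μ)) ∧
      IntMaj (T i).2.2 (2 ^ (14 * μ)) := by
    intro i
    obtain ⟨a1, a2, a3⟩ := intMaj_cubicRed h1 h2 h3 (j₀ + i)
    have h : (2 : ℝ) ^ (7 * (j₀ + i)) ≤ 2 ^ (14 * μ) :=
      pow_le_pow_right₀ one_le_two (by have := i.2; omega)
    exact ⟨a1.mono h, a2.mono h, a3.mono h⟩
  let M : Matrix (Fin (7 * μ)) (Fin 3 × Fin (3 * μ)) ℤ :=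
    fun r ij => (X ^ (ij.2 : ℕ) * (T ij.1).2.2).coeff r
  have hMn : ‖M‖ ≤ 2 ^ (14 * μ) := by
    rw [Matrix.norm_le_iff (by positivity)]
    intro r ij
    have := ((IntMaj.X.pow (ij.2 : ℕ)).mul (hTM ij.1).2.2).abs_coeff_le r
    rw [one_pow, one_mul] at this
    exact this
  obtain ⟨t, ht0, htM, htn⟩ := exists_ne_zero_int_vec_norm_le M
    (by simp only [Fintype.card_fin, Fintype.card_prod]; omega) (by simp; omega)
  have hμR : (1 : ℝ) ≤ μ := by exact_mod_cast hμ
  have hμ2 : (μ : ℝ) ≤ 2 ^ μ := by exact_mod_cast (Nat.lt_two_pow_self).le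
  have htn' : ‖t‖ ≤ 2 ^ (80 * μ) := by
    refine htn.trans ?_
    have e1 : ((Fintype.card (Fin (7 * μ)) : ℕ) : ℝ) /
        ((Fintype.card (Fin 3 × Fin (3 * μ)) : ℕ) - (Fintype.card (Fin (7 * μ)) : ℕ)) ≤
        (4 : ℕ) := by
      simp only [Fintype.card_fin, Fintype.card_prod]
      push_cast
      rw [div_le_iff₀ (by linarith)]
      linarith
    have e2 : ((Fintype.card (Fin 3 × Fin (3 * μ)) : ℕ) : ℝ) * max 1 ‖M‖ ≤ 2 ^ (20 * μ) := by
      simp only [Fintype.card_fin, Fintype.card_prod]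
      push_cast
      have : (3 * (3 * (μ : ℝ))) ≤ 2 ^ (6 * μ) := by
        have h5 : (32 : ℝ) ≤ 2 ^ (5 * μ) := by
          calc (32 : ℝ) = 2 ^ (5 * 1) := by norm_num
            _ ≤ _ := pow_le_pow_right₀ one_le_two (by omega)
        calc (3 * (3 * (μ : ℝ))) ≤ 32 * μ := by linarith
          _ ≤ 2 ^ (5 * μ) * 2 ^ μ := by gcongr
          _ = _ := by rw [← pow_add]; congr 1; ring
      calc _ ≤ (2 : ℝ) ^ (6 * μ) * 2 ^ (14 * μ) := by
            gcongr
            exact max_le (one_le_pow₀ one_le_two) hMn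
        _ = _ := by rw [← pow_add]; congr 1; ring
    have e3 : (1 : ℝ) ≤ ((Fintype.card (Fin 3 × Fin (3 * μ)) : ℕ) : ℝ) * max 1 ‖M‖ := by
      refine one_le_mul_of_one_le_of_one_le ?_ (le_max_left _ _)
      simp only [Fintype.card_fin, Fintype.card_prod]
      push_cast
      linarith
    refine (Real.rpow_le_rpow_of_exponent_le e3 e1).trans ?_
    rw [Real.rpow_natCast]
    refine (pow_le_pow_left₀ (by linarith) e2 4).trans (le_of_eq ?_)
    rw [← pow_mul]; congr 1; ring
  have htc : ∀ ij, |(t ij : ℝ)| ≤ 2 ^ (80 * μ) := fun ij => by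
    have := (norm_le_pi_norm t ij).trans htn'
    simpa [Int.norm_eq_abs] using this
  let x : Fin 3 → ℤ[X] := fun i => ∑ j : Fin (3 * μ), C (t (i, j)) * X ^ (j : ℕ)
  have hxc : ∀ i (j : Fin (3 * μ)), (x i).coeff j = t (i, j) := by
    intro i j
    simp only [x, finsetSum_coeff, coeff_C_mul, coeff_X_pow]
    rw [Finset.sum_eq_single j]
    · simp
    · intro b _ hb
      rw [if_neg (fun h => hb (Fin.ext h.symm)), mul_zero]
    · simp
  have hxd : ∀ i, (x i).natDegree < 3 * μ := by
    intro i
    refine (natDegree_sum_le_of_forall_le (n := 3 * μ - 1) _ _ fun j _ => ?_).trans_lt (by omega)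
    exact (natDegree_C_mul_X_pow_le _ _).trans (by have := j.2; omega)
  have hxM : ∀ i, IntMaj (x i) (2 ^ (83 * μ)) := by
    intro i
    refine (IntMaj.sum _ _ (fun _ => (2 : ℝ) ^ (80 * μ)) fun j _ => ?_).mono ?_
    · refine ((IntMaj.C _).mul (IntMaj.X.pow _)).mono ?_
      rw [one_pow, mul_one]
      exact htc _
    · simp only [Finset.sum_const, Finset.card_univ, Fintype.card_fin, nsmul_eq_mul]
      push_cast
      have : (3 * (μ : ℝ)) ≤ 2 ^ (3 * μ) := by
        have h5 : (4 : ℝ) ≤ 2 ^ (2 * μ) := by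
          calc (4 : ℝ) = 2 ^ (2 * 1) := by norm_num
            _ ≤ _ := pow_le_pow_right₀ one_le_two (by omega)
        calc (3 * (μ : ℝ)) ≤ 4 * μ := by linarith
          _ ≤ 2 ^ (2 * μ) * 2 ^ μ := by gcongr
          _ = _ := by rw [← pow_add]; congr 1; ring
      calc _ ≤ (2 : ℝ) ^ (3 * μ) * 2 ^ (80 * μ) := by gcongr
        _ = _ := by rw [← pow_add]; congr 1; ring
  have hsumM : ∀ f : Fin 3 → ℤ[X], (∀ i, IntMaj (f i) (2 ^ (14 * μ))) →
      IntMaj (∑ i, x i * f i) (2 ^ (150 * μ)) := by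
    intro f hf
    refine (IntMaj.sum _ _ (fun _ => (2 : ℝ) ^ (97 * μ)) fun i _ => ?_).mono ?_
    · refine ((hxM i).mul (hf i)).mono (le_of_eq ?_)
      rw [← pow_add]; congr 1; ring
    · simp only [Finset.sum_const, Finset.card_univ, Fintype.card_fin, nsmul_eq_mul]
      push_cast
      have h5 : (3 : ℝ) ≤ 2 ^ (2 * μ) := by
        calc (3 : ℝ) ≤ 2 ^ (2 * 1) := by norm_num
          _ ≤ _ := pow_le_pow_right₀ one_le_two (by omega)
      calc _ ≤ (2 : ℝ) ^ (2 * μ) * 2 ^ (97 * μ) := by gcongr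
        _ = 2 ^ (2 * μ + 97 * μ) := by rw [← pow_add]
        _ ≤ _ := pow_le_pow_right₀ one_le_two (by omega)
  have hsumD : ∀ (f : Fin 3 → ℤ[X]) (d : ℕ), (∀ i, (f i).natDegree ≤ d) →
      (∑ i, x i * f i).natDegree ≤ 3 * μ - 1 + d := by
    intro f d hf
    refine natDegree_sum_le_of_forall_le _ _ fun i _ => natDegree_mul_le.trans ?_
    have := hf i
    have := hxd i
    omega
  have hzero : ∑ i, x i * (T i).2.2 = 0 := by
    ext r
    rw [coeff_zero]
    by_cases hr : r < 7 * μ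
    · have := congrFun htM ⟨r, hr⟩
      rw [Matrix.mulVec, dotProduct, Fintype.sum_prod_type] at this
      simp only [Pi.zero_apply] at this
      rw [← this, finsetSum_coeff]
      refine Finset.sum_congr rfl fun i _ => ?_
      simp only [x, M]
      rw [Finset.sum_mul, finsetSum_coeff]
      refine Finset.sum_congr rfl fun j _ => ?_
      rw [mul_assoc, coeff_C_mul, mul_comm]
    · refine coeff_eq_zero_of_natDegree_lt ((hsumD _ _ fun i => (hTd i).2.2).trans_lt ?_)
      omega
  refine ⟨x, ∑ i, x i * (T i).1, ∑ i, x i * (T i).2.1, ?_, ?_, ?_, ?_, ?_, ?_, ?_⟩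
  · intro hx
    apply ht0
    ext ⟨i, j⟩
    rw [← hxc, hx]; simp
  · exact fun i => (hxM i).mono (pow_le_pow_right₀ one_le_two (by omega))
  · exact (hsumD _ _ fun i => (hTd i).1).trans (by omega)
  · exact (hsumD _ _ fun i => (hTd i).2.1).trans (by omega)
  · exact hsumM _ fun i => (hTM i).1
  · exact hsumM _ fun i => (hTM i).2.1
  · intro S _ g a ha
    have hz := congrArg g hzero
    simp only [Fin.sum_univ_three, map_add, map_mul, map_zero] at hz ⊢
    have p0 := pow_eq_cubicRed g ha j₀
    have p1 := pow_eq_cubicRed g ha (j₀ + 1)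
    have p2 := pow_eq_cubicRed g ha (j₀ + 2)
    have t0 : T 0 = cubicRed s₁ s₂ s₃ j₀ := rfl
    have t1 : T 1 = cubicRed s₁ s₂ s₃ (j₀ + 1) := rfl
    have t2 : T 2 = cubicRed s₁ s₂ s₃ (j₀ + 2) := rfl
    rw [← t0] at p0
    rw [← t1] at p1
    rw [← t2] at p2
    rw [hj₀]
    linear_combination -g (x 0) * p0 - g (x 1) * p1 - g (x 2) * p2 - a ^ 2 * hz

end cubicRed

section Newton
open PowerSeries

/-- A rearranged Newton step for a root `α + θ y` of a cubic with series coefficients. -/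
noncomputable def newtonStep {R : Type*} [CommRing R] (A B α θ d₁ d₂ d₃ y : R⟦X⟧) : R⟦X⟧ :=
  -A * y ^ 2 - B * y ^ 3 + X * (d₁ * (α + θ * y) ^ 2 - d₂ * (α + θ * y) + d₃)

variable {R : Type*} [CommRing R] (A B α θ d₁ d₂ d₃ : R⟦X⟧)

lemma X_dvd_newtonStep (a : R⟦X⟧) (ha : X ∣ a) : X ∣ newtonStep A B α θ d₁ d₂ d₃ a := by
  obtain ⟨a, rfl⟩ := ha
  exact ⟨-A * X * a ^ 2 - B * X ^ 2 * a ^ 3 +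
    (d₁ * (α + θ * (X * a)) ^ 2 - d₂ * (α + θ * (X * a)) + d₃), by unfold newtonStep; ring⟩

lemma newtonStep_contracts (n : ℕ) (a b : R⟦X⟧) (ha : X ∣ a) (hb : X ∣ b) (h : X ^ n ∣ a - b) :
    X ^ (n + 1) ∣ newtonStep A B α θ d₁ d₂ d₃ a - newtonStep A B α θ d₁ d₂ d₃ b := by
  obtain ⟨a, rfl⟩ := ha
  obtain ⟨b, rfl⟩ := hb
  obtain ⟨c, hc⟩ := h
  refine ⟨c * (-A * (a + b) - B * X * (a ^ 2 + a * b + b ^ 2) +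
    (d₁ * (θ * (2 * α + θ * (X * a) + θ * (X * b))) - d₂ * θ)), ?_⟩
  unfold newtonStep
  linear_combination X * (-A * (a + b) - B * X * (a ^ 2 + a * b + b ^ 2) +
    (d₁ * (θ * (2 * α + θ * (X * a) + θ * (X * b))) - d₂ * θ)) * hc

lemma maj_of_newtonStep_eq {A B α θ d₁ d₂ d₃ y : ℝ⟦X⟧} {ρ M : ℝ} (hM : 0 ≤ M) (hXy : X ∣ y)
    (hy : newtonStep A B α θ d₁ d₂ d₃ y = y)
    (h : ∀ a, Maj ρ a M → Maj ρ (newtonStep A B α θ d₁ d₂ d₃ a) M) : Maj ρ y M := by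
  set Ψ := newtonStep A B α θ d₁ d₂ d₃ with hΨ
  have hX : ∀ n, X ∣ Ψ^[n] 0 := by
    intro n
    induction n with
    | zero => simp
    | succ n ih => rw [Function.iterate_succ_apply']; exact X_dvd_newtonStep _ _ _ _ _ _ _ _ ih
  have hd : ∀ n, X ^ n ∣ y - Ψ^[n] 0 := by
    intro n
    induction n with
    | zero => simp
    | succ n ih =>
      rw [Function.iterate_succ_apply']
      have := newtonStep_contracts A B α θ d₁ d₂ d₃ n y _ hXy (hX n) ih
      rwa [← hΨ, hy] at this
  have hmaj : ∀ n, Maj ρ (Ψ^[n] 0) M := by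
    intro n
    induction n with
    | zero => intro K; simpa using hM
    | succ n ih => rw [Function.iterate_succ_apply']; exact h _ ih
  intro K
  refine le_trans (le_of_eq (Finset.sum_congr rfl fun j hj => ?_)) (hmaj K K)
  have := X_pow_dvd_iff.1 (hd K) j (Finset.mem_range.1 hj)
  rw [map_sub, sub_eq_zero] at this
  rw [this]

end Newton

/-- The discriminant of `X ^ 3 - s₁ X ^ 2 + s₂ X - s₃`. -/
def cubicDisc {R : Type*} [CommRing R] (s₁ s₂ s₃ : R) : R :=
  s₁ ^ 2 * s₂ ^ 2 - 4 * s₂ ^ 3 - 4 * s₁ ^ 3 * s₃ + 18 * s₁ * s₂ * s₃ - 27 * s₃ ^ 2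

/-- The order `ℤ[r]` generated by the tuple of roots of an integer cubic. -/
def cubicOrder (r : Fin 3 → ℝ) (n₁ n₂ n₃ : ℤ)
    (hr : ∀ i, r i ^ 3 - n₁ * r i ^ 2 + n₂ * r i - n₃ = 0) : Subring (Fin 3 → ℝ) where
  carrier := {z | ∃ a b c : ℤ, ∀ i, z i = a + b * r i + c * r i ^ 2}
  zero_mem' := ⟨0, 0, 0, fun i => by simp⟩
  one_mem' := ⟨1, 0, 0, fun i => by simp⟩
  add_mem' := by
    rintro z z' ⟨a, b, c, h⟩ ⟨a', b', c', h'⟩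
    exact ⟨a + a', b + b', c + c', fun i => by rw [Pi.add_apply, h, h']; push_cast; ring⟩
  neg_mem' := by
    rintro z ⟨a, b, c, h⟩
    exact ⟨-a, -b, -c, fun i => by rw [Pi.neg_apply, h]; push_cast; ring⟩
  mul_mem' := by
    rintro z z' ⟨a, b, c, h⟩ ⟨a', b', c', h'⟩
    refine ⟨a * a' + (b * c' + c * b') * n₃ + c * c' * (n₁ * n₃),
      a * b' + b * a' - (b * c' + c * b') * n₂ + c * c' * (n₃ - n₁ * n₂),
      a * c' + b * b' + c * a' + (b * c' + c * b') * n₁ + c * c' * (n₁ ^ 2 - n₂), fun i => ?_⟩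
    rw [Pi.mul_apply, h, h']
    push_cast
    linear_combination ((b * c' + c * b') + c * c' * (r i + n₁)) * hr i

section deformation
open Polynomial

lemma IntMaj.divX {p : ℤ[X]} {A : ℝ} (hp : IntMaj p A) : IntMaj p.divX A := by
  intro K
  have := hp.sum_abs_coeff_le (K + 1)
  rw [Finset.sum_range_succ'] at this
  simp only [coeff_toSeries, coeff_divX, one_pow, mul_one]
  have h0 := abs_nonneg (p.coeff 0 : ℝ)
  linarith

/-- Hensel lifting of the roots of an integer cubic along a deformation, with estimates and
integrality of traces. -/
theorem exists_deformation {Q : ℝ} (hQ : 8 ≤ Q) {σ₁ σ₂ σ₃ : ℤ[X]} (r : Fin 3 → ℝ)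
    (hσ₁ : IntMaj σ₁ (Q ^ 3)) (hσ₂ : IntMaj σ₂ (Q ^ 5)) (hσ₃ : IntMaj σ₃ (Q ^ 7))
    (v₁ : r 0 + r 1 + r 2 = σ₁.coeff 0) (v₂ : r 0 * r 1 + r 1 * r 2 + r 2 * r 0 = σ₂.coeff 0)
    (v₃ : r 0 * r 1 * r 2 = σ₃.coeff 0)
    (hA : ∀ i, |3 * r i - σ₁.coeff 0| ≤ Q ^ 4) (hrQ : ∀ i, |r i| ≤ Q ^ 3)
    (hθ1 : ∀ i, 1 ≤ |3 * r i ^ 2 - 2 * σ₁.coeff 0 * r i + σ₂.coeff 0|)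
    (hθ2 : ∀ i, |3 * r i ^ 2 - 2 * σ₁.coeff 0 * r i + σ₂.coeff 0| ≤ Q ^ 6) :
    ∃ α : Fin 3 → PowerSeries ℝ,
      (∀ i, α i ^ 3 - toSeries σ₁ * α i ^ 2 + toSeries σ₂ * α i - toSeries σ₃ = 0) ∧
      (∀ i, PowerSeries.constantCoeff (α i) = r i) ∧
      (∀ i, Maj ((Q⁻¹) ^ 40) (α i - PowerSeries.C (r i)) ((Q⁻¹) ^ 14)) ∧
      ∀ (G : Polynomial ℤ[X]) (a b c : ℤ) (k : ℕ), ∃ N : ℤ,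
        ∑ i, (a + b * r i + c * r i ^ 2) *
          (cubicDisc (σ₁.coeff 0 : ℝ) (σ₂.coeff 0) (σ₃.coeff 0) ^ k *
          PowerSeries.coeff k (G.eval₂ toSeries (α i))) = N := by
  have hr : ∀ i, r i ^ 3 - σ₁.coeff 0 * r i ^ 2 + σ₂.coeff 0 * r i - σ₃.coeff 0 = 0 := by
    intro i
    rw [← v₁, ← v₂, ← v₃]
    fin_cases i <;> simp <;> ring
  let O := cubicOrder r (σ₁.coeff 0) (σ₂.coeff 0) (σ₃.coeff 0) hr
  let r' : O := ⟨r, 0, 1, 0, fun i => by simp⟩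
  let θ : O := ⟨fun i => 3 * r i ^ 2 - 2 * σ₁.coeff 0 * r i + σ₂.coeff 0,
    σ₂.coeff 0, -2 * σ₁.coeff 0, 3, fun i => by push_cast; ring⟩
  let w : O := ⟨fun i => σ₁.coeff 0 ^ 2 - 4 * σ₂.coeff 0 + 2 * σ₁.coeff 0 * r i - 3 * r i ^ 2,
    σ₁.coeff 0 ^ 2 - 4 * σ₂.coeff 0, 2 * σ₁.coeff 0, -3, fun i => by push_cast; ring⟩
  let φ : Fin 3 → (O →+* ℝ) := fun i => (Pi.evalRingHom (fun _ => ℝ) i).comp O.subtype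
  let ι : ℤ[X] →+* PowerSeries O :=
    (Polynomial.coeToPowerSeries.ringHom).comp (Polynomial.mapRingHom (Int.castRingHom O))
  have hιc : ∀ p k, PowerSeries.coeff k (ι p) = ((p.coeff k : ℤ) : O) := by
    intro p k; simp [ι, Polynomial.coeToPowerSeries.ringHom_apply]
  have hθ : ∀ i, φ i θ = 3 * r i ^ 2 - 2 * σ₁.coeff 0 * r i + σ₂.coeff 0 := fun i => rfl
  have hr' : ∀ i, φ i r' = r i := fun i => rfl
  have hθ0 : ∀ i, φ i θ ≠ 0 := by
    intro i h
    have := hθ1 i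
    rw [← hθ, h, abs_zero] at this
    linarith
  let δ : ℤ[X] → PowerSeries O := fun p => PowerSeries.rescale (θ ^ 2) (ι p.divX)
  have hδ : ∀ p : ℤ[X], PowerSeries.rescale (θ ^ 2) (ι p) =
      ((p.coeff 0 : ℤ) : PowerSeries O) + PowerSeries.C (θ ^ 2) * PowerSeries.X * δ p := by
    intro p
    conv_lhs => rw [← divX_mul_X_add p]
    have e1 : ι X = PowerSeries.X := by
      simp [ι]
    have e2 : ι (C (p.coeff 0)) = ((p.coeff 0 : ℤ) : PowerSeries O) := by
      simp [ι]
    rw [map_add, map_mul, e1, e2, map_add, map_mul, PowerSeries.rescale_X, map_intCast]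
    ring
  let θs : PowerSeries O := PowerSeries.C θ
  let rs : PowerSeries O := PowerSeries.C r'
  obtain ⟨y, hXy, hy, -⟩ := exists_fixedPoint
    (newtonStep (3 * rs - ((σ₁.coeff 0 : ℤ) : PowerSeries O)) θs rs θs (δ σ₁) (δ σ₂) (δ σ₃))
    (X_dvd_newtonStep _ _ _ _ _ _ _) (newtonStep_contracts _ _ _ _ _ _ _)
  let Ξ : Fin 3 → (PowerSeries O →+* PowerSeries ℝ) := fun i =>
    (PowerSeries.rescale ((φ i θ)⁻¹ ^ 2)).comp (PowerSeries.map (φ i))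
  have hΞC : ∀ i z, Ξ i (PowerSeries.C z) = PowerSeries.C (φ i z) := by
    intro i z
    ext k
    simp only [Ξ, RingHom.comp_apply, PowerSeries.coeff_rescale, PowerSeries.map_C,
      PowerSeries.coeff_C]
    split_ifs with h <;> simp [h]
  have hΞX : ∀ i, Ξ i PowerSeries.X = PowerSeries.C ((φ i θ)⁻¹ ^ 2) * PowerSeries.X := by
    intro i
    simp only [Ξ, RingHom.comp_apply, PowerSeries.map_X, PowerSeries.rescale_X]
  have hΞι : ∀ i p, Ξ i (PowerSeries.rescale (θ ^ 2) (ι p)) = toSeries p := by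
    intro i p
    ext k
    simp only [Ξ, RingHom.comp_apply, PowerSeries.coeff_rescale, PowerSeries.coeff_map, hιc,
      coeff_toSeries, map_mul, map_pow, map_intCast]
    rw [← mul_assoc, ← mul_pow, ← mul_pow, inv_mul_cancel₀ (hθ0 i)]
    simp
  let αO : PowerSeries O := rs + θs * y
  have hcub : αO ^ 3 - PowerSeries.rescale (θ ^ 2) (ι σ₁) * αO ^ 2 +
      PowerSeries.rescale (θ ^ 2) (ι σ₂) * αO - PowerSeries.rescale (θ ^ 2) (ι σ₃) = 0 := by
    have hrs : rs ^ 3 - ((σ₁.coeff 0 : ℤ) : PowerSeries O) * rs ^ 2 +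
        ((σ₂.coeff 0 : ℤ) : PowerSeries O) * rs - ((σ₃.coeff 0 : ℤ) : PowerSeries O) = 0 := by
      have : r' ^ 3 - ((σ₁.coeff 0 : ℤ) : O) * r' ^ 2 + ((σ₂.coeff 0 : ℤ) : O) * r' -
          ((σ₃.coeff 0 : ℤ) : O) = 0 := by
        apply Subtype.ext
        funext i
        simpa [r'] using hr i
      have := congrArg (PowerSeries.C (R := O)) this
      simpa only [map_sub, map_add, map_mul, map_pow, map_intCast, map_zero] using this
    have hθs : θs = 3 * rs ^ 2 - 2 * ((σ₁.coeff 0 : ℤ) : PowerSeries O) * rs +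
        ((σ₂.coeff 0 : ℤ) : PowerSeries O) := by
      have : θ = 3 * r' ^ 2 - 2 * ((σ₁.coeff 0 : ℤ) : O) * r' + ((σ₂.coeff 0 : ℤ) : O) := by
        apply Subtype.ext
        funext i
        simp [r', θ]
        rfl
      have := congrArg (PowerSeries.C (R := O)) this
      simpa only [map_sub, map_add, map_mul, map_pow, map_intCast, map_ofNat] using this
    rw [hδ, hδ, hδ, map_pow]
    change _ - (_ + θs ^ 2 * _ * _) * _ + (_ + θs ^ 2 * _ * _) * _ - (_ + θs ^ 2 * _ * _) = 0
    simp only [newtonStep] at hy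
    simp only [αO]
    linear_combination hrs - θs ^ 2 * hy - θs * y * hθs
  refine ⟨fun i => Ξ i αO, ?_, ?_, ?_, ?_⟩
  · intro i
    have := congrArg (Ξ i) hcub
    simpa only [map_sub, map_add, map_mul, map_pow, hΞι, map_zero] using this
  · intro i
    obtain ⟨y', hy'⟩ := hXy
    simp only [αO, map_add, map_mul, hy', hΞX, rs, θs, hΞC]
    simp [hr']
  · intro i
    have hQ0 : (0 : ℝ) < Q := by linarith
    set ε := Q⁻¹ with hε
    have hε0 : 0 < ε := by positivity
    have hQε : Q * ε = 1 := mul_inv_cancel₀ hQ0.ne'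
    have hε1 : ε ≤ 1 / 8 := by
      rw [hε, inv_eq_one_div]; exact one_div_le_one_div_of_le (by norm_num) hQ
    have hε1' : ε ≤ 1 := by linarith
    have hρ : (0 : ℝ) ≤ ε ^ 40 := by positivity
    have hfix : newtonStep (PowerSeries.C (3 * r i - σ₁.coeff 0)) (PowerSeries.C (φ i θ))
        (PowerSeries.C (r i)) (PowerSeries.C (φ i θ))
        (PowerSeries.C ((φ i θ)⁻¹ ^ 2) * toSeries σ₁.divX)
        (PowerSeries.C ((φ i θ)⁻¹ ^ 2) * toSeries σ₂.divX)
        (PowerSeries.C ((φ i θ)⁻¹ ^ 2) * toSeries σ₃.divX) (Ξ i y) = Ξ i y := by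
      have := congrArg (Ξ i) hy
      conv_rhs => rw [← this]
      simp only [newtonStep, map_sub, map_add, map_mul, map_pow, map_neg, hΞX, rs, θs, hΞC, hr', δ,
        hΞι, map_intCast, map_ofNat]
      ring
    have hθi : |(φ i θ)⁻¹ ^ 2| ≤ 1 := by
      rw [abs_pow, abs_inv]
      exact pow_le_one₀ (by positivity) (inv_le_one_of_one_le₀ (hθ1 i))
    have hdm : ∀ (p : ℤ[X]) (M : ℝ), IntMaj p M →
        Maj (ε ^ 40) (PowerSeries.C ((φ i θ)⁻¹ ^ 2) * toSeries p.divX) M := by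
      intro p M hp
      have h1 : Maj (ε ^ 40) (toSeries p.divX) M :=
        Maj.anti hρ (pow_le_one₀ hε0.le hε1') hp.divX
      refine ((Maj.const _).mul hρ h1).mono ?_
      exact mul_le_of_le_one_left hp.nonneg hθi
    have hy1 : Maj (ε ^ 40) (Ξ i y) (ε ^ 20) := by
      refine maj_of_newtonStep_eq (by positivity) ?_ hfix ?_
      · obtain ⟨y', hy'⟩ := hXy
        rw [hy', map_mul, hΞX]
        exact ⟨PowerSeries.C ((φ i θ)⁻¹ ^ 2) * Ξ i y', by ring⟩
      · intro a ha
        have hα := (Maj.const (ρ := ε ^ 40) (r i)).add hρ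
          ((Maj.const (ρ := ε ^ 40) (φ i θ)).mul hρ ha)
        have hα' := hα.mono (show _ ≤ Q ^ 4 by
          have h1 := hrQ i
          have h2 := hθ2 i
          rw [← hθ] at h2
          have h3 : |φ i θ| * ε ^ 20 ≤ Q ^ 6 * ε ^ 20 := by gcongr
          have h4 : Q ^ 6 * ε ^ 20 = ε ^ 14 := by
            calc _ = (Q * ε) ^ 6 * ε ^ 14 := by ring
              _ = _ := by rw [hQε]; ring
          have h5 : ε ^ 14 ≤ 1 := pow_le_one₀ hε0.le hε1'
          have h6 : 8 * Q ^ 3 ≤ Q ^ 4 := by rw [pow_succ Q 3]; nlinarith [pow_pos hQ0 3]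
          have h7 : 1 ≤ Q ^ 3 := one_le_pow₀ (by linarith)
          linarith)
        have key := ((((Maj.const (ρ := ε ^ 40) (3 * r i - σ₁.coeff 0)).neg.mul hρ
          (ha.pow hρ 2)).sub hρ ((Maj.const (ρ := ε ^ 40) (φ i θ)).mul hρ (ha.pow hρ 3))).add hρ
          ((Maj.X hρ).mul hρ ((((hdm _ _ hσ₁).mul hρ (hα'.pow hρ 2)).sub hρ
            ((hdm _ _ hσ₂).mul hρ hα')).add hρ (hdm _ _ hσ₃))))
        refine Maj.mono key ?_
        have h2 := hθ2 i
        rw [← hθ] at h2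
        have b1 : |3 * r i - σ₁.coeff 0| * (ε ^ 20) ^ 2 ≤ ε ^ 36 := by
          calc _ ≤ Q ^ 4 * (ε ^ 20) ^ 2 := by gcongr; exact hA i
            _ = (Q * ε) ^ 4 * ε ^ 36 := by ring
            _ = _ := by rw [hQε]; ring
        have b2 : |φ i θ| * (ε ^ 20) ^ 3 ≤ ε ^ 54 := by
          calc _ ≤ Q ^ 6 * (ε ^ 20) ^ 3 := by gcongr
            _ = (Q * ε) ^ 6 * ε ^ 54 := by ring
            _ = _ := by rw [hQε]; ring
        have b3 : ε ^ 40 * (Q ^ 3 * (Q ^ 4) ^ 2 + Q ^ 5 * Q ^ 4 + Q ^ 7) =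
            ε ^ 29 + ε ^ 31 + ε ^ 33 := by
          calc _ = (Q * ε) ^ 11 * ε ^ 29 + (Q * ε) ^ 9 * ε ^ 31 + (Q * ε) ^ 7 * ε ^ 33 := by ring
            _ = _ := by rw [hQε]; ring
        have hm : ∀ n, ε ^ (21 + n) ≤ ε ^ 20 * (1 / 8) := by
          intro n
          calc ε ^ (21 + n) ≤ ε ^ 21 := pow_le_pow_of_le_one hε0.le hε1' (by omega)
            _ = ε ^ 20 * ε := by ring
            _ ≤ _ := by gcongr
        have e1 := hm 15
        have e2 := hm 33
        have e3 := hm 8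
        have e4 := hm 10
        have e5 := hm 12
        norm_num at e1 e2 e3 e4 e5
        have e0 : 0 < ε ^ 20 := by positivity
        rw [b3]
        linarith
    have h2 := hθ2 i
    rw [← hθ] at h2
    have : Ξ i αO - PowerSeries.C (r i) = PowerSeries.C (φ i θ) * Ξ i y := by
      simp only [αO, map_add, map_mul, rs, θs, hΞC, hr']
      ring
    rw [this]
    refine ((Maj.const _).mul hρ hy1).mono ?_
    calc _ ≤ Q ^ 6 * ε ^ 20 := by gcongr
      _ = (Q * ε) ^ 6 * ε ^ 14 := by ring
      _ = _ := by rw [hQε]; ring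
  · intro G a b c k
    let g : ℤ[X] →+* PowerSeries O := (PowerSeries.rescale (θ ^ 2)).comp ι
    let z : PowerSeries O := G.eval₂ g αO
    have hz : ∀ i, Ξ i z = G.eval₂ toSeries (Ξ i αO) := by
      intro i
      have : (Ξ i).comp g = toSeries := RingHom.ext fun p => hΞι i p
      rw [← this, ← Polynomial.hom_eval₂]
    have hdisc : ∀ i, cubicDisc (σ₁.coeff 0 : ℝ) (σ₂.coeff 0) (σ₃.coeff 0) =
        φ i θ ^ 2 * φ i w := by
      intro i
      change _ = (3 * r i ^ 2 - 2 * σ₁.coeff 0 * r i + σ₂.coeff 0) ^ 2 * (σ₁.coeff 0 ^ 2 -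
        4 * σ₂.coeff 0 + 2 * σ₁.coeff 0 * r i - 3 * r i ^ 2)
      rw [← v₁, ← v₂, ← v₃]
      unfold cubicDisc
      fin_cases i <;> simp <;> ring
    let v : O := ⟨fun i => a + b * r i + c * r i ^ 2, a, b, c, fun i => rfl⟩
    obtain ⟨a', b', c', hN⟩ := (v * (w ^ k * PowerSeries.coeff k z)).2
    refine ⟨3 * a' + b' * σ₁.coeff 0 + c' * (σ₁.coeff 0 ^ 2 - 2 * σ₂.coeff 0), ?_⟩
    have hterm : ∀ i, (a + b * r i + c * r i ^ 2) *
          (cubicDisc (σ₁.coeff 0 : ℝ) (σ₂.coeff 0) (σ₃.coeff 0) ^ k *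
          PowerSeries.coeff k (G.eval₂ toSeries (Ξ i αO))) = a' + b' * r i + c' * r i ^ 2 := by
      intro i
      rw [← hN i, ← hz, hdisc i]
      change _ = φ i (v * (w ^ k * PowerSeries.coeff k z))
      rw [map_mul, map_mul, map_pow]
      change (a + b * r i + c * r i ^ 2) * _ = (a + b * r i + c * r i ^ 2) * _
      congr 1
      simp only [Ξ, RingHom.comp_apply, PowerSeries.coeff_rescale, PowerSeries.coeff_map]
      have : (φ i θ) ^ 2 * (φ i θ)⁻¹ ^ 2 = 1 := by
        rw [← mul_pow, mul_inv_cancel₀ (hθ0 i), one_pow]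
      calc _ = ((φ i θ) ^ 2 * (φ i θ)⁻¹ ^ 2) ^ k * (φ i w ^ k * φ i (PowerSeries.coeff k z)) := by
            ring
        _ = _ := by rw [this, one_pow, one_mul]
    rw [Fin.sum_univ_three, hterm, hterm, hterm]
    push_cast
    rw [← v₁, ← v₂]
    ring

end deformation

section Jacobian
open Polynomial

/-- Hessian covariant of the binary cubic form `cubicNorm`. -/
def cubicHessian {R : Type*} [CommRing R] (s₁ s₂ s₃ c e : R) : R :=
  c ^ 2 * (s₁ ^ 2 - 3 * s₂) + c * e * (s₁ * s₂ - 9 * s₃) + e ^ 2 * (s₂ ^ 2 - 3 * s₁ * s₃)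

/-- The norm of `c + e a` for `a` a root of `X ^ 3 - s₁ X ^ 2 + s₂ X - s₃`. -/
def cubicNorm {R : Type*} [CommRing R] (s₁ s₂ s₃ c e : R) : R :=
  c ^ 3 + c ^ 2 * e * s₁ + c * e ^ 2 * s₂ + e ^ 3 * s₃

/-- A Jacobian that detects vanishing of the Wronskian of two conjugates of `c + e a`. -/
noncomputable def jacobian (s₁ s₂ s₃ c e : ℤ[X]) : ℤ[X] :=
  3 * derivative (cubicDisc s₁ s₂ s₃ * cubicHessian s₁ s₂ s₃ c e) *
      (cubicDisc s₁ s₂ s₃ ^ 2 * cubicNorm s₁ s₂ s₃ c e) -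
    2 * (cubicDisc s₁ s₂ s₃ * cubicHessian s₁ s₂ s₃ c e) *
      derivative (cubicDisc s₁ s₂ s₃ ^ 2 * cubicNorm s₁ s₂ s₃ c e)

lemma intMaj_jacobian {μ : ℕ} (hμ : 1 ≤ μ) {s₁ s₂ s₃ c e : ℤ[X]}
    (hd1 : s₁.natDegree ≤ 2) (hd2 : s₂.natDegree ≤ 4) (hd3 : s₃.natDegree ≤ 6)
    (h1 : IntMaj s₁ 20) (h2 : IntMaj s₂ 100) (h3 : IntMaj s₃ 27)
    (hdc : c.natDegree ≤ 7 * μ + 3) (hde : e.natDegree ≤ 7 * μ + 1)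
    (hc : IntMaj c (2 ^ (150 * μ))) (he : IntMaj e (2 ^ (150 * μ))) :
    IntMaj (jacobian s₁ s₂ s₃ c e) (2 ^ (900 * μ)) := by
  set M : ℝ := 2 ^ (150 * μ) with hM
  have hM0 : 0 < M := by positivity
  have T1 : IntMaj (cubicDisc s₁ s₂ s₃) (2 ^ 24) := by
    refine IntMaj.mono (((((((h1.pow 2).mul (h2.pow 2)).sub ((IntMaj.ofNat 4).mul (h2.pow 3))).sub
      (((IntMaj.ofNat 4).mul (h1.pow 3)).mul h3)).add
      ((((IntMaj.ofNat 18).mul h1).mul h2).mul h3)).sub ((IntMaj.ofNat 27).mul (h3.pow 2)))) ?_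
    norm_num
  have T2 : (cubicDisc s₁ s₂ s₃).natDegree ≤ 12 := by
    unfold cubicDisc
    compute_degree
    omega
  have H1 : IntMaj (cubicHessian s₁ s₂ s₃ c e) (2 ^ 14 * M ^ 2) := by
    refine IntMaj.mono (((((hc.pow 2).mul ((h1.pow 2).sub ((IntMaj.ofNat 3).mul h2))).add
      ((hc.mul he).mul ((h1.mul h2).sub ((IntMaj.ofNat 9).mul h3)))).add
      ((he.pow 2).mul ((h2.pow 2).sub (((IntMaj.ofNat 3).mul h1).mul h3))))) ?_
    nlinarith [sq_nonneg M]
  have H2 : (cubicHessian s₁ s₂ s₃ c e).natDegree ≤ 14 * μ + 14 := by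
    unfold cubicHessian
    compute_degree
    omega
  have N1 : IntMaj (cubicNorm s₁ s₂ s₃ c e) (2 ^ 8 * M ^ 3) := by
    refine IntMaj.mono (((((hc.pow 3).add (((hc.pow 2).mul he).mul h1))).add
      ((hc.mul (he.pow 2)).mul h2)).add ((he.pow 3).mul h3)) ?_
    nlinarith [pow_pos hM0 3]
  have N2 : (cubicNorm s₁ s₂ s₃ c e).natDegree ≤ 21 * μ + 9 := by
    unfold cubicNorm
    compute_degree
    omega
  have A1 := T1.mul H1
  have A2 : (cubicDisc s₁ s₂ s₃ * cubicHessian s₁ s₂ s₃ c e).natDegree ≤ 100 * μ :=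
    natDegree_mul_le.trans (by omega)
  have B1 := (T1.pow 2).mul N1
  have B2 : (cubicDisc s₁ s₂ s₃ ^ 2 * cubicNorm s₁ s₂ s₃ c e).natDegree ≤ 100 * μ := by
    have := natDegree_pow_le (p := cubicDisc s₁ s₂ s₃) (n := 2)
    exact natDegree_mul_le.trans (by omega)
  refine IntMaj.mono ((((IntMaj.ofNat 3).mul (A1.derivative A2)).mul B1).sub
    (((IntMaj.ofNat 2).mul A1).mul (B1.derivative B2))) ?_
  have hμ2 : (μ : ℝ) ≤ 2 ^ μ := by exact_mod_cast (Nat.lt_two_pow_self).le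
  have e1 : (2 : ℝ) ^ (900 * μ) = 2 ^ (149 * μ) * 2 ^ μ * M ^ 5 := by
    rw [hM, ← pow_mul, ← pow_add, ← pow_add]; congr 1; ring
  have e2 : (2 : ℝ) ^ 110 ≤ 2 ^ (149 * μ) := pow_le_pow_right₀ one_le_two (by omega)
  rw [e1]
  push_cast
  calc _ = 500 * (2 ^ 94) * μ * M ^ 5 := by ring
    _ ≤ 2 ^ 110 * μ * M ^ 5 := by gcongr; norm_num
    _ ≤ _ := by gcongr

/-- A high order relation between two conjugates forces a bound on `Q`. -/
lemma pow_le_of_relation {P Q : ℤ} (hQ : 0 < Q) (hPQ : IsCoprime P Q) {s₁ s₂ s₃ c e : ℤ[X]}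
    (a : Fin 3 → PowerSeries ℝ) (v₁ : a 0 + a 1 + a 2 = serAt P Q s₁)
    (v₂ : a 0 * a 1 + a 1 * a 2 + a 2 * a 0 = serAt P Q s₂)
    (v₃ : a 0 * a 1 * a 2 = serAt P Q s₃) {A : ℝ} (hJ : IntMaj (jacobian s₁ s₂ s₃ c e) A)
    (hJ0 : jacobian s₁ s₂ s₃ c e ≠ 0) {S : Fin 3 → PowerSeries ℝ}
    (hS : ∀ i, S i = (serAt P Q c + serAt P Q e * a i) *
      (3 * a i ^ 2 - 2 * serAt P Q s₁ * a i + serAt P Q s₂) *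
      (serAt P Q s₁ ^ 2 - 4 * serAt P Q s₂ + 2 * serAt P Q s₁ * a i - 3 * a i ^ 2))
    {l₁ l₂ : ℝ} (hl : l₁ ≠ 0) {K : ℕ}
    (h : PowerSeries.X ^ (K + 1) ∣ PowerSeries.C l₁ * S 0 + PowerSeries.C l₂ * S 1) :
    (Q : ℝ) ^ K ≤ A := by
  refine pow_le_of_X_pow_dvd_serAt hQ hPQ hJ hJ0 ?_
  set s := serAt P Q
  set D := PowerSeries.derivative ℝ with hD
  have hsum : S 0 + S 1 + S 2 = 0 := by
    rw [hS, hS, hS, ← v₁, ← v₂]; ring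
  have hE2 : S 0 * S 1 + S 1 * S 2 + S 2 * S 0 =
      - s (cubicDisc s₁ s₂ s₃ * cubicHessian s₁ s₂ s₃ c e) := by
    simp only [cubicDisc, cubicHessian, map_add, map_sub, map_mul, map_pow, map_ofNat]
    rw [hS, hS, hS, ← v₁, ← v₂, ← v₃]; ring
  have hE3 : S 0 * S 1 * S 2 = - s (cubicDisc s₁ s₂ s₃ ^ 2 * cubicNorm s₁ s₂ s₃ c e) := by
    simp only [cubicDisc, cubicNorm, map_add, map_sub, map_mul, map_pow, map_ofNat]
    rw [hS, hS, hS, ← v₁, ← v₂, ← v₃]; ring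
  have hS2 : S 2 = -S 0 - S 1 := by linear_combination hsum
  rw [hS2] at hE2 hE3
  have hQ' : (Q : ℝ) ≠ 0 := by exact_mod_cast hQ.ne'
  have hder : ∀ p : ℤ[X], s (derivative p) = PowerSeries.C (Q : ℝ) * D (s p) := by
    intro p
    rw [hD, derivative_serAt, ← mul_assoc, ← map_mul, mul_one_div_cancel hQ', map_one, one_mul]
  have hW : PowerSeries.X ^ K ∣ S 0 * D (S 1) - D (S 0) * S 1 := by
    obtain ⟨g, hg⟩ := h
    have hg' := congrArg D hg
    have hDC : ∀ r : ℝ, D (PowerSeries.C r) = 0 := by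
      intro r; ext k; simp [hD]
    rw [map_add, Derivation.leibniz, Derivation.leibniz, Derivation.leibniz, hDC, hDC,
      Derivation.leibniz_pow] at hg'
    simp only [smul_eq_mul, mul_zero, add_zero, Nat.add_sub_cancel, nsmul_eq_mul] at hg'
    have hC : PowerSeries.C l₁⁻¹ * PowerSeries.C l₁ = 1 := by
      rw [← map_mul, inv_mul_cancel₀ hl, map_one]
    refine ⟨PowerSeries.C l₁⁻¹ * (PowerSeries.X * g * D (S 1) - (PowerSeries.X * D g +
      g * (((K + 1 : ℕ) : PowerSeries ℝ) * D PowerSeries.X)) * S 1), ?_⟩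
    linear_combination (PowerSeries.C l₁⁻¹ * D (S 1)) * hg - PowerSeries.C l₁⁻¹ * S 1 * hg' -
      (S 0 * D (S 1) - D (S 0) * S 1) * hC
  obtain ⟨g, hg⟩ := hW
  have hE2' := congrArg D hE2
  have hE3' := congrArg D hE3
  simp only [map_add, map_sub, map_neg, Derivation.leibniz, smul_eq_mul] at hE2' hE3'
  refine ⟨PowerSeries.C (Q : ℝ) * (-(2 * S 0 + S 1) * (S 0 + 2 * S 1) * (S 0 - S 1) * g), ?_⟩
  unfold jacobian
  rw [map_sub, map_mul s, map_mul s 3, map_mul s (2 * _), map_mul s 2, hder, hder, map_ofNat,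
    map_ofNat]
  have i1 : s (cubicDisc s₁ s₂ s₃ * cubicHessian s₁ s₂ s₃ c e) =
    -(S 0 * S 1 + S 1 * (-S 0 - S 1) + (-S 0 - S 1) * S 0) := by rw [hE2]; ring
  have i2 : s (cubicDisc s₁ s₂ s₃ ^ 2 * cubicNorm s₁ s₂ s₃ c e) =
    -(S 0 * S 1 * (-S 0 - S 1)) := by rw [hE3]; ring
  rw [i1, i2]
  simp only [map_add, map_sub, map_neg, Derivation.leibniz, smul_eq_mul]
  linear_combination (PowerSeries.C (Q : ℝ) * (-(2 * S 0 + S 1) * (S 0 + 2 * S 1) * (S 0 - S 1))) * hg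

lemma exists_pow_mul_pair {L c e : ℤ[X]} (hL : 1 ≤ L.natDegree) (h : c ≠ 0 ∨ e ≠ 0) :
    ∃ (i : ℕ) (c' e' : ℤ[X]), c = L ^ i * c' ∧ e = L ^ i * e' ∧ ¬(L ∣ c' ∧ L ∣ e') := by
  have hL0 : L ≠ 0 := by rintro rfl; simp at hL
  induction hn : c.natDegree + e.natDegree using Nat.strong_induction_on generalizing c e with
  | _ n ih =>
    by_cases hd : L ∣ c ∧ L ∣ e
    · obtain ⟨⟨c', rfl⟩, ⟨e', rfl⟩⟩ := hd
      have h' : c' ≠ 0 ∨ e' ≠ 0 := h.imp right_ne_zero_of_mul right_ne_zero_of_mul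
      have hlt : c'.natDegree + e'.natDegree < n := by
        rw [← hn]
        by_cases hc : c' = 0
        · have he := h'.resolve_left (not_not.2 hc)
          rw [hc, mul_zero, natDegree_mul hL0 he]
          omega
        · rw [natDegree_mul hL0 hc]
          by_cases he : e' = 0
          · rw [he, mul_zero]; omega
          · rw [natDegree_mul hL0 he]; omega
      obtain ⟨i, c'', e'', h1, h2, h3⟩ := ih _ hlt h' rfl
      exact ⟨i + 1, c'', e'', by rw [pow_succ', mul_assoc, ← h1], by rw [pow_succ', mul_assoc, ← h2],
        h3⟩
    · exact ⟨0, c, e, by simp, by simp, hd⟩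

lemma eq_zero_of_log_derivative {h g : ℝ[X]} {t : ℝ} (hh : h.eval t ≠ 0) (hg : g.eval t = 0)
    (H : 3 * derivative h * g = 2 * h * derivative g) : g = 0 := by
  by_contra hg0
  obtain ⟨q, hq, hqt⟩ := exists_eq_pow_rootMultiplicity_mul_and_not_dvd g hg0 t
  set k := g.rootMultiplicity t
  have hk : 0 < k := (rootMultiplicity_pos hg0).2 hg
  obtain ⟨k', hk'⟩ := Nat.exists_eq_succ_of_ne_zero hk.ne'
  rw [hk', Nat.succ_eq_add_one] at hq
  rw [dvd_iff_isRoot, IsRoot] at hqt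
  have hne : (X - C t) ^ k' ≠ 0 := pow_ne_zero _ (X_sub_C_ne_zero t)
  have h2 : 3 * derivative h * (X - C t) * q =
      2 * h * (((k' + 1 : ℕ) : ℝ[X]) * q + (X - C t) * derivative q) := by
    apply mul_left_cancel₀ hne
    rw [hq, derivative_mul, derivative_pow] at H
    simp only [derivative_sub, derivative_X, derivative_C, sub_zero, mul_one,
      Nat.add_sub_cancel, map_natCast] at H
    linear_combination H
  have h3 := congrArg (eval t) h2
  simp only [eval_mul, eval_add, eval_sub, eval_X, eval_C, sub_self, eval_natCast, mul_zero,
    zero_mul, add_zero, eval_ofNat] at h3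
  have : ((k' + 1 : ℕ) : ℝ) ≠ 0 := by positivity
  have := mul_ne_zero (mul_ne_zero two_ne_zero hh) (mul_ne_zero this hqt)
  exact this h3.symm

lemma Polynomial.Monic.dvd_of_dvd_C_mul {R : Type*} [CommRing R] [IsDomain R] {f p : R[X]} {n : R}
    (hf : f.Monic) (hn : n ≠ 0) (h : f ∣ C n * p) : f ∣ p := by
  rw [← modByMonic_eq_zero_iff_dvd hf, ← smul_eq_C_mul, smul_modByMonic, smul_eq_C_mul] at h
  rw [← modByMonic_eq_zero_iff_dvd hf]
  exact (mul_eq_zero.1 h).resolve_left (by simpa using hn)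

end Jacobian

section NonVanishing
open Polynomial

lemma X_sq_add_X_sub_one_dvd {p : ℤ[X]} {τ : ℝ} (hτ : τ ^ 2 + τ - 1 = 0)
    (hp : eval₂RingHom (Int.castRingHom ℝ) τ p = 0) : (X ^ 2 + X - 1 : ℤ[X]) ∣ p := by
  set N : ℤ[X] := X ^ 2 + X - 1 with hN
  have hdeg : N.natDegree = 2 := by rw [hN]; compute_degree!
  have hmon : N.Monic := by rw [hN]; monicity!
  have hr : (p %ₘ N).natDegree ≤ 1 := by
    have := natDegree_modByMonic_lt p hmon (by intro h; rw [h] at hdeg; simp at hdeg)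
    omega
  rw [← modByMonic_eq_zero_iff_dvd hmon]
  obtain ⟨b, a, hab⟩ := exists_eq_X_add_C_of_natDegree_le_one hr
  have h1 : (b : ℝ) * τ + a = 0 := by
    have h := congrArg (eval₂RingHom (Int.castRingHom ℝ) τ) (modByMonic_add_div p N)
    have hN0 : eval₂RingHom (Int.castRingHom ℝ) τ N = 0 := by
      rw [hN, map_sub, map_add, map_pow]; simpa using hτ
    rw [map_add, map_mul, hN0, hp, zero_mul, add_zero, hab] at h
    simpa only [map_add, map_mul, coe_eval₂RingHom, eval₂_C, eval₂_X, Int.coe_castRingHom] using h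
  have hb : b = 0 := by
    by_contra hb
    have hb' : (b : ℝ) ≠ 0 := by exact_mod_cast hb
    have h2 : (5 : ℚ) = ((b - 2 * a : ℤ) / b : ℚ) * ((b - 2 * a : ℤ) / b : ℚ) := by
      have : (5 : ℝ) = ((b - 2 * a : ℤ) / b : ℝ) * ((b - 2 * a : ℤ) / b : ℝ) := by
        have h3 : ((b - 2 * a : ℤ) / b : ℝ) = 2 * τ + 1 := by
          field_simp; push_cast; linear_combination -2 * h1
        rw [h3]; linear_combination -4 * hτ
      exact_mod_cast this
    have h3 : IsSquare (5 : ℚ) := ⟨_, h2⟩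
    rw [Rat.isSquare_ofNat_iff] at h3
    obtain ⟨k, hk⟩ := h3
    have : k < 3 := by nlinarith
    interval_cases k <;> omega
  subst hb
  have ha : a = 0 := by simpa using h1
  rw [hab, ha]; simp

lemma cubicHessian_mul {R : Type*} [CommRing R] (s₁ s₂ s₃ n c e : R) :
    cubicHessian s₁ s₂ s₃ (n * c) (n * e) = n ^ 2 * cubicHessian s₁ s₂ s₃ c e := by
  unfold cubicHessian; ring

lemma cubicNorm_mul {R : Type*} [CommRing R] (s₁ s₂ s₃ n c e : R) :
    cubicNorm s₁ s₂ s₃ (n * c) (n * e) = n ^ 3 * cubicNorm s₁ s₂ s₃ c e := by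
  unfold cubicNorm; ring

lemma jacobian_mul (s₁ s₂ s₃ n c e : ℤ[X]) :
    jacobian s₁ s₂ s₃ (n * c) (n * e) = n ^ 5 * jacobian s₁ s₂ s₃ c e := by
  unfold jacobian
  rw [cubicHessian_mul, cubicNorm_mul]
  simp only [derivative_mul, derivative_pow]
  push_cast
  simp only [map_ofNat, pow_one]
  ring

lemma exists_root_of_cubicNorm_eq_zero {P Q : ℤ} (hQ : 0 < Q) (hPQ : IsCoprime P Q)
    {s₁ s₂ s₃ c e : ℤ[X]} (hce : c ≠ 0 ∨ e ≠ 0) (h : cubicNorm s₁ s₂ s₃ c e = 0) :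
    ∃ z : ℚ, z ^ 3 - eval₂RingHom (Int.castRingHom ℚ) (P / Q) s₁ * z ^ 2 +
      eval₂RingHom (Int.castRingHom ℚ) (P / Q) s₂ * z -
      eval₂RingHom (Int.castRingHom ℚ) (P / Q) s₃ = 0 := by
  set L : ℤ[X] := C Q * X - C P with hL
  have hLd : L.natDegree = 1 := by
    rw [hL, sub_eq_add_neg, ← C_neg]; exact natDegree_linear hQ.ne'
  have hL0 : L ≠ 0 := by intro h0; rw [h0] at hLd; simp at hLd
  obtain ⟨i, c', e', rfl, rfl, hnd⟩ := exists_pow_mul_pair hLd.ge hce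
  rw [cubicNorm_mul] at h
  have h' := (mul_eq_zero.1 h).resolve_left (pow_ne_zero _ (pow_ne_zero _ hL0))
  set ev := eval₂RingHom (Int.castRingHom ℚ) ((P : ℚ) / Q) with hev
  have hdvd : ∀ p : ℤ[X], ev p = 0 → L ∣ p := by
    intro p hp
    have := pow_dvd_of_X_pow_dvd_serAt hQ.ne' hPQ 1 p ?_
    · rwa [pow_one] at this
    · rw [pow_one, PowerSeries.X_dvd_iff, constantCoeff_serAt]
      have h1 : (algebraMap ℚ ℝ) (ev p) = eval₂ (Int.castRingHom ℝ) ((P : ℝ) / Q) p := by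
        rw [hev, coe_eval₂RingHom, hom_eval₂]
        congr 1
        simp
      rw [← h1, hp, map_zero]
  have hN : cubicNorm (ev s₁) (ev s₂) (ev s₃) (ev c') (ev e') = 0 := by
    rw [← map_zero ev, ← h']; simp [cubicNorm]
  have he : ev e' ≠ 0 := by
    intro he
    refine hnd ⟨hdvd _ ?_, hdvd _ he⟩
    rw [he] at hN
    unfold cubicNorm at hN
    simpa using hN
  refine ⟨-(ev c') / ev e', ?_⟩
  unfold cubicNorm at hN
  field_simp
  linear_combination -hN

lemma jacobian_ne_zero {P Q : ℤ} (hQ : 0 < Q) (hPQ : IsCoprime P Q) {u v c e : ℤ[X]}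
    {x : Fin 3 → ℤ[X]} {ν : ℤ} (hν : ν ≠ 0) {m : ℕ} {τ : ℝ} (hτ : τ ^ 2 + τ - 1 = 0)
    (hu : eval₂RingHom (Int.castRingHom ℝ) τ u ≠ 0)
    (hv : eval₂RingHom (Int.castRingHom ℝ) τ v ≠ 0)
    (huv : eval₂RingHom (Int.castRingHom ℝ) τ (u - v) ≠ 0)
    (hdc : c.natDegree < 6 * m) (hde : e.natDegree < 6 * m) (hx : x ≠ 0)
    (hid : ∀ (S : Type) [CommRing S] (g : ℤ[X] →+* S) (a : S),
      a ^ 3 - g (u + v) * a ^ 2 + g (u * v) * a - g (C ν * (X ^ 2 + X - 1) ^ 3) = 0 →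
      g c + g e * a = a ^ m * (g (x 0) + g (x 1) * a + g (x 2) * a ^ 2))
    (hirr : ∀ z : ℚ, z ^ 3 - eval₂RingHom (Int.castRingHom ℚ) (P / Q) (u + v) * z ^ 2 +
      eval₂RingHom (Int.castRingHom ℚ) (P / Q) (u * v) * z -
      eval₂RingHom (Int.castRingHom ℚ) (P / Q) (C ν * (X ^ 2 + X - 1) ^ 3) ≠ 0) :
    jacobian (u + v) (u * v) (C ν * (X ^ 2 + X - 1) ^ 3) c e ≠ 0 := by
  intro hJ
  set N : ℤ[X] := X ^ 2 + X - 1 with hN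
  set s₁ := u + v with hs₁
  set s₂ := u * v with hs₂
  set s₃ := C ν * N ^ 3 with hs₃
  set ev := eval₂RingHom (Int.castRingHom ℝ) τ with hev
  have hNd : N.natDegree = 2 := by rw [hN]; compute_degree!
  have hN0 : N ≠ 0 := by intro h0; rw [h0] at hNd; simp at hNd
  have hevN : ev N = 0 := by rw [hev, hN, map_sub, map_add, map_pow]; simpa using hτ
  have hs30 : ev s₃ = 0 := by rw [hs₃, map_mul, map_pow, hevN]; ring
  have hs20 : ev s₂ ≠ 0 := by rw [hs₂, map_mul]; exact mul_ne_zero hu hv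
  have hs3ne : s₃ ≠ 0 := mul_ne_zero (C_ne_zero.2 hν) (pow_ne_zero _ hN0)
  set f : Polynomial ℤ[X] := X ^ 3 - C s₁ * X ^ 2 + C s₂ * X - C s₃ with hf
  have hfd : f.natDegree = 3 := by rw [hf]; compute_degree!
  have hfm : f.Monic := by rw [hf]; monicity!
  have key : f ∣ (X ^ 2 - C s₁ * X + C s₂) ^ m * (C c + C e * X) -
      C (s₃ ^ m) * (C (x 0) + C (x 1) * X + C (x 2) * X ^ 2) := by
    rw [← AdjoinRoot.mk_eq_zero]
    set a := AdjoinRoot.root f with ha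
    have hroot : a ^ 3 - AdjoinRoot.of f s₁ * a ^ 2 + AdjoinRoot.of f s₂ * a
        - AdjoinRoot.of f s₃ = 0 := by
      have h1 : AdjoinRoot.mk f (X ^ 3 - C s₁ * X ^ 2 + C s₂ * X - C s₃) = 0 :=
        AdjoinRoot.mk_self (f := f)
      simpa only [map_sub, map_add, map_mul, map_pow, AdjoinRoot.mk_C, AdjoinRoot.mk_X] using h1
    have h1 := hid _ (AdjoinRoot.of f) a hroot
    simp only [map_sub, map_mul, map_add, map_pow, AdjoinRoot.mk_C, AdjoinRoot.mk_X]
    rw [← ha, h1, ← mul_assoc, ← mul_pow]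
    have h2 : (a ^ 2 - AdjoinRoot.of f s₁ * a + AdjoinRoot.of f s₂) * a = AdjoinRoot.of f s₃ := by
      linear_combination hroot
    rw [h2]; ring
  have hdlt : (C (x 0) + C (x 1) * X + C (x 2) * X ^ 2 : Polynomial ℤ[X]).natDegree < 3 :=
    Nat.lt_succ_of_le (by compute_degree!)
  have hce : c ≠ 0 ∨ e ≠ 0 := by
    by_contra! hce
    rw [hce.1, hce.2] at key
    rw [map_zero, zero_mul, add_zero, mul_zero, zero_sub] at key
    obtain ⟨w, hw⟩ := key
    have h1 := hfm.dvd_of_dvd_C_mul (pow_ne_zero m hs3ne)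
      (p := C (x 0) + C (x 1) * X + C (x 2) * X ^ 2) ⟨-w, by linear_combination -hw⟩
    have h2 := eq_zero_of_dvd_of_natDegree_lt h1 (by omega)
    apply hx
    funext i
    have h3 := fun k => congrArg (fun p => coeff p k) h2
    fin_cases i
    · simpa [coeff_X, coeff_C, coeff_X_pow] using h3 0
    · simpa [coeff_X, coeff_C, coeff_X_pow] using h3 1
    · simpa [coeff_X, coeff_C, coeff_X_pow] using h3 2
  obtain ⟨i, c', e', rfl, rfl, hnd⟩ := exists_pow_mul_pair (L := N) (by omega) hce
  have hce' : c' ≠ 0 ∨ e' ≠ 0 := hce.imp right_ne_zero_of_mul right_ne_zero_of_mul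
  have him : i < 3 * m := by
    rcases hce' with h | h
    · rw [natDegree_mul (pow_ne_zero _ hN0) h, natDegree_pow, hNd] at hdc; omega
    · rw [natDegree_mul (pow_ne_zero _ hN0) h, natDegree_pow, hNd] at hde; omega
  obtain ⟨k, hk⟩ : ∃ k, 3 * m = i + (k + 1) := ⟨3 * m - i - 1, by omega⟩
  have key2 : f ∣ (X ^ 2 - C s₁ * X + C s₂) ^ m * (C c' + C e' * X) -
      C (C ν ^ m * N ^ (k + 1)) * (C (x 0) + C (x 1) * X + C (x 2) * X ^ 2) := by
    refine hfm.dvd_of_dvd_C_mul (n := N ^ i) (pow_ne_zero _ hN0) ?_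
    convert key using 1
    rw [hs₃, mul_pow, ← pow_mul, hk, pow_add N i]
    simp only [map_mul]
    ring
  have hc' : ev c' = 0 := by
    have h1 := map_dvd (eval₂RingHom ev 0) key2
    rw [hf] at h1
    simp only [map_sub, map_add, map_mul, map_pow, coe_eval₂RingHom, eval₂_X, eval₂_C] at h1
    rw [hs30, hevN] at h1
    have h2 : ev s₂ ^ m * ev c' = 0 := by
      have h3 := zero_dvd_iff.1 (by simpa only [ne_eq, OfNat.ofNat_ne_zero, not_false_eq_true,
        zero_pow, mul_zero, sub_zero, add_zero] using h1)
      simpa using h3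
    exact (mul_eq_zero.1 h2).resolve_left (pow_ne_zero _ hs20)
  have hNc : N ∣ c' := X_sq_add_X_sub_one_dvd hτ hc'
  have he' : ev e' ≠ 0 := fun h => hnd ⟨hNc, X_sq_add_X_sub_one_dvd hτ h⟩
  rw [jacobian_mul] at hJ
  have hJ' := (mul_eq_zero.1 hJ).resolve_left (pow_ne_zero _ (pow_ne_zero _ hN0))
  set T := cubicDisc s₁ s₂ s₃ with hT
  have hTev : ev T ≠ 0 := by
    have : ev T = (ev u * ev v * ev (u - v)) ^ 2 := by
      rw [hT]; unfold cubicDisc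
      simp only [map_sub, map_add, map_mul, map_pow, hs30, map_ofNat]
      rw [hs₁, hs₂]; simp only [map_add, map_mul]; ring
    rw [this]
    exact pow_ne_zero _ (mul_ne_zero (mul_ne_zero hu hv) huv)
  have hg : (T ^ 2 * cubicNorm s₁ s₂ s₃ c' e').map (Int.castRingHom ℝ) = 0 := by
    refine eq_zero_of_log_derivative
      (h := (T * cubicHessian s₁ s₂ s₃ c' e').map (Int.castRingHom ℝ)) (t := τ) ?_ ?_ ?_
    · rw [eval_map, ← coe_eval₂RingHom, ← hev, map_mul]
      refine mul_ne_zero hTev ?_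
      have : ev (cubicHessian s₁ s₂ s₃ c' e') = ev e' ^ 2 * ev s₂ ^ 2 := by
        unfold cubicHessian
        simp only [map_sub, map_add, map_mul, map_pow, hs30, hc', map_ofNat]
        ring
      rw [this]
      exact mul_ne_zero (pow_ne_zero _ he') (pow_ne_zero _ hs20)
    · rw [eval_map, ← coe_eval₂RingHom, ← hev, map_mul]
      have : ev (cubicNorm s₁ s₂ s₃ c' e') = 0 := by
        unfold cubicNorm
        simp only [map_add, map_mul, map_pow, hs30, hc']
        ring
      rw [this, mul_zero]
    · have h1 := congrArg (Polynomial.map (Int.castRingHom ℝ)) (sub_eq_zero.1 hJ')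
      rw [← hT] at h1
      rw [derivative_map, derivative_map]
      simpa only [Polynomial.map_mul, Polynomial.map_ofNat] using h1
  have hg' := (Polynomial.map_eq_zero_iff (RingHom.injective_int _)).1 hg
  have hT0 : T ≠ 0 := by intro h0; apply hTev; rw [h0, map_zero]
  have hn := (mul_eq_zero.1 hg').resolve_left (pow_ne_zero _ hT0)
  obtain ⟨z, hz⟩ := exists_root_of_cubicNorm_eq_zero hQ hPQ hce' hn
  exact hirr z hz

end NonVanishing

section CubicRoots
open Polynomial

lemma rat_mul_sub_mul_sub_ne_one {U V : ℤ} (hU : 3 ≤ |U|) (w : ℚ) :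
    w * (w - U) * (w - V) ≠ 1 := by
  intro h
  have hw_int : IsIntegral ℤ w := by
    refine ⟨X ^ 3 - C (U + V) * X ^ 2 + C (U * V) * X - C 1, by monicity!, ?_⟩
    simp only [eval₂_sub, eval₂_add, eval₂_mul, eval₂_pow, eval₂_X, eval₂_C, algebraMap_int_eq,
      Int.coe_castRingHom]
    push_cast
    linear_combination h
  obtain ⟨n, rfl⟩ := IsIntegrallyClosed.isIntegral_iff.1 hw_int
  simp only [algebraMap_int_eq, eq_intCast] at h
  have h' : n * (n - U) * (n - V) = 1 := by exact_mod_cast h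
  have h1 : IsUnit n := IsUnit.of_mul_eq_one ((n - U) * (n - V)) (by linear_combination h')
  have h2 : IsUnit (n - U) := IsUnit.of_mul_eq_one (n * (n - V)) (by linear_combination h')
  rw [Int.isUnit_iff] at h1 h2
  rcases abs_cases U with h3 | h3 <;> omega

/-- Vieta's formulas for a cubic with three distinct roots. -/
lemma vieta_of_distinct {R : Type*} [CommRing R] [IsDomain R] {x y z s₁ s₂ s₃ : R}
    (hxy : x ≠ y) (hyz : y ≠ z) (hxz : x ≠ z)
    (hx : x ^ 3 - s₁ * x ^ 2 + s₂ * x - s₃ = 0) (hy : y ^ 3 - s₁ * y ^ 2 + s₂ * y - s₃ = 0)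
    (hz : z ^ 3 - s₁ * z ^ 2 + s₂ * z - s₃ = 0) :
    x + y + z = s₁ ∧ x * y + y * z + z * x = s₂ ∧ x * y * z = s₃ := by
  have h1 : x ^ 2 + x * y + y ^ 2 - s₁ * (x + y) + s₂ = 0 := by
    apply mul_left_cancel₀ (sub_ne_zero.2 hxy); linear_combination hx - hy
  have h2 : y ^ 2 + y * z + z ^ 2 - s₁ * (y + z) + s₂ = 0 := by
    apply mul_left_cancel₀ (sub_ne_zero.2 hyz); linear_combination hy - hz
  have h3 : x + y + z - s₁ = 0 := by
    apply mul_left_cancel₀ (sub_ne_zero.2 hxz); linear_combination h1 - h2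
  have h4 : x * y + y * z + z * x = s₂ := by linear_combination -h1 + (x + y) * h3
  exact ⟨sub_eq_zero.1 h3, h4, by linear_combination hx - x ^ 2 * h3 + x * h4⟩

lemma exists_root_near {A B D L : ℝ} (hL : 4 ≤ L) (hB : L ≤ |B - A|) (hD : L ≤ |D - A|) :
    ∃ r, |r - A| ≤ 2 / L ^ 2 ∧ (r - A) * (r - B) * (r - D) = 1 := by
  set δ := 2 / L ^ 2 with hδ
  have hL0 : 0 < L := by linarith
  have hδ0 : 0 < δ := by positivity
  have hδL : δ * L ^ 2 = 2 := by rw [hδ]; field_simp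
  have hδ1 : δ ≤ 1 / 8 := by rw [hδ, div_le_div_iff₀ (by positivity) (by norm_num)]; nlinarith
  have hδL1 : δ * L ≤ 1 / 2 := by nlinarith
  have hlb : ∀ s t : ℝ, L - δ ≤ s → L - δ ≤ t → 1 ≤ δ * s * t := by
    intro s t hs ht
    have : (L - δ) * (L - δ) ≤ s * t := mul_le_mul hs ht (by linarith) (by linarith)
    nlinarith
  have hcont : ContinuousOn (fun x : ℝ => (x - A) * (x - B) * (x - D)) (Set.Icc (A - δ) (A + δ)) := by
    fun_prop
  have hle : A - δ ≤ A + δ := by linarith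
  have key : ∃ r ∈ Set.Icc (A - δ) (A + δ), (r - A) * (r - B) * (r - D) = 1 := by
    rcases abs_cases (B - A) with ⟨h1, h2⟩ | ⟨h1, h2⟩ <;>
      rcases abs_cases (D - A) with ⟨h3, h4⟩ | ⟨h3, h4⟩
    · refine intermediate_value_Icc hle hcont ⟨?_, ?_⟩
      · have := hlb (B - A + δ) (D - A + δ) (by linarith) (by linarith)
        nlinarith
      · have := hlb (B - A - δ) (D - A - δ) (by linarith) (by linarith)
        nlinarith
    · refine intermediate_value_Icc' hle hcont ⟨?_, ?_⟩
      · have := hlb (B - A - δ) (A - D + δ) (by linarith) (by linarith)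
        nlinarith
      · have := hlb (B - A + δ) (A - D - δ) (by linarith) (by linarith)
        nlinarith
    · refine intermediate_value_Icc' hle hcont ⟨?_, ?_⟩
      · have := hlb (A - B + δ) (D - A - δ) (by linarith) (by linarith)
        nlinarith
      · have := hlb (A - B - δ) (D - A + δ) (by linarith) (by linarith)
        nlinarith
    · refine intermediate_value_Icc hle hcont ⟨?_, ?_⟩
      · have := hlb (A - B - δ) (A - D - δ) (by linarith) (by linarith)
        nlinarith
      · have := hlb (A - B + δ) (A - D + δ) (by linarith) (by linarith)
        nlinarith
  obtain ⟨r, hr, h⟩ := key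
  exact ⟨r, abs_le.2 ⟨by linarith [hr.1], by linarith [hr.2]⟩, h⟩

lemma exists_cubic_roots {U V L : ℝ} (hL : 4 ≤ L) (hU : L ≤ |U|) (hV : L ≤ |V|)
    (hUV : L ≤ |U - V|) :
    ∃ r : Fin 3 → ℝ, r 0 + r 1 + r 2 = U + V ∧ r 0 * r 1 + r 1 * r 2 + r 2 * r 0 = U * V ∧
      r 0 * r 1 * r 2 = 1 ∧ |r 0| ≤ 2 / L ^ 2 ∧ |r 1 - U| ≤ 2 / L ^ 2 ∧ |r 2 - V| ≤ 2 / L ^ 2 := by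
  have hδ1 : 2 / L ^ 2 ≤ 1 / 8 := by
    rw [div_le_div_iff₀ (by positivity) (by norm_num)]; nlinarith
  obtain ⟨x, hx, hx'⟩ := exists_root_near (A := 0) (B := U) (D := V) hL (by simpa) (by simpa)
  obtain ⟨y, hy, hy'⟩ := exists_root_near (A := U) (B := 0) (D := V) hL (by simpa)
    (by rwa [abs_sub_comm])
  obtain ⟨z, hz, hz'⟩ := exists_root_near (A := V) (B := 0) (D := U) hL (by simpa) hUV
  rw [sub_zero] at hx
  have hxy : x ≠ y := by
    rintro rfl
    have := abs_sub_abs_le_abs_sub U x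
    rw [abs_sub_comm] at this
    linarith
  have hxz : x ≠ z := by
    rintro rfl
    have := abs_sub_abs_le_abs_sub V x
    rw [abs_sub_comm] at this
    linarith
  have hyz : y ≠ z := by
    rintro rfl
    have := abs_sub_le U y V
    rw [abs_sub_comm U y] at this
    linarith
  obtain ⟨v1, v2, v3⟩ := vieta_of_distinct (s₁ := U + V) (s₂ := U * V) (s₃ := 1) hxy hyz hxz
    (by linear_combination hx') (by linear_combination hy') (by linear_combination hz')
  exact ⟨![x, y, z], v1, v2, v3, hx, hy, hz⟩

end CubicRoots

section AuxiliaryForms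
open Polynomial

variable {P Q U V ν : ℤ} {u v : ℤ[X]}

lemma IntMaj.shiftHom {p : ℤ[X]} {A : ℝ} {d : ℕ} (hP : 0 ≤ P) (hPQ : P + 1 ≤ Q)
    (hd : p.natDegree ≤ d) (hp : IntMaj p A) : IntMaj (shiftHom P Q d p) ((Q : ℝ) ^ d * A) := by
  have hP' : (0 : ℝ) ≤ P := by exact_mod_cast hP
  have hPQ' : (P : ℝ) + 1 ≤ Q := by exact_mod_cast hPQ
  unfold IntMaj
  rw [toSeries_shiftHom (by omega) hd]
  refine (Maj.mul zero_le_one (Maj.const _)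
    (hp.maj_serAt hP' hPQ' zero_le_one le_rfl)).mono (le_of_eq ?_)
  rw [abs_of_nonneg (pow_nonneg (by linarith) _)]

lemma coeff_zero_shiftHom {p : ℤ[X]} {d : ℕ} (hQ : Q ≠ 0) (hd : p.natDegree ≤ d) :
    ((_root_.shiftHom P Q d p).coeff 0 : ℝ) = (Q : ℝ) ^ d * eval₂RingHom (Int.castRingHom ℝ) (P / Q) p := by
  rw [← coeff_toSeries, toSeries_shiftHom hQ hd, PowerSeries.coeff_zero_eq_constantCoeff_apply,
    map_mul, constantCoeff_serAt, PowerSeries.constantCoeff_C, coe_eval₂RingHom]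

/-- Auxiliary power series: three conjugate series with zero sum, the first of which is very
small, with integrality and non-vanishing properties. -/
lemma exists_auxiliary_forms {τ : ℝ} (hQ8 : 2 ^ 10 ≤ Q) (hP : 0 ≤ P) (hPQ1 : P + 1 ≤ Q)
    (hPQ : IsCoprime P Q) (hν : P ^ 2 + P * Q - Q ^ 2 = ν) (hν2 : ν ^ 2 = 1)
    (hud : u.natDegree ≤ 2) (hvd : v.natDegree ≤ 2) (hu : IntMaj u 10) (hv : IntMaj v 10)
    (hτ : τ ^ 2 + τ - 1 = 0)
    (huτ : eval₂RingHom (Int.castRingHom ℝ) τ u ≠ 0)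
    (hvτ : eval₂RingHom (Int.castRingHom ℝ) τ v ≠ 0)
    (huvτ : eval₂RingHom (Int.castRingHom ℝ) τ (u - v) ≠ 0)
    (hU : (U : ℝ) = Q ^ 2 * eval₂RingHom (Int.castRingHom ℝ) (P / Q) u)
    (hV : (V : ℝ) = Q ^ 2 * eval₂RingHom (Int.castRingHom ℝ) (P / Q) v)
    (hU3 : 3 ≤ |U|) (hU10 : |(U : ℝ)| ≤ 10 * Q ^ 2) (hV10 : |(V : ℝ)| ≤ 10 * Q ^ 2)
    {r : Fin 3 → ℝ} (v₁ : r 0 + r 1 + r 2 = U + V)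
    (v₂ : r 0 * r 1 + r 1 * r 2 + r 2 * r 0 = U * V) (v₃ : r 0 * r 1 * r 2 = 1)
    (hr0 : |r 0| * Q ^ 4 ≤ 8) (hr1 : |r 1| ≤ 11 * Q ^ 2) (hr2 : |r 2| ≤ 11 * Q ^ 2)
    (h01 : 1 ≤ |r 0 - r 1|) (h12 : 1 ≤ |r 1 - r 2|) (h02 : 1 ≤ |r 0 - r 2|)
    {μ : ℕ} (hμ : 1 ≤ μ) :
    ∃ S : Fin 3 → PowerSeries ℝ, S 0 + S 1 + S 2 = 0 ∧
      Maj (((Q : ℝ)⁻¹) ^ 40) (S 0) (2 ^ (200 * μ) * ((Q : ℝ)⁻¹) ^ (12 * μ)) ∧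
      Maj (((Q : ℝ)⁻¹) ^ 40) (S 1) (2 ^ (200 * μ)) ∧
      (∀ (a b c : ℤ) (k : ℕ), ∃ N : ℤ, (Q : ℝ) ^ (7 * μ + 11) *
        cubicDisc ((U : ℝ) + V) (U * V) 1 ^ k *
        ∑ i, (a + b * r i + c * r i ^ 2) * PowerSeries.coeff k (S i) = N) ∧
      ∀ (l₁ l₂ : ℝ) (K : ℕ), l₁ ≠ 0 →
        PowerSeries.X ^ (K + 1) ∣ PowerSeries.C l₁ * S 0 + PowerSeries.C l₂ * S 1 →
        (Q : ℝ) ^ K ≤ 2 ^ (900 * μ) := by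
  have hQ0 : 0 < Q := by omega
  have hQR : (2 : ℝ) ^ 10 ≤ Q := by exact_mod_cast hQ8
  have hQ1 : (1 : ℝ) ≤ Q := by linarith
  have hQp : (0 : ℝ) < Q := by linarith
  have hQne : (Q : ℝ) ≠ 0 := hQp.ne'
  have hP' : (0 : ℝ) ≤ P := by exact_mod_cast hP
  have hPQ' : (P : ℝ) + 1 ≤ Q := by exact_mod_cast hPQ1
  set N : ℤ[X] := X ^ 2 + X - 1 with hN
  set s₁ := u + v with hs₁
  set s₂ := u * v with hs₂
  set s₃ := C ν * N ^ 3 with hs₃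
  have hNd : N.natDegree ≤ 2 := by rw [hN]; compute_degree!
  have hNM : IntMaj N 3 := by
    refine (((IntMaj.X.pow 2).add IntMaj.X).sub IntMaj.one).mono (by norm_num)
  have hνa : |(ν : ℝ)| = 1 := by
    have : (ν : ℝ) ^ 2 = 1 := by exact_mod_cast hν2
    rw [← sq_abs] at this
    nlinarith [abs_nonneg (ν : ℝ)]
  have d1 : s₁.natDegree ≤ 2 := natDegree_add_le_of_degree_le hud hvd
  have d2 : s₂.natDegree ≤ 4 := natDegree_mul_le_of_le hud hvd
  have d3 : s₃.natDegree ≤ 6 := by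
    refine (natDegree_C_mul_le _ _).trans (natDegree_pow_le_of_le 3 hNd)
  have m1 : IntMaj s₁ 20 := (hu.add hv).mono (by norm_num)
  have m2 : IntMaj s₂ 100 := (hu.mul hv).mono (by norm_num)
  have m3 : IntMaj s₃ 27 := ((IntMaj.C ν).mul (hNM.pow 3)).mono (by rw [hνa]; norm_num)
  set ev := eval₂RingHom (Int.castRingHom ℝ) ((P : ℝ) / Q) with hev
  have hevN : (Q : ℝ) ^ 2 * ev N = ν := by
    rw [hN, map_sub, map_add, map_pow, hev, coe_eval₂RingHom, eval₂_X, eval₂_one]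
    have : (P : ℝ) ^ 2 + P * Q - Q ^ 2 = ν := by exact_mod_cast hν
    field_simp
    linear_combination this
  have c1 : ((shiftHom P Q 2 s₁).coeff 0 : ℝ) = U + V := by
    rw [coeff_zero_shiftHom hQ0.ne' d1, hs₁, map_add, hU, hV]; ring
  have c2 : ((shiftHom P Q 4 s₂).coeff 0 : ℝ) = U * V := by
    rw [coeff_zero_shiftHom hQ0.ne' d2, hs₂, map_mul, hU, hV]; ring
  have c3 : ((shiftHom P Q 6 s₃).coeff 0 : ℝ) = 1 := by
    rw [coeff_zero_shiftHom hQ0.ne' d3, hs₃, map_mul, map_pow]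
    have h1 : eval₂RingHom (Int.castRingHom ℝ) ((P : ℝ) / Q) (C ν) = ν := by simp
    have h2 : (ν : ℝ) ^ 2 = 1 := by exact_mod_cast hν2
    rw [h1, ← hev]
    calc (Q : ℝ) ^ 6 * (ν * ev N ^ 3) = ν * (Q ^ 2 * ev N) ^ 3 := by ring
      _ = ((ν : ℝ) ^ 2) ^ 2 := by rw [hevN]; ring
      _ = 1 := by rw [h2]; norm_num
  have hθ : ∀ i, ∃ j k, 3 * r i ^ 2 - 2 * ((U : ℝ) + V) * r i + U * V = (r i - r j) * (r i - r k) ∧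
      1 ≤ |r i - r j| ∧ 1 ≤ |r i - r k| := by
    intro i
    rw [← v₁, ← v₂]
    fin_cases i
    · exact ⟨1, 2, by simp only [Fin.zero_eta]; ring, h01, h02⟩
    · exact ⟨0, 2, by simp only [Fin.mk_one]; ring, abs_sub_comm (r 0) (r 1) ▸ h01, h12⟩
    · exact ⟨0, 1, by simp only [Fin.reduceFinMk]; ring, abs_sub_comm (r 0) (r 2) ▸ h02,
        abs_sub_comm (r 1) (r 2) ▸ h12⟩
  have hr : ∀ i, |r i| ≤ 11 * (Q : ℝ) ^ 2 := by
    intro i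
    fin_cases i
    · refine le_trans ?_ (show (8 : ℝ) ≤ _ by nlinarith)
      refine le_trans ?_ hr0
      exact le_mul_of_one_le_right (abs_nonneg _) (one_le_pow₀ hQ1)
    · exact hr1
    · exact hr2
  have hQ2 : (2 : ℝ) ^ 10 * Q ^ 2 ≤ Q ^ 3 := by
    rw [pow_succ' (Q : ℝ) 2]; gcongr
  have hQ3 : (1 : ℝ) ≤ Q ^ 2 := one_le_pow₀ hQ1
  have hQ34 : (Q : ℝ) ^ 3 ≤ Q ^ 4 := pow_le_pow_right₀ hQ1 (by norm_num)
  obtain ⟨α, hα, hα0, hαM, hαI⟩ := exists_deformation (Q := Q) (by linarith)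
    (σ₁ := shiftHom P Q 2 s₁) (σ₂ := shiftHom P Q 4 s₂) (σ₃ := shiftHom P Q 6 s₃) r
    ((m1.shiftHom hP hPQ1 d1).mono (by linarith))
    ((m2.shiftHom hP hPQ1 d2).mono (by
      rw [pow_succ (Q : ℝ) 4]; gcongr; linarith))
    ((m3.shiftHom hP hPQ1 d3).mono (by
      rw [pow_succ (Q : ℝ) 6]; gcongr; linarith))
    (by rw [c1, v₁]) (by rw [c2, v₂]) (by rw [c3, v₃])
    (by
      intro i
      rw [c1]
      calc |3 * r i - ((U : ℝ) + V)| ≤ |3 * r i| + |(U : ℝ) + V| := abs_sub _ _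
        _ ≤ 3 * |r i| + (|(U : ℝ)| + |(V : ℝ)|) := by
          rw [abs_mul, abs_of_pos (by norm_num : (0 : ℝ) < 3)]; gcongr; exact abs_add_le _ _
        _ ≤ _ := by linarith [hr i])
    (by intro i; linarith [hr i])
    (by
      intro i
      rw [c1, c2]
      obtain ⟨j, k, h, h1, h2⟩ := hθ i
      rw [h, abs_mul]
      exact one_le_mul_of_one_le_of_one_le h1 h2)
    (by
      intro i
      rw [c1, c2]
      obtain ⟨j, k, h, h1, h2⟩ := hθ i
      have hd : ∀ i j, |r i - r j| ≤ (Q : ℝ) ^ 3 := fun i j =>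
        (abs_sub _ _).trans (by linarith [hr i, hr j])
      rw [h, abs_mul]
      calc _ ≤ (Q : ℝ) ^ 3 * Q ^ 3 := mul_le_mul (hd _ _) (hd _ _) (abs_nonneg _) (by positivity)
        _ = _ := by ring)
  rw [c1, c2, c3] at hαI
  set κ : PowerSeries ℝ := PowerSeries.C (Q : ℝ) with hκ
  set κ' : PowerSeries ℝ := PowerSeries.C ((Q : ℝ)⁻¹) with hκ'
  have hκκ : κ * κ' = 1 := by rw [hκ, hκ', ← map_mul, mul_inv_cancel₀ hQne, map_one]
  have hκ0 : κ ≠ 0 := left_ne_zero_of_mul_eq_one hκκ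
  set s := serAt (P : ℝ) Q with hs
  have t1 : toSeries (shiftHom P Q 2 s₁) = κ ^ 2 * s s₁ := by
    rw [toSeries_shiftHom hQ0.ne' d1, map_pow]
  have t2 : toSeries (shiftHom P Q 4 s₂) = κ ^ 4 * s s₂ := by
    rw [toSeries_shiftHom hQ0.ne' d2, map_pow]
  have t3 : toSeries (shiftHom P Q 6 s₃) = κ ^ 6 * s s₃ := by
    rw [toSeries_shiftHom hQ0.ne' d3, map_pow]
  set a : Fin 3 → PowerSeries ℝ := fun i => κ' ^ 2 * α i with ha
  have hαa : ∀ i, α i = κ ^ 2 * a i := by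
    intro i
    simp only [ha]
    linear_combination (-κ * κ' - 1) * α i * hκκ
  have hcub : ∀ i, a i ^ 3 - s s₁ * a i ^ 2 + s s₂ * a i - s s₃ = 0 := by
    intro i
    apply mul_left_cancel₀ (pow_ne_zero 6 hκ0)
    have := hα i
    rw [t1, t2, t3, hαa i] at this
    linear_combination this
  have hac : ∀ i, PowerSeries.constantCoeff (a i) = (Q : ℝ)⁻¹ ^ 2 * r i := by
    intro i
    simp only [ha]
    rw [map_mul, map_pow, hκ', PowerSeries.constantCoeff_C, hα0]
  have hane : ∀ i j, 1 ≤ |r i - r j| → a i ≠ a j := by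
    intro i j hij h
    have h1 := hac i
    rw [h, hac j] at h1
    have h2 := mul_left_cancel₀ (pow_ne_zero 2 (inv_ne_zero hQne)) h1
    rw [h2] at hij
    norm_num at hij
  obtain ⟨w₁, w₂, w₃⟩ := vieta_of_distinct (hane 0 1 h01) (hane 1 2 h12) (hane 0 2 h02)
    (hcub 0) (hcub 1) (hcub 2)
  obtain ⟨x, c, e, hx0, hxM, hcd, hed, hcM, heM, hid⟩ := exists_auxiliary hμ d1 d2 d3 m1 m2 m3
  have hJ0 : jacobian s₁ s₂ s₃ c e ≠ 0 := by
    refine jacobian_ne_zero (P := P) (Q := Q) (m := 2 * μ) hQ0 hPQ ?_ hτ huτ hvτ huvτ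
      (by omega) (by omega) hx0 hid ?_
    · rintro rfl; norm_num at hν2
    · intro z hz
      refine rat_mul_sub_mul_sub_ne_one (U := U) (V := V) hU3 ((Q : ℚ) ^ 2 * z) ?_
      have hQq : (Q : ℚ) ≠ 0 := by exact_mod_cast hQ0.ne'
      set eq := eval₂RingHom (Int.castRingHom ℚ) ((P : ℚ) / Q) with heq
      have hcast : ∀ p : ℤ[X], ((eq p : ℚ) : ℝ) = ev p := by
        intro p
        have : (algebraMap ℚ ℝ) (eq p) = ev p := by
          rw [heq, hev, coe_eval₂RingHom, hom_eval₂, coe_eval₂RingHom]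
          congr 1
          simp
        exact this
      have e1 : (Q : ℚ) ^ 2 * eq u = U := by
        have : (Q : ℝ) ^ 2 * (eq u : ℝ) = U := by rw [hcast, hU]
        exact_mod_cast this
      have e2 : (Q : ℚ) ^ 2 * eq v = V := by
        have : (Q : ℝ) ^ 2 * (eq v : ℝ) = V := by rw [hcast, hV]
        exact_mod_cast this
      have e3 : (Q : ℚ) ^ 6 * eq s₃ = 1 := by
        have : (Q : ℝ) ^ 6 * (eq s₃ : ℝ) = 1 := by
          rw [hcast, hev, ← coeff_zero_shiftHom hQ0.ne' d3, c3]
        exact_mod_cast this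
      rw [map_add, map_mul, ← hN, ← hs₃] at hz
      rw [← e1, ← e2]
      linear_combination (Q : ℚ) ^ 6 * hz + e3
  set S : Fin 3 → PowerSeries ℝ := fun i => (s c + s e * a i) *
      (3 * a i ^ 2 - 2 * s s₁ * a i + s s₂) *
      (s s₁ ^ 2 - 4 * s s₂ + 2 * s s₁ * a i - 3 * a i ^ 2) with hS
  set ρ : ℝ := (Q : ℝ)⁻¹ ^ 40 with hρdef
  have hi1 : (Q : ℝ)⁻¹ ≤ 1 := inv_le_one_of_one_le₀ hQ1
  have hi0 : 0 < (Q : ℝ)⁻¹ := inv_pos.2 hQp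
  have hρ : 0 ≤ ρ := by positivity
  have hρ1 : ρ ≤ 1 := pow_le_one₀ hi0.le hi1
  have hsM : ∀ {p : ℤ[X]} {A : ℝ}, IntMaj p A → Maj ρ (s p) A := fun hp =>
    hp.maj_serAt hP' hPQ' hρ hρ1
  have haM : ∀ i, Maj ρ (a i) ((Q : ℝ)⁻¹ ^ 2 * (|r i| + (Q : ℝ)⁻¹ ^ 14)) := by
    intro i
    have h1 : Maj ρ (α i) (|r i| + (Q : ℝ)⁻¹ ^ 14) := by
      have := (Maj.const (ρ := ρ) (r i)).add hρ (hαM i)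
      rwa [add_sub_cancel] at this
    have h2 : Maj ρ (κ' ^ 2) ((Q : ℝ)⁻¹ ^ 2) := by
      have := (Maj.const (ρ := ρ) ((Q : ℝ)⁻¹)).pow hρ 2
      rwa [abs_of_pos hi0] at this
    exact h2.mul hρ h1
  have hQi : ∀ n : ℕ, (Q : ℝ)⁻¹ ^ n * Q ^ n = 1 := fun n => by
    rw [← mul_pow, inv_mul_cancel₀ hQne, one_pow]
  have haM0 : Maj ρ (a 0) (2 ^ 4 * (Q : ℝ)⁻¹ ^ 6) := by
    refine (haM 0).mono ?_
    have h1 : |r 0| ≤ 8 * (Q : ℝ)⁻¹ ^ 4 := by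
      calc |r 0| = (|r 0| * Q ^ 4) * (Q : ℝ)⁻¹ ^ 4 := by
            rw [mul_assoc, mul_comm ((Q : ℝ) ^ 4), hQi, mul_one]
        _ ≤ _ := by gcongr
    have h2 : (Q : ℝ)⁻¹ ^ 14 ≤ (Q : ℝ)⁻¹ ^ 4 := pow_le_pow_of_le_one hi0.le hi1 (by norm_num)
    calc (Q : ℝ)⁻¹ ^ 2 * (|r 0| + (Q : ℝ)⁻¹ ^ 14) ≤
          (Q : ℝ)⁻¹ ^ 2 * (8 * (Q : ℝ)⁻¹ ^ 4 + (Q : ℝ)⁻¹ ^ 4) := by gcongr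
      _ = 9 * (Q : ℝ)⁻¹ ^ 6 := by ring
      _ ≤ _ := by gcongr; norm_num
  have haM1 : Maj ρ (a 1) 12 := by
    refine (haM 1).mono ?_
    have h2 : (Q : ℝ)⁻¹ ^ 14 ≤ 1 := pow_le_one₀ hi0.le hi1
    calc (Q : ℝ)⁻¹ ^ 2 * (|r 1| + (Q : ℝ)⁻¹ ^ 14) ≤ (Q : ℝ)⁻¹ ^ 2 * (11 * Q ^ 2 + Q ^ 2) := by
          gcongr; linarith
      _ = 12 * ((Q : ℝ)⁻¹ ^ 2 * Q ^ 2) := by ring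
      _ = 12 := by rw [hQi, mul_one]
  have haM0' : Maj ρ (a 0) 12 := haM0.mono (by
    have : (Q : ℝ)⁻¹ ^ 6 ≤ (Q : ℝ)⁻¹ ^ 1 := pow_le_pow_of_le_one hi0.le hi1 (by norm_num)
    have h2 : (Q : ℝ)⁻¹ ≤ 1 / 2 ^ 10 := by
      rw [← one_div]; exact one_div_le_one_div_of_le (by norm_num) hQR
    rw [pow_one] at this
    rw [div_eq_inv_mul, mul_one] at h2
    linarith [show ((2 : ℝ) ^ 10)⁻¹ ≤ 1 / 32 by norm_num])
  have n2 : Maj ρ (2 : PowerSeries ℝ) 2 := by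
    simpa only [map_ofNat, Nat.abs_ofNat] using Maj.const (ρ := ρ) (2 : ℝ)
  have n3 : Maj ρ (3 : PowerSeries ℝ) 3 := by
    simpa only [map_ofNat, Nat.abs_ofNat] using Maj.const (ρ := ρ) (3 : ℝ)
  have n4 : Maj ρ (4 : PowerSeries ℝ) 4 := by
    simpa only [map_ofNat, Nat.abs_ofNat] using Maj.const (ρ := ρ) (4 : ℝ)
  have hFw : ∀ i, Maj ρ (a i) 12 → Maj ρ ((3 * a i ^ 2 - 2 * s s₁ * a i + s s₂) *
      (s s₁ ^ 2 - 4 * s s₂ + 2 * s s₁ * a i - 3 * a i ^ 2)) (2 ^ 22) := by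
    intro i hi
    refine (((((n3.mul hρ (hi.pow hρ 2)).sub hρ ((n2.mul hρ (hsM m1)).mul hρ hi)).add hρ
      (hsM m2))).mul hρ (((((hsM m1).pow hρ 2).sub hρ (n4.mul hρ (hsM m2))).add hρ
      ((n2.mul hρ (hsM m1)).mul hρ hi)).sub hρ (n3.mul hρ (hi.pow hρ 2)))).mono ?_
    norm_num
  have hpow : ∀ {b d : ℕ}, b ≤ d → (2 : ℝ) ^ b ≤ 2 ^ d := fun h => pow_le_pow_right₀ one_le_two h
  refine ⟨S, ?_, ?_, ?_, ?_, ?_⟩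
  · simp only [hS]
    rw [← w₁, ← w₂]
    ring
  · have h1 : s c + s e * a 0 = a 0 ^ (2 * μ) * (s (x 0) + s (x 1) * a 0 + s (x 2) * a 0 ^ 2) :=
      hid _ s (a 0) (hcub 0)
    simp only [hS]
    rw [h1, mul_assoc]
    refine (((haM0.pow hρ (2 * μ)).mul hρ (((hsM (hxM 0)).add hρ ((hsM (hxM 1)).mul hρ haM0')).add hρ
      ((hsM (hxM 2)).mul hρ (haM0'.pow hρ 2)))).mul hρ (hFw 0 haM0')).mono ?_
    calc (2 ^ 4 * (Q : ℝ)⁻¹ ^ 6) ^ (2 * μ) *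
          (2 ^ (150 * μ) + 2 ^ (150 * μ) * 12 + 2 ^ (150 * μ) * 12 ^ 2) * 2 ^ 22
        = (2 ^ 4) ^ (2 * μ) * 2 ^ (150 * μ) * (157 * 2 ^ 22) * ((Q : ℝ)⁻¹ ^ 6) ^ (2 * μ) := by
          rw [mul_pow]; ring
      _ ≤ (2 ^ 4) ^ (2 * μ) * 2 ^ (150 * μ) * (2 ^ (30 * μ)) * ((Q : ℝ)⁻¹ ^ 6) ^ (2 * μ) := by
          gcongr
          exact le_trans (by norm_num) (hpow (show 30 ≤ 30 * μ by omega))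
      _ = 2 ^ (188 * μ) * (Q : ℝ)⁻¹ ^ (12 * μ) := by
          rw [← pow_mul, ← pow_mul, ← pow_add, ← pow_add]; congr 2 <;> ring
      _ ≤ _ := by gcongr 2 ^ ?_ * _; · exact one_le_two
                  · omega
  · simp only [hS]
    rw [mul_assoc]
    refine ((((hsM hcM).add hρ ((hsM heM).mul hρ haM1))).mul hρ (hFw 1 haM1)).mono ?_
    calc ((2 : ℝ) ^ (150 * μ) + 2 ^ (150 * μ) * 12) * 2 ^ 22 = 2 ^ (150 * μ) * (13 * 2 ^ 22) := by
          ring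
      _ ≤ 2 ^ (150 * μ) * 2 ^ (30 * μ) := by
          gcongr; exact le_trans (by norm_num) (hpow (show 30 ≤ 30 * μ by omega))
      _ = 2 ^ (150 * μ + 30 * μ) := by rw [← pow_add]
      _ ≤ _ := hpow (by omega)
  · intro a' b' c' k
    set c₀ := shiftHom P Q (7 * μ + 3) c with hc₀
    set e₀ := shiftHom P Q (7 * μ + 1) e with he₀
    obtain ⟨n, hn⟩ := hαI ((C c₀ + C e₀ * X) * (3 * X ^ 2 - 2 * C (shiftHom P Q 2 s₁) * X +
      C (shiftHom P Q 4 s₂)) * (C (shiftHom P Q 2 s₁) ^ 2 - 4 * C (shiftHom P Q 4 s₂) +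
      2 * C (shiftHom P Q 2 s₁) * X - 3 * X ^ 2)) a' b' c' k
    refine ⟨n, ?_⟩
    rw [← hn, Finset.mul_sum]
    refine Finset.sum_congr rfl fun i _ => ?_
    have hG : eval₂ toSeries (α i) ((C c₀ + C e₀ * X) *
        (3 * X ^ 2 - 2 * C (shiftHom P Q 2 s₁) * X + C (shiftHom P Q 4 s₂)) *
        (C (shiftHom P Q 2 s₁) ^ 2 - 4 * C (shiftHom P Q 4 s₂) +
        2 * C (shiftHom P Q 2 s₁) * X - 3 * X ^ 2)) =
        PowerSeries.C ((Q : ℝ) ^ (7 * μ + 11)) * S i := by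
      rw [← coe_eval₂RingHom]
      simp only [map_mul, map_add, map_sub, map_pow, map_ofNat]
      simp only [coe_eval₂RingHom, eval₂_X, eval₂_C]
      rw [t1, t2, hc₀, he₀, toSeries_shiftHom hQ0.ne' hcd, toSeries_shiftHom hQ0.ne' hed, map_pow,
        map_pow, ← hκ, ← hs, hαa i]
      simp only [hS]
      ring
    rw [hG, PowerSeries.coeff_C_mul]
    ring
  · intro l₁ l₂ K hl h
    exact pow_le_of_relation (l₁ := l₁) (l₂ := l₂) hQ0 hPQ a w₁ w₂ w₃
      (intMaj_jacobian hμ d1 d2 d3 m1 m2 m3 hcd hed hcM heM) hJ0 (S := S) (fun i => rfl) hl h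

end AuxiliaryForms

section LargeSolutions
open Polynomial

lemma exists_cubic_roots_of_le {U V Q : ℝ} (hQ : 2 ^ 10 ≤ Q) (hU : Q ^ 2 / 2 ≤ |U|)
    (hV : Q ^ 2 / 2 ≤ |V|) (hUV : Q ^ 2 / 2 ≤ |U - V|)
    (hU' : |U| ≤ 10 * Q ^ 2) (hV' : |V| ≤ 10 * Q ^ 2) :
    ∃ r : Fin 3 → ℝ, r 0 + r 1 + r 2 = U + V ∧ r 0 * r 1 + r 1 * r 2 + r 2 * r 0 = U * V ∧
      r 0 * r 1 * r 2 = 1 ∧ |r 0| * Q ^ 4 ≤ 8 ∧ |r 1| ≤ 11 * Q ^ 2 ∧ |r 2| ≤ 11 * Q ^ 2 ∧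
      Q ^ 2 / 4 ≤ |r 0 - r 1| ∧ Q ^ 2 / 4 ≤ |r 1 - r 2| ∧ Q ^ 2 / 4 ≤ |r 0 - r 2| ∧
      Q ^ 2 / 4 ≤ |r 1| ∧ Q ^ 2 / 4 ≤ |r 2| ∧ |r 0| ≤ 1 ∧ |r 1 - U| ≤ 1 ∧ |r 2 - V| ≤ 1 := by
  have hQ2 : 2 ^ 10 * 2 ^ 10 ≤ Q ^ 2 := by rw [sq]; gcongr
  norm_num at hQ2
  obtain ⟨r, v₁, v₂, v₃, h0, h1, h2⟩ := exists_cubic_roots (L := Q ^ 2 / 2) (by linarith) hU hV hUV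
  have hQ0 : 0 < Q := by linarith [show (0 : ℝ) < 2 ^ 10 by norm_num]
  have hδ : 2 / (Q ^ 2 / 2) ^ 2 ≤ 1 := by
    rw [div_le_one (by positivity)]; nlinarith
  have h0' : |r 0| * Q ^ 4 ≤ 8 := by
    have : 2 / (Q ^ 2 / 2) ^ 2 = 8 / Q ^ 4 := by field_simp; norm_num
    rw [this] at h0
    rwa [← le_div_iff₀ (by positivity)]
  have a0 := h0.trans hδ
  have a1 := h1.trans hδ
  have a2 := h2.trans hδ
  have e1 := abs_sub_abs_le_abs_sub (r 1) U
  have e1' := abs_sub_abs_le_abs_sub U (r 1)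
  have e2 := abs_sub_abs_le_abs_sub (r 2) V
  have e2' := abs_sub_abs_le_abs_sub V (r 2)
  rw [abs_sub_comm] at e1' e2'
  have e01 := abs_sub_abs_le_abs_sub (r 1) (r 0)
  have e02 := abs_sub_abs_le_abs_sub (r 2) (r 0)
  rw [abs_sub_comm] at e01 e02
  have e12 : |U - V| ≤ |r 1 - U| + |r 1 - r 2| + |r 2 - V| := by
    calc |U - V| = |-(r 1 - U) + (r 1 - r 2) + (r 2 - V)| := by congr 1; ring
      _ ≤ |-(r 1 - U)| + |r 1 - r 2| + |r 2 - V| := abs_add_three _ _ _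
      _ = _ := by rw [abs_neg]
  exact ⟨r, v₁, v₂, v₃, h0', by linarith, by linarith, by linarith, by linarith, by linarith,
    by linarith, by linarith, a0, a1, a2⟩

lemma prod_linear_forms {U V p q : ℝ} {r : Fin 3 → ℝ} (v₁ : r 0 + r 1 + r 2 = U + V)
    (v₂ : r 0 * r 1 + r 1 * r 2 + r 2 * r 0 = U * V) (v₃ : r 0 * r 1 * r 2 = 1)
    (h : (p * (p - q * U) * (p - q * V) - q ^ 3) ^ 2 = 1) :
    |p - q * r 0| * |p - q * r 1| * |p - q * r 2| = 1 := by
  rw [← abs_mul, ← abs_mul]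
  have : (p - q * r 0) * (p - q * r 1) * (p - q * r 2) =
      p * (p - q * U) * (p - q * V) - q ^ 3 := by
    linear_combination (-p ^ 2 * q) * v₁ + p * q ^ 2 * v₂ - q ^ 3 * v₃
  rw [← this] at h
  rw [← sq_abs] at h
  nlinarith [abs_nonneg ((p - q * r 0) * (p - q * r 1) * (p - q * r 2))]

lemma le_abs_linear_form {p q s : ℝ} (hpq : |p| ≤ |q|) (hs : 2 ≤ |s|) : |q| ≤ |p - q * s| := by
  have := abs_sub_abs_le_abs_sub (q * s) p
  rw [abs_sub_comm, abs_mul] at this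
  nlinarith [abs_nonneg q]

lemma abs_form_mul_le {Q W H A B C l₁ l₂ z₀ z₁ : ℝ} (hQ : 2 ≤ Q) (hW : 0 ≤ W) (hH : 0 ≤ H)
    (hA : 0 ≤ A) (hB : 0 ≤ B) (hABC : C * (A * B) = 1) (h₀ : |z₀| ≤ W * C * H)
    (h₁ : |z₁| ≤ W * H) (hl₁ : |l₁| ≤ Q ^ 9 * A) (hl₂ : |l₂| * B ≤ Q ^ 3) :
    |l₁ * z₀ + l₂ * z₁| * B ≤ W * H * Q ^ 10 := by
  have hQ0 : 0 ≤ Q := by linarith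
  calc |l₁ * z₀ + l₂ * z₁| * B ≤ (|l₁| * |z₀| + |l₂| * |z₁|) * B := by
        gcongr; rw [← abs_mul, ← abs_mul]; exact abs_add_le _ _
    _ = |l₁| * |z₀| * B + (|l₂| * B) * |z₁| := by ring
    _ ≤ Q ^ 9 * A * (W * C * H) * B + Q ^ 3 * (W * H) := by gcongr
    _ = W * H * (Q ^ 9 * (C * (A * B)) + Q ^ 3) := by ring
    _ = W * H * (Q ^ 9 + Q ^ 3) := by rw [hABC, mul_one]
    _ ≤ _ := by
        gcongr
        have e1 : Q ^ 3 ≤ Q ^ 9 := pow_le_pow_right₀ (by linarith) (by norm_num)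
        have e2 : 2 * Q ^ 9 ≤ Q ^ 10 := by
          rw [pow_succ' _ 9]; gcongr
        linarith

set_option maxHeartbeats 1000000 in
lemma thue_large {P Q U V p q ν : ℤ} {u v : ℤ[X]} {τ : ℝ} {E : ℕ} (hE : 10 ^ 7 ≤ E)
    (hQE : (2 : ℝ) ^ E ≤ Q) (hP : 0 ≤ P) (hPQ1 : P + 1 ≤ Q)
    (hPQ : IsCoprime P Q) (hν : P ^ 2 + P * Q - Q ^ 2 = ν) (hν2 : ν ^ 2 = 1)
    (hud : u.natDegree ≤ 2) (hvd : v.natDegree ≤ 2) (hu : IntMaj u 10) (hv : IntMaj v 10)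
    (hτ : τ ^ 2 + τ - 1 = 0)
    (huτ : eval₂RingHom (Int.castRingHom ℝ) τ u ≠ 0)
    (hvτ : eval₂RingHom (Int.castRingHom ℝ) τ v ≠ 0)
    (huvτ : eval₂RingHom (Int.castRingHom ℝ) τ (u - v) ≠ 0)
    (hU : (U : ℝ) = Q ^ 2 * eval₂RingHom (Int.castRingHom ℝ) (P / Q) u)
    (hV : (V : ℝ) = Q ^ 2 * eval₂RingHom (Int.castRingHom ℝ) (P / Q) v)
    (hU1 : (Q : ℝ) ^ 2 / 2 ≤ |(U : ℝ)|) (hV1 : (Q : ℝ) ^ 2 / 2 ≤ |(V : ℝ)|)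
    (hUV1 : (Q : ℝ) ^ 2 / 2 ≤ |(U : ℝ) - V|)
    (hU10 : |(U : ℝ)| ≤ 10 * Q ^ 2) (hV10 : |(V : ℝ)| ≤ 10 * Q ^ 2)
    (hpq : |(p : ℝ)| ≤ |(q : ℝ)|)
    (heq : ((p : ℝ) * (p - q * U) * (p - q * V) - q ^ 3) ^ 2 = 1) :
    |(q : ℝ)| < Q ^ 4000 := by
  by_contra! hq
  have hQ10 : (2 : ℝ) ^ 10 ≤ Q := (pow_le_pow_right₀ one_le_two (by omega)).trans hQE
  have hQ1 : (1 : ℝ) ≤ Q := le_trans (by norm_num) hQ10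
  have hQ1' : (1 : ℝ) < Q := lt_of_lt_of_le (by norm_num) hQ10
  have hQ0 : (0 : ℝ) < Q := by linarith
  have hQ2 : 2 ^ 10 * 2 ^ 10 ≤ (Q : ℝ) ^ 2 := by rw [sq]; gcongr
  norm_num at hQ2
  obtain ⟨r, v₁, v₂, v₃, hr0, hr1, hr2, h01, h12, h02, h1, h2, h0, -, -⟩ :=
    exists_cubic_roots_of_le hQ10 hU1 hV1 hUV1 hU10 hV10
  have hprod := prod_linear_forms v₁ v₂ v₃ heq
  have hx1 := le_abs_linear_form hpq (s := r 1) (by linarith)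
  have hx2 := le_abs_linear_form hpq (s := r 2) (by linarith)
  have hq1 : 1 ≤ |(q : ℝ)| := (one_le_pow₀ hQ1).trans hq
  have hx0 : |(p : ℝ) - q * r 0| * |(q : ℝ)| ^ 2 ≤ 1 := by
    rw [← hprod, mul_assoc, sq]
    gcongr
  obtain ⟨μ, hμ1, hμ2⟩ := exists_nat_pow_near hq1 (one_lt_pow₀ hQ1' (four_ne_zero))
  have hμ : 1000 ≤ μ := by
    have : ((Q : ℝ) ^ 4) ^ 1000 < (Q ^ 4) ^ (μ + 1) := by
      refine lt_of_le_of_lt ?_ hμ2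
      rw [← pow_mul]; exact hq
    have := (pow_lt_pow_iff_right₀ (one_lt_pow₀ hQ1' four_ne_zero)).1 this
    omega
  rw [← pow_mul] at hμ1 hμ2
  have h22 : 22 * (Q : ℝ) ^ 2 ≤ Q ^ 3 := by nlinarith
  have hd : ∀ x y : ℝ, |x| ≤ 11 * (Q : ℝ) ^ 2 → |y| ≤ 11 * (Q : ℝ) ^ 2 → |x - y| ≤ 22 * (Q : ℝ) ^ 2 :=
    fun x y hx hy => (abs_sub _ _).trans (by linarith)
  have hr0' : |r 0| ≤ 11 * (Q : ℝ) ^ 2 := by linarith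
  have hl₁M : |(r 0 - r 2) * (p - q * r 1)| ≤ Q ^ 9 * Q ^ (4 * μ) := by
    rw [abs_mul]
    have hx1' : |(p : ℝ) - q * r 1| ≤ 12 * Q ^ 2 * |(q : ℝ)| := by
      calc |(p : ℝ) - q * r 1| ≤ |(p : ℝ)| + |q * r 1| := abs_sub _ _
        _ ≤ |(q : ℝ)| * Q ^ 2 + |(q : ℝ)| * (11 * Q ^ 2) := by
          rw [abs_mul]
          gcongr
          exact hpq.trans (le_mul_of_one_le_right (abs_nonneg _) (one_le_pow₀ hQ1))
        _ = _ := by ring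
    calc |r 0 - r 2| * |(p : ℝ) - q * r 1| ≤ 22 * Q ^ 2 * (12 * Q ^ 2 * Q ^ (4 * (μ + 1))) := by
          have := hd _ _ hr0' hr2
          gcongr
          exact hx1'.trans (by gcongr)
      _ = 264 * (Q ^ 8 * Q ^ (4 * μ)) := by ring
      _ ≤ Q * (Q ^ 8 * Q ^ (4 * μ)) := by
          have : (264 : ℝ) ≤ Q := le_trans (by norm_num) hQ10
          gcongr
      _ = _ := by ring
  have hl₂M : |(r 1 - r 2) * (p - q * r 0)| * Q ^ (8 * μ) ≤ Q ^ 3 := by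
    rw [abs_mul]
    calc |r 1 - r 2| * |(p : ℝ) - q * r 0| * Q ^ (8 * μ)
        = |r 1 - r 2| * (|(p : ℝ) - q * r 0| * (Q ^ (4 * μ)) ^ 2) := by ring
      _ ≤ (22 * Q ^ 2) * (|(p : ℝ) - q * r 0| * |(q : ℝ)| ^ 2) := by
          have := hd _ _ hr1 hr2
          gcongr
      _ ≤ (22 * Q ^ 2) * 1 := by gcongr
      _ ≤ _ := by rwa [mul_one]
  obtain ⟨S, hS0, hSM0, hSM1, hSI, hSZ⟩ := exists_auxiliary_forms (by exact_mod_cast hQ10) hP hPQ1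
    hPQ hν hν2 hud hvd hu hv hτ huτ hvτ huvτ hU hV
    (by have : (3 : ℝ) ≤ |(U : ℝ)| := by linarith
        exact_mod_cast this) hU10 hV10 v₁ v₂ v₃ hr0 hr1 hr2
    (by linarith) (by linarith) (by linarith) (μ := μ) (by omega)
  set l₁ := (r 0 - r 2) * (p - q * r 1) with hl₁
  set l₂ := (r 1 - r 2) * (p - q * r 0) with hl₂
  set K := μ / 1000 + 1 with hK
  have hQK : (2 : ℝ) ^ (900 * μ) < Q ^ K := by
    calc (2 : ℝ) ^ (900 * μ) < 2 ^ (E * K) := by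
          apply pow_lt_pow_right₀ one_lt_two
          calc 900 * μ < 10 ^ 7 * K := by omega
            _ ≤ E * K := Nat.mul_le_mul_right _ hE
      _ ≤ Q ^ K := by rw [pow_mul]; gcongr
  have hl₁0 : l₁ ≠ 0 := by
    refine mul_ne_zero ?_ ?_
    · rw [← abs_pos]; linarith
    · rw [← abs_pos]; linarith
  obtain ⟨k, hkK, hk⟩ : ∃ k, k ≤ K ∧
      PowerSeries.coeff k (PowerSeries.C l₁ * S 0 + PowerSeries.C l₂ * S 1) ≠ 0 := by
    by_contra! hcon
    refine absurd (hSZ l₁ l₂ K hl₁0 ?_) (not_le.2 hQK)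
    rw [PowerSeries.X_pow_dvd_iff]
    exact fun k hk => hcon k (by omega)
  rw [map_add, PowerSeries.coeff_C_mul, PowerSeries.coeff_C_mul] at hk
  set z₀ := PowerSeries.coeff k (S 0) with hz₀
  set z₁ := PowerSeries.coeff k (S 1) with hz₁
  obtain ⟨N, hN⟩ := hSI (q * U * V) (p - q * (U + V)) q k
  have hz₂ : PowerSeries.coeff k (S 2) = -z₀ - z₁ := by
    rw [show S 2 = -S 0 - S 1 by linear_combination hS0]
    simp [hz₀, hz₁]
  rw [Fin.sum_univ_three, hz₂] at hN
  have hN' : (Q : ℝ) ^ (7 * μ + 11) * cubicDisc ((U : ℝ) + V) (U * V) 1 ^ k * (l₁ * z₀ + l₂ * z₁) =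
      N := by
    rw [← hN]
    congr 1
    push_cast
    rw [hl₁, hl₂]
    linear_combination (-q * ((r 0 - r 2) * z₀ + (r 1 - r 2) * z₁)) * v₁
  have hdisc : cubicDisc ((U : ℝ) + V) (U * V) 1 = ((r 0 - r 1) * (r 1 - r 2) * (r 0 - r 2)) ^ 2 := by
    rw [← v₁, ← v₂, ← v₃]; unfold cubicDisc; ring
  have hT0 : cubicDisc ((U : ℝ) + V) (U * V) 1 ≠ 0 := by
    rw [hdisc]
    refine pow_ne_zero _ (mul_ne_zero (mul_ne_zero ?_ ?_) ?_) <;> rw [← abs_pos] <;> linarith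
  have hT1 : |cubicDisc ((U : ℝ) + V) (U * V) 1| ≤ Q ^ 18 := by
    rw [hdisc, abs_pow, abs_mul, abs_mul]
    calc (|r 0 - r 1| * |r 1 - r 2| * |r 0 - r 2|) ^ 2 ≤ ((Q : ℝ) ^ 3 * Q ^ 3 * Q ^ 3) ^ 2 := by
          gcongr
          · exact (hd _ _ hr0' hr1).trans h22
          · exact (hd _ _ hr1 hr2).trans h22
          · exact (hd _ _ hr0' hr2).trans h22
      _ = _ := by ring
  have hN0 : N ≠ 0 := by
    rintro rfl
    rw [Int.cast_zero] at hN'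
    exact mul_ne_zero (mul_ne_zero (pow_ne_zero _ hQ0.ne') (pow_ne_zero _ hT0)) hk hN'
  have hN1 : (1 : ℝ) ≤ |(N : ℝ)| := by exact_mod_cast Int.one_le_abs hN0
  have hi0 : 0 < (Q : ℝ)⁻¹ := inv_pos.2 hQ0
  have hρ : 0 < (Q : ℝ)⁻¹ ^ 40 := by positivity
  have hz₀M : |z₀| ≤ 2 ^ (200 * μ) * (Q : ℝ)⁻¹ ^ (12 * μ) * Q ^ (40 * k) := by
    refine (hSM0.abs_coeff_le hρ k).trans (le_of_eq ?_)
    rw [← pow_mul, inv_pow _ (40 * k), div_inv_eq_mul]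
  have hz₁M : |z₁| ≤ 2 ^ (200 * μ) * Q ^ (40 * k) := by
    refine (hSM1.abs_coeff_le hρ k).trans (le_of_eq ?_)
    rw [← pow_mul, inv_pow _ (40 * k), div_inv_eq_mul]
  have hΦ : |l₁ * z₀ + l₂ * z₁| * Q ^ (8 * μ) ≤ 2 ^ (200 * μ) * Q ^ (40 * k) * Q ^ 10 := by
    have hQi : (Q : ℝ)⁻¹ ^ (12 * μ) * (Q ^ (4 * μ) * Q ^ (8 * μ)) = 1 := by
      rw [← pow_add, ← add_mul, ← mul_pow, inv_mul_cancel₀ hQ0.ne', one_pow]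
    exact abs_form_mul_le (by linarith) (pow_nonneg zero_le_two _) (pow_nonneg hQ0.le _)
      (pow_nonneg hQ0.le _) (pow_nonneg hQ0.le _) hQi hz₀M hz₁M hl₁M hl₂M
  have hfin : (Q : ℝ) ^ (8 * μ) ≤ Q ^ (7 * μ + 11 + 18 * k + (K + 40 * k + 10)) := by
    calc (Q : ℝ) ^ (8 * μ) ≤ |(N : ℝ)| * Q ^ (8 * μ) := le_mul_of_one_le_left (by positivity) hN1
      _ = Q ^ (7 * μ + 11) * |cubicDisc ((U : ℝ) + V) (U * V) 1| ^ k *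
          (|l₁ * z₀ + l₂ * z₁| * Q ^ (8 * μ)) := by
          rw [← hN', abs_mul, abs_mul, abs_pow, abs_pow, abs_of_pos hQ0, mul_assoc]
      _ ≤ Q ^ (7 * μ + 11) * (Q ^ 18) ^ k * (Q ^ K * Q ^ (40 * k) * Q ^ 10) := by
          refine mul_le_mul (mul_le_mul_of_nonneg_left (pow_le_pow_left₀ (abs_nonneg _) hT1 k)
            (pow_nonneg hQ0.le _)) (hΦ.trans ?_) (by positivity) (by positivity)
          gcongr
          refine le_trans ?_ hQK.le
          exact pow_le_pow_right₀ one_le_two (by omega)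
      _ = _ := by rw [← pow_mul, ← pow_add, ← pow_add, ← pow_add, ← pow_add]
  have := (pow_le_pow_iff_right₀ hQ1').1 hfin
  omega

end LargeSolutions

section SmallSolutions

lemma exists_reduction_mod_cubic (U V p q : ℤ) (j : ℕ) :
    ∃ z₀ z₁ z₂ : ℤ, ∀ r : ℝ, r * (r - U) * (r - V) = 1 →
      (p - q * r) * ((r - U) * (r - V)) ^ j = z₀ + z₁ * r + z₂ * r ^ 2 := by
  induction j with
  | zero => exact ⟨p, -q, 0, fun r _ => by push_cast; ring⟩
  | succ j ih =>
    obtain ⟨z₀, z₁, z₂, h⟩ := ih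
    refine ⟨z₀ * (U * V) + z₁, z₂ - z₀ * (U + V), z₀, fun r hr => ?_⟩
    rw [pow_succ, ← mul_assoc, h r hr]
    push_cast
    linear_combination (z₁ + z₂ * r) * hr

lemma prod_add_le_of_mul_eq_one {a b c m : ℝ} (ha : 0 < a) (hb : 0 < b) (hc : 0 < c)
    (hm : 1 ≤ m) (habc : c * a * b = 1) (ha1 : a ≤ m) (hb1 : b ≤ m) (ha2 : 1 ≤ m * a)
    (hb2 : 1 ≤ m * b) : (c + a) * (a + b) * (c + b) ≤ 8 * m ^ 3 := by
  have hm0 : 0 < m := by linarith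
  have h1 : a ^ 2 * b ≤ m ^ 2 * m := by gcongr
  have h2 : b ^ 2 * a ≤ m ^ 2 * m := by gcongr
  have hm23 : m ^ 2 ≤ m ^ 3 := pow_le_pow_right₀ hm (by norm_num)
  have hm13 : 1 ≤ m ^ 3 := one_le_pow₀ hm
  have h3 : a ^ 2 * c ≤ m ^ 2 := by
    calc a ^ 2 * c ≤ a ^ 2 * c * (m * b) := le_mul_of_one_le_right (by positivity) hb2
      _ = m * a * (c * a * b) := by ring
      _ ≤ m * m := by rw [habc, mul_one]; gcongr
      _ = _ := by ring
  have h4 : b ^ 2 * c ≤ m ^ 2 := by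
    calc b ^ 2 * c ≤ b ^ 2 * c * (m * a) := le_mul_of_one_le_right (by positivity) ha2
      _ = m * b * (c * a * b) := by ring
      _ ≤ m * m := by rw [habc, mul_one]; gcongr
      _ = _ := by ring
  have h5 : c ^ 2 * a ≤ m ^ 3 := by
    calc c ^ 2 * a ≤ c ^ 2 * a * ((m * a) * (m * b) ^ 2) := by
          refine le_mul_of_one_le_right (by positivity) (one_le_mul_of_one_le_of_one_le ha2
            (one_le_pow₀ hb2))
      _ = m ^ 3 * (c * a * b) ^ 2 := by ring
      _ = m ^ 3 := by rw [habc]; ring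
  have h6 : c ^ 2 * b ≤ m ^ 3 := by
    calc c ^ 2 * b ≤ c ^ 2 * b * ((m * a) ^ 2 * (m * b)) := by
          refine le_mul_of_one_le_right (by positivity) (one_le_mul_of_one_le_of_one_le
            (one_le_pow₀ ha2) hb2)
      _ = m ^ 3 * (c * a * b) ^ 2 := by ring
      _ = m ^ 3 := by rw [habc]; ring
  nlinarith

lemma eq_const_of_prod_sub_lt {U V z₀ z₁ z₂ : ℤ} (hU : 3 ≤ |U|) {r : Fin 3 → ℝ}
    (v₁ : r 0 + r 1 + r 2 = U + V) (v₂ : r 0 * r 1 + r 1 * r 2 + r 2 * r 0 = U * V)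
    (v₃ : r 0 * r 1 * r 2 = 1) {η : Fin 3 → ℝ}
    (hη : ∀ i, η i = z₀ + z₁ * r i + z₂ * r i ^ 2)
    (h : |η 0 - η 1| * |η 1 - η 2| * |η 0 - η 2| <
      |r 0 - r 1| * |r 1 - r 2| * |r 0 - r 2|) : ∀ i, η i = z₀ := by
  set A := z₁ + z₂ * (U + V) with hA
  set I := A * (A - U * z₂) * (A - V * z₂) - z₂ ^ 3 with hI
  have key : (η 0 - η 1) * (η 1 - η 2) * (η 0 - η 2) =
      (r 0 - r 1) * (r 1 - r 2) * (r 0 - r 2) * I := by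
    have h1 : η 0 - η 1 = (r 0 - r 1) * (A - z₂ * r 2) := by
      rw [hη, hη, hA]; push_cast; linear_combination (z₂ * (r 0 - r 1)) * v₁
    have h2 : η 1 - η 2 = (r 1 - r 2) * (A - z₂ * r 0) := by
      rw [hη, hη, hA]; push_cast; linear_combination (z₂ * (r 1 - r 2)) * v₁
    have h3 : η 0 - η 2 = (r 0 - r 2) * (A - z₂ * r 1) := by
      rw [hη, hη, hA]; push_cast; linear_combination (z₂ * (r 0 - r 2)) * v₁
    have h4 : (A - z₂ * r 2) * (A - z₂ * r 0) * (A - z₂ * r 1) = I := by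
      rw [hI]; push_cast
      linear_combination (-A ^ 2 * z₂) * v₁ + (A * z₂ ^ 2) * v₂ - z₂ ^ 3 * v₃
    rw [h1, h2, h3, ← h4]; ring
  have hI0 : I = 0 := by
    by_contra hne
    have h1 : (1 : ℝ) ≤ |(I : ℝ)| := by exact_mod_cast Int.one_le_abs hne
    rw [← abs_mul, ← abs_mul, ← abs_mul, ← abs_mul, key, abs_mul] at h
    nlinarith [abs_nonneg ((r 0 - r 1) * (r 1 - r 2) * (r 0 - r 2))]
  have hz2 : z₂ = 0 := by
    by_contra hne
    have hne' : (z₂ : ℚ) ≠ 0 := by exact_mod_cast hne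
    refine rat_mul_sub_mul_sub_ne_one hU (V := V) ((A : ℚ) / z₂) ?_
    have : (A : ℚ) * (A - U * z₂) * (A - V * z₂) - z₂ ^ 3 = 0 := by exact_mod_cast hI0
    field_simp
    linear_combination this
  have hz1 : z₁ = 0 := by
    have : A = z₁ := by rw [hA, hz2]; ring
    rw [hI, hz2, this] at hI0
    have : z₁ ^ 3 = 0 := by linear_combination hI0
    exact pow_eq_zero_iff (three_ne_zero) |>.1 this
  intro i
  rw [hη, hz1, hz2]; simp

lemma false_of_power_ratio {a b q : ℝ} {j : ℕ} (hj : 2 ≤ j) (hq : 0 < q) (hb : 1000 ≤ b)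
    (hab : 119 / 100 * b ≤ a) (h1 : a ^ j ≤ q * (a + 1)) (h2 : q * (b - 1) ≤ b ^ j) : False := by
  obtain ⟨j, rfl⟩ := Nat.exists_eq_add_of_le' hj
  have hb0 : 0 < b := by linarith
  have ha0 : 0 < a := by linarith
  have h3 : 119 / 100 * b ^ (j + 1) ≤ a ^ (j + 1) := by
    rw [pow_succ, pow_succ]
    have : b ^ j ≤ a ^ j := by gcongr; linarith
    calc 119 / 100 * (b ^ j * b) = b ^ j * (119 / 100 * b) := by ring
      _ ≤ a ^ j * a := by gcongr
  have h4 : 119 / 100 * b ^ (j + 1) * a ≤ q * (a + 1) := by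
    refine le_trans ?_ h1
    rw [pow_succ a (j + 1)]; gcongr
  have h5 : 119 / 100 * (q * (b - 1)) * a ≤ q * (a + 1) * b := by
    calc 119 / 100 * (q * (b - 1)) * a ≤ 119 / 100 * b ^ (j + 2) * a := by gcongr
      _ = 119 / 100 * b ^ (j + 1) * a * b := by ring
      _ ≤ _ := by gcongr
  have h6 : 119 / 100 * (b - 1) * a ≤ (a + 1) * b := by
    refine le_of_mul_le_mul_left ?_ hq
    linarith
  nlinarith

lemma unit_bounds {x R e Q T : ℝ} {j : ℕ} (hj : j ≠ 0) (hx : 0 ≤ x) (hQ : 0 < Q) (hT : 0 < T)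
    (hR1 : T / 4 ≤ R) (hR2 : R ≤ 11 * T) (hxe : x * R ^ j = e) (h1 : e ≤ 96 * (T ^ j * Q))
    (h2 : T ^ j ≤ 96 * (e * Q)) : x ≤ 2 ^ (15 * j) * Q ∧ 1 ≤ 2 ^ (15 * j) * Q * x := by
  have hTj : 0 < T ^ j := pow_pos hT j
  have h96 : (96 : ℝ) * 11 ^ j ≤ 2 ^ (15 * j) := by
    rw [pow_mul]
    calc (96 : ℝ) * 11 ^ j ≤ 96 ^ j * 11 ^ j := by
          gcongr; exact le_self_pow₀ (by norm_num) hj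
      _ = (96 * 11) ^ j := by rw [mul_pow]
      _ ≤ _ := by gcongr; norm_num
  constructor
  · have h3 : x * (T ^ j / 4 ^ j) ≤ 96 * (T ^ j * Q) := by
      rw [← div_pow]
      refine le_trans ?_ h1
      rw [← hxe]; gcongr
    have h4 : x ≤ 96 * 4 ^ j * Q := by
      refine le_of_mul_le_mul_right ?_ hTj
      have : x * T ^ j = x * (T ^ j / 4 ^ j) * 4 ^ j := by field_simp
      rw [this]
      calc _ ≤ 96 * (T ^ j * Q) * 4 ^ j := by gcongr
        _ = _ := by ring
    refine h4.trans ?_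
    gcongr
    refine le_trans ?_ h96
    gcongr; norm_num
  · have h3 : T ^ j ≤ T ^ j * (96 * 11 ^ j * Q * x) := by
      calc T ^ j ≤ 96 * (x * R ^ j * Q) := by rw [hxe]; exact h2
        _ ≤ 96 * (x * (11 * T) ^ j * Q) := by
          have : 0 ≤ R := by linarith
          gcongr
        _ = _ := by rw [mul_pow]; ring
    have h4 : 1 ≤ 96 * 11 ^ j * Q * x := le_of_mul_le_mul_left (by simpa using h3) hTj
    refine h4.trans ?_
    gcongr

set_option maxHeartbeats 1000000 in
lemma thue_small {U V p q : ℤ} {Q : ℝ} {E : ℕ} (hE : 10 ^ 6 ≤ E) (hQ : (2 : ℝ) ^ E ≤ Q)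
    (hU1 : Q ^ 2 / 2 ≤ |(U : ℝ)|) (hV1 : Q ^ 2 / 2 ≤ |(V : ℝ)|)
    (hUV1 : Q ^ 2 / 2 ≤ |(U : ℝ) - V|)
    (hU10 : |(U : ℝ)| ≤ 10 * Q ^ 2) (hV10 : |(V : ℝ)| ≤ 10 * Q ^ 2)
    (hratio : 6 * |(U : ℝ)| ≤ 5 * |(V : ℝ)| ∨ 6 * |(V : ℝ)| ≤ 5 * |(U : ℝ)|)
    (hpq : |(p : ℝ)| ≤ |(q : ℝ)|) (hq2 : 2 ≤ |(q : ℝ)|) (hq : |(q : ℝ)| < Q ^ 4000)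
    (heq : ((p : ℝ) * (p - q * U) * (p - q * V) - q ^ 3) ^ 2 = 1) : False := by
  have hQ10 : (2 : ℝ) ^ 10 ≤ Q := (pow_le_pow_right₀ one_le_two (by omega)).trans hQ
  have hQ1 : (1 : ℝ) ≤ Q := le_trans (by norm_num) hQ10
  have hQ1' : (1 : ℝ) < Q := lt_of_lt_of_le (by norm_num) hQ10
  have hQ0 : (0 : ℝ) < Q := by linarith
  have hQ2 : 2 ^ 10 * 2 ^ 10 ≤ Q ^ 2 := by rw [sq]; gcongr
  norm_num at hQ2
  obtain ⟨r, v₁, v₂, v₃, -, hr1, hr2, h01, h12, h02, h1, h2, h0, hrU, hrV⟩ :=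
    exists_cubic_roots_of_le hQ10 hU1 hV1 hUV1 hU10 hV10
  have hprod := prod_linear_forms v₁ v₂ v₃ heq
  have hroot : ∀ i, r i * ((r i - U) * (r i - V)) = 1 := by
    have hx : ∀ x, (x - r 0) * (x - r 1) * (x - r 2) = x * ((x - U) * (x - V)) - 1 := fun x => by
      linear_combination (-x ^ 2) * v₁ + x * v₂ - v₃
    intro i
    have := hx (r i)
    fin_cases i <;> simp at this ⊢ <;> linarith
  have hεu : ∀ s : ℝ, |p - q * s| ≤ |(q : ℝ)| * (|s| + 1) := fun s => by
    refine (abs_sub _ _).trans ?_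
    rw [abs_mul]; linarith
  have hεl : ∀ s : ℝ, |(q : ℝ)| * (|s| - 1) ≤ |p - q * s| := fun s => by
    have := abs_sub_abs_le_abs_sub (q * s) (p : ℝ)
    rw [abs_mul, abs_sub_comm] at this
    linarith
  have hε1l := hεl (r 1)
  have hε2l := hεl (r 2)
  have hε1u := hεu (r 1)
  have hε2u := hεu (r 2)
  set e₁ := |(p : ℝ) - q * r 1| with he₁
  set e₂ := |(p : ℝ) - q * r 2| with he₂
  have hq0 : 0 < |(q : ℝ)| := by linarith
  have hl1 : |(q : ℝ)| * (Q ^ 2 / 8) ≤ e₁ := le_trans (by gcongr; linarith) hε1l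
  have hl2 : |(q : ℝ)| * (Q ^ 2 / 8) ≤ e₂ := le_trans (by gcongr; linarith) hε2l
  have hu1 : e₁ ≤ |(q : ℝ)| * (12 * Q ^ 2) := hε1u.trans (by gcongr; linarith)
  have hu2 : e₂ ≤ |(q : ℝ)| * (12 * Q ^ 2) := hε2u.trans (by gcongr; linarith)
  have hQe : Q ≤ e₂ := by
    refine le_trans ?_ hl2
    nlinarith
  obtain ⟨j, hj1, hj2⟩ := exists_nat_pow_near (x := e₂ * Q) (y := Q ^ 2)
    (by nlinarith) (one_lt_pow₀ hQ1' two_ne_zero)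
  have hj0 : j ≠ 0 := by
    rintro rfl
    rw [zero_add, pow_one] at hj2
    nlinarith
  have hjle : j < 2002 := by
    have : (Q ^ 2) ^ j < (Q ^ 2) ^ 2002 := by
      refine lt_of_le_of_lt hj1 ?_
      calc e₂ * Q ≤ |(q : ℝ)| * (12 * Q ^ 2) * Q := by gcongr
        _ < Q ^ 4000 * (12 * Q ^ 2) * Q := by gcongr
        _ = 12 * Q ^ 4003 := by ring
        _ ≤ Q * Q ^ 4003 := by gcongr; exact le_trans (by norm_num) hQ10
        _ = (Q ^ 2) ^ 2002 := by rw [← pow_succ', ← pow_mul]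
    exact (pow_lt_pow_iff_right₀ (one_lt_pow₀ hQ1' two_ne_zero)).1 this
  have hW : 8 * (2 : ℝ) ^ (15 * j) < Q := by
    refine lt_of_lt_of_le ?_ hQ
    calc 8 * (2 : ℝ) ^ (15 * j) = 2 ^ (15 * j + 3) := by rw [pow_add]; norm_num [mul_comm]
      _ < 2 ^ E := pow_lt_pow_right₀ one_lt_two (by omega)
  obtain ⟨z₀, z₁, z₂, hz⟩ := exists_reduction_mod_cubic U V p q j
  set η : Fin 3 → ℝ := fun i => (p - q * r i) * ((r i - U) * (r i - V)) ^ j with hη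
  have hηr : ∀ i, |η i| * |r i| ^ j = |p - q * r i| := fun i => by
    rw [hη, ← abs_pow, ← abs_mul, mul_assoc, ← mul_pow, mul_comm ((r i - U) * (r i - V)) (r i), hroot,
      one_pow, mul_one]
  have hj2' : e₂ ≤ (Q ^ 2) ^ j * Q := by
    refine le_of_mul_le_mul_right ?_ hQ0
    calc e₂ * Q ≤ (Q ^ 2) ^ (j + 1) := hj2.le
      _ = _ := by ring
  obtain ⟨ha1, ha2⟩ := unit_bounds hj0 (abs_nonneg _) hQ0 (by positivity) h1 hr1 (hηr 1)
    (show e₁ ≤ _ by linarith)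
    (hj1.trans (by rw [← mul_assoc]; gcongr; linarith))
  obtain ⟨hb1, hb2⟩ := unit_bounds hj0 (abs_nonneg _) hQ0 (by positivity) h2 hr2 (hηr 2)
    (show e₂ ≤ _ by nlinarith [pow_pos (pow_pos hQ0 2) j])
    (hj1.trans (by rw [← mul_assoc]; gcongr; linarith))
  have hprodη : |η 0| * |η 1| * |η 2| = 1 := by
    have h3 : |r 0| * |r 1| * |r 2| = 1 := by rw [← abs_mul, ← abs_mul, v₃, abs_one]
    rw [← hprod, he₁, he₂, ← hηr 0, ← hηr 1, ← hηr 2]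
    calc |η 0| * |η 1| * |η 2| = |η 0| * |η 1| * |η 2| * (|r 0| * |r 1| * |r 2|) ^ j := by
          rw [h3, one_pow, mul_one]
      _ = _ := by rw [mul_pow, mul_pow]; ring
  have hpos : ∀ i, 0 < |η i| := by
    have hne : |η 0| * |η 1| * |η 2| ≠ 0 := by rw [hprodη]; exact one_ne_zero
    intro i
    refine lt_of_le_of_ne (abs_nonneg _) fun h => hne ?_
    replace h := abs_eq_zero.1 h.symm
    fin_cases i
    · simp [show η 0 = 0 from h]
    · simp [show η 1 = 0 from h]
    · simp [show η 2 = 0 from h]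
  set W : ℝ := 2 ^ (15 * j) with hWdef
  have hW1 : 1 ≤ W := one_le_pow₀ one_le_two
  have hsmall : |η 0 - η 1| * |η 1 - η 2| * |η 0 - η 2| <
      |r 0 - r 1| * |r 1 - r 2| * |r 0 - r 2| := by
    calc |η 0 - η 1| * |η 1 - η 2| * |η 0 - η 2|
        ≤ (|η 0| + |η 1|) * (|η 1| + |η 2|) * (|η 0| + |η 2|) := by
          gcongr <;> exact abs_sub _ _
      _ ≤ 8 * (W * Q) ^ 3 := prod_add_le_of_mul_eq_one (hpos 1) (hpos 2) (hpos 0)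
          (one_le_mul_of_one_le_of_one_le hW1 hQ1) hprodη ha1 hb1 ha2 hb2
      _ = (8 * W) ^ 3 * Q ^ 3 / 64 := by ring
      _ < Q ^ 3 * Q ^ 3 / 64 := by gcongr
      _ = Q ^ 2 / 4 * (Q ^ 2 / 4) * (Q ^ 2 / 4) := by ring
      _ ≤ _ := by gcongr
  have hU3 : 3 ≤ |U| := by
    have : (3 : ℝ) ≤ |(U : ℝ)| := by linarith
    exact_mod_cast this
  have hηz := eq_const_of_prod_sub_lt hU3 v₁ v₂ v₃ (η := η)
    (fun i => hz (r i) (by rw [mul_assoc]; exact hroot i)) hsmall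
  rw [hηz, hηz, hηz] at hprodη
  have hz1 : |(z₀ : ℝ)| = 1 := by
    have : |(z₀ : ℝ)| ^ 3 = 1 := by linear_combination hprodη
    exact (pow_eq_one_iff_of_nonneg (abs_nonneg _) three_ne_zero).1 this
  have hr1e := hηr 1
  have hr2e := hηr 2
  rw [hηz, hz1, one_mul] at hr1e hr2e
  clear ha1 ha2 hb1 hb2 hsmall hprodη hpos hW hWdef hηz hηr hη hz hj1 hj2 hj2' hQe hQ hq
  rcases (show j = 1 ∨ 2 ≤ j by omega) with rfl | hj
  · rw [pow_one] at hr1e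
    rw [← he₁] at hr1e
    nlinarith
  · have hV : ∀ x y : ℝ, |x - y| ≤ 1 → |x| ≤ |y| + 1 ∧ |y| ≤ |x| + 1 := fun x y h => by
      have g1 := abs_sub_abs_le_abs_sub x y
      have g2 := abs_sub_abs_le_abs_sub y x
      rw [abs_sub_comm] at g2
      constructor <;> linarith
    obtain ⟨g1, g2⟩ := hV _ _ hrU
    obtain ⟨g3, g4⟩ := hV _ _ hrV
    rcases hratio with h | h
    · exact false_of_power_ratio hj hq0 (b := |r 1|) (a := |r 2|) (by linarith) (by linarith)
        (by rw [hr2e]; exact hε2u) (by rw [hr1e]; exact hε1l)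
    · exact false_of_power_ratio hj hq0 (b := |r 2|) (a := |r 1|) (by linarith) (by linarith)
        (by rw [hr1e]; exact hε1u) (by rw [hr2e]; exact hε2l)

end SmallSolutions

section Reduction
open Polynomial

/-- The integral polynomial `c₀ + c₁ X + c₂ X²`. -/
noncomputable def quadPoly (c₀ c₁ c₂ : ℤ) : ℤ[X] := C c₀ + C c₁ * X + C c₂ * X ^ 2

lemma eval_quadPoly (c₀ c₁ c₂ : ℤ) (x : ℝ) :
    eval₂RingHom (Int.castRingHom ℝ) x (quadPoly c₀ c₁ c₂) = c₀ + c₁ * x + c₂ * x ^ 2 := by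
  simp only [quadPoly, map_add, map_mul, map_pow, coe_eval₂RingHom, eval₂_C, eval₂_X]
  simp

lemma natDegree_quadPoly_le (c₀ c₁ c₂ : ℤ) : (quadPoly c₀ c₁ c₂).natDegree ≤ 2 := by
  unfold quadPoly; compute_degree

lemma intMaj_quadPoly {c₀ c₁ c₂ : ℤ} (h : |c₀| + |c₁| + |c₂| ≤ 10) :
    IntMaj (quadPoly c₀ c₁ c₂) 10 := by
  have h' : |(c₀ : ℝ)| + |(c₁ : ℝ)| + |(c₂ : ℝ)| ≤ 10 := by exact_mod_cast h
  refine (((IntMaj.C c₀).add ((IntMaj.C c₁).mul IntMaj.X)).add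
    ((IntMaj.C c₂).mul (IntMaj.X.pow 2))).mono ?_
  linarith

lemma abs_le_of_mul_mul_le {a b c q : ℤ} (hb : |a| ≤ |b|) (hc : |a| ≤ |c|) (hq : 2 ≤ |q|)
    (h : |a * b * c| ≤ |q| ^ 3 + 1) : |a| ≤ |q| := by
  by_contra! hlt
  rw [abs_mul, abs_mul] at h
  have h1 : |q| + 1 ≤ |a| := hlt
  have h2 : (|q| + 1) * (|q| + 1) * (|q| + 1) ≤ |a| * |b| * |c| := by
    have := h1.trans hb
    have := h1.trans hc
    gcongr
  nlinarith [sq_nonneg |q|]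

lemma no_small_solution {P Q ν : ℤ} {τ : ℝ} {E : ℕ} (hE : 10 ^ 7 ≤ E)
    (hQE : (2 : ℝ) ^ E ≤ Q) (hP : 0 ≤ P) (hPQ1 : P + 1 ≤ Q)
    (hPQ : IsCoprime P Q) (hν : P ^ 2 + P * Q - Q ^ 2 = ν) (hν2 : ν ^ 2 = 1)
    (hτ : τ ^ 2 + τ - 1 = 0) {c₀ c₁ c₂ d₀ d₁ d₂ U V : ℤ}
    (hc : |c₀| + |c₁| + |c₂| ≤ 10) (hd : |d₀| + |d₁| + |d₂| ≤ 10)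
    (hcτ : (c₀ : ℝ) + c₁ * τ + c₂ * τ ^ 2 ≠ 0) (hdτ : (d₀ : ℝ) + d₁ * τ + d₂ * τ ^ 2 ≠ 0)
    (hcdτ : (c₀ : ℝ) + c₁ * τ + c₂ * τ ^ 2 - (d₀ + d₁ * τ + d₂ * τ ^ 2) ≠ 0)
    (hU : U = c₀ * Q ^ 2 + c₁ * (P * Q) + c₂ * P ^ 2)
    (hV : V = d₀ * Q ^ 2 + d₁ * (P * Q) + d₂ * P ^ 2)
    (hU1 : (Q : ℝ) ^ 2 / 2 ≤ |(U : ℝ)|) (hV1 : (Q : ℝ) ^ 2 / 2 ≤ |(V : ℝ)|)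
    (hUV1 : (Q : ℝ) ^ 2 / 2 ≤ |(U : ℝ) - V|)
    (hU10 : |(U : ℝ)| ≤ 10 * Q ^ 2) (hV10 : |(V : ℝ)| ≤ 10 * Q ^ 2)
    (hratio : 6 * |(U : ℝ)| ≤ 5 * |(V : ℝ)| ∨ 6 * |(V : ℝ)| ≤ 5 * |(U : ℝ)|)
    {p q : ℤ} (hq : 2 ≤ |q|) (hpq : |p| ≤ |q|)
    (heq : (p * (p - q * U) * (p - q * V) - q ^ 3) ^ 2 = 1) : False := by
  have hQ0 : (0 : ℝ) < Q := lt_of_lt_of_le (by positivity) hQE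
  have hpq' : |(p : ℝ)| ≤ |(q : ℝ)| := by exact_mod_cast hpq
  have hq' : 2 ≤ |(q : ℝ)| := by exact_mod_cast hq
  have heq' : ((p : ℝ) * (p - q * U) * (p - q * V) - q ^ 3) ^ 2 = 1 := by exact_mod_cast heq
  have hlarge := thue_large (u := quadPoly c₀ c₁ c₂) (v := quadPoly d₀ d₁ d₂) hE hQE hP hPQ1 hPQ hν
    hν2 (natDegree_quadPoly_le _ _ _) (natDegree_quadPoly_le _ _ _) (intMaj_quadPoly hc)
    (intMaj_quadPoly hd) hτ (by rwa [eval_quadPoly]) (by rwa [eval_quadPoly])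
    (by rwa [map_sub, eval_quadPoly, eval_quadPoly])
    (by rw [eval_quadPoly, hU]; push_cast; field_simp)
    (by rw [eval_quadPoly, hV]; push_cast; field_simp) hU1 hV1 hUV1 hU10 hV10 hpq' heq'
  exact thue_small ((by norm_num : 10 ^ 6 ≤ 10 ^ 7).trans hE) hQE hU1 hV1 hUV1 hU10 hV10 hratio hpq'
    hq' hlarge heq'

lemma no_solution_of_forms {P Q ν : ℤ} {τ : ℝ} {E : ℕ} (hE : 10 ^ 7 ≤ E)
    (hQE : (2 : ℝ) ^ E ≤ Q) (hP : 0 ≤ P) (hPQ1 : P + 1 ≤ Q)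
    (hPQ : IsCoprime P Q) (hν : P ^ 2 + P * Q - Q ^ 2 = ν) (hν2 : ν ^ 2 = 1)
    (hτ : τ ^ 2 + τ - 1 = 0) {c₀ c₁ c₂ d₀ d₁ d₂ A B : ℤ}
    (hc : |c₀| + |c₁| + |c₂| ≤ 10) (hd : |d₀| + |d₁| + |d₂| ≤ 10)
    (hdc : |d₀ - c₀| + |d₁ - c₁| + |d₂ - c₂| ≤ 10)
    (hcτ : (c₀ : ℝ) + c₁ * τ + c₂ * τ ^ 2 ≠ 0) (hdτ : (d₀ : ℝ) + d₁ * τ + d₂ * τ ^ 2 ≠ 0)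
    (hcdτ : (c₀ : ℝ) + c₁ * τ + c₂ * τ ^ 2 - (d₀ + d₁ * τ + d₂ * τ ^ 2) ≠ 0)
    (hA : A = c₀ * Q ^ 2 + c₁ * (P * Q) + c₂ * P ^ 2)
    (hB : B = d₀ * Q ^ 2 + d₁ * (P * Q) + d₂ * P ^ 2)
    (hA1 : (Q : ℝ) ^ 2 / 2 ≤ A) (hBA : 6 * (A : ℝ) ≤ 5 * (B - A)) (hBA' : (B : ℝ) ≤ 6 * A)
    (hB10 : (B : ℝ) ≤ 10 * Q ^ 2) {x y : ℤ} (hy : 2 ≤ |y|)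
    (h : ((x - A * y) * (x - B * y) * x - y ^ 3) ^ 2 = 1) : False := by
  have hQ0 : (0 : ℝ) < Q := lt_of_lt_of_le (by positivity) hQE
  have hQ2 : 0 < (Q : ℝ) ^ 2 := by positivity
  have hA0 : (0 : ℝ) ≤ A := by linarith
  have hB0 : (0 : ℝ) ≤ B := by linarith
  have hBA0 : (0 : ℝ) ≤ B - A := by linarith
  have hbound : |x * (x - A * y) * (x - B * y)| ≤ |y| ^ 3 + 1 := by
    have h1 : |(x - A * y) * (x - B * y) * x - y ^ 3| = 1 := by
      rw [← sq_abs] at h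
      exact (pow_eq_one_iff_of_nonneg (abs_nonneg _) two_ne_zero).1 h
    have := abs_sub_abs_le_abs_sub ((x - A * y) * (x - B * y) * x) (y ^ 3)
    rw [h1, abs_pow] at this
    rw [show x * (x - A * y) * (x - B * y) = (x - A * y) * (x - B * y) * x by ring]
    linarith
  have aA : |(A : ℝ)| = A := abs_of_nonneg hA0
  have aB : |(B : ℝ)| = B := abs_of_nonneg hB0
  have aBA : |(B : ℝ) - A| = B - A := abs_of_nonneg hBA0
  by_cases h1 : |x| ≤ |x - A * y| ∧ |x| ≤ |x - B * y|
  · refine no_small_solution hE hQE hP hPQ1 hPQ hν hν2 hτ hc hd hcτ hdτ hcdτ hA hB ?_ ?_ ?_ ?_ ?_ ?_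
      hy (abs_le_of_mul_mul_le h1.1 h1.2 hy hbound) (by rw [← h]; ring)
    all_goals try rw [abs_sub_comm (A : ℝ)]
    all_goals try rw [aA]
    all_goals try rw [aB]
    all_goals try rw [aBA]
    any_goals linarith
    exact Or.inl (by linarith)
  by_cases h2 : |x - A * y| ≤ |x| ∧ |x - A * y| ≤ |x - B * y|
  · refine no_small_solution (c₀ := -c₀) (c₁ := -c₁) (c₂ := -c₂) (d₀ := d₀ - c₀) (d₁ := d₁ - c₁)
      (d₂ := d₂ - c₂) (U := -A) (V := B - A) hE hQE hP hPQ1 hPQ hν hν2 hτ (by simpa only [abs_neg])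
      hdc ?_ ?_ ?_ (by rw [hA]; ring) (by rw [hA, hB]; ring) ?_ ?_ ?_ ?_ ?_ ?_
      hy (abs_le_of_mul_mul_le (b := x) (c := x - B * y) h2.1 h2.2 hy
        (by rwa [mul_comm (x - A * y)])) (by rw [← h]; ring)
    · push_cast; exact fun h => hcτ (by linarith)
    · push_cast; exact fun h => hcdτ (by linarith)
    · push_cast; exact fun h => hdτ (by linarith)
    all_goals push_cast
    all_goals try rw [show -(A : ℝ) - (B - A) = -B by ring]
    all_goals try rw [abs_neg]
    all_goals try rw [aA]
    all_goals try rw [aB]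
    all_goals try rw [aBA]
    any_goals linarith
    exact Or.inl (by linarith)
  have h3 : |x - B * y| ≤ |x| ∧ |x - B * y| ≤ |x - A * y| := by
    rw [not_and_or, not_le, not_le] at h1 h2
    constructor <;> omega
  refine no_small_solution (c₀ := -d₀) (c₁ := -d₁) (c₂ := -d₂) (d₀ := -(d₀ - c₀)) (d₁ := -(d₁ - c₁))
    (d₂ := -(d₂ - c₂)) (U := -B) (V := -(B - A)) hE hQE hP hPQ1 hPQ hν hν2 hτ
    (by simpa only [abs_neg]) (by simpa only [abs_neg]) ?_ ?_ ?_ (by rw [hB]; ring)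
    (by rw [hA, hB]; ring) ?_ ?_ ?_ ?_ ?_ ?_
    hy (abs_le_of_mul_mul_le (b := x) (c := x - A * y) h3.1 h3.2 hy
      (by rwa [mul_comm (x - B * y), mul_right_comm])) (by rw [← h]; ring)
  · push_cast; exact fun h => hdτ (by linarith)
  · push_cast; exact fun h => hcdτ (by linarith)
  · push_cast; exact fun h => hcτ (by linarith)
  all_goals push_cast
  all_goals try rw [show -(B : ℝ) - -(B - A) = -A by ring]
  all_goals try rw [abs_neg]
  all_goals try rw [aA]
  all_goals try rw [aB]
  all_goals try rw [abs_neg]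
  all_goals try rw [aBA]
  any_goals linarith
  exact Or.inr (by linarith)

end Reduction

section Fibonacci

lemma lucas_eq (n : ℕ) : lucas n = 2 * Nat.fib (n + 1) - Nat.fib n := by
  induction n using Nat.twoStepInduction with
  | zero => simp [lucas]
  | one => simp [lucas]
  | more n h1 h2 =>
    rw [lucas, h1, h2, Nat.fib_add_two (n := n + 1), Nat.fib_add_two (n := n)]
    push_cast
    ring

lemma two_pow_le_fib (j : ℕ) : 2 ^ j ≤ Nat.fib (2 * j + 1) := by
  induction j with
  | zero => simp
  | succ j ih =>
    have h1 : Nat.fib (2 * (j + 1) + 1) = Nat.fib (2 * j + 1) + Nat.fib (2 * j + 2) :=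
      Nat.fib_add_two
    have h2 : Nat.fib (2 * j + 1) ≤ Nat.fib (2 * j + 2) := Nat.fib_le_fib_succ
    rw [h1, pow_succ]
    omega

lemma fib_sq_add_mul_sub_sq_sq (k : ℕ) :
    ((Nat.fib k : ℤ) ^ 2 + Nat.fib k * Nat.fib (k + 1) - (Nat.fib (k + 1) : ℤ) ^ 2) ^ 2 = 1 := by
  induction k with
  | zero => simp
  | succ k ih =>
    rw [Nat.fib_add_two]
    push_cast
    linear_combination ih

lemma cast_fib_two_mul (k : ℕ) :
    (Nat.fib (2 * k) : ℤ) = 2 * (Nat.fib k * Nat.fib (k + 1)) - Nat.fib k ^ 2 := by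
  have h : Nat.fib k ≤ 2 * Nat.fib (k + 1) := by
    have := Nat.fib_le_fib_succ (n := k); omega
  rw [Nat.fib_two_mul]
  push_cast [Nat.cast_sub h]
  ring

lemma cast_fib_two_mul_add_one (k : ℕ) :
    (Nat.fib (2 * k + 1) : ℤ) = Nat.fib (k + 1) ^ 2 + Nat.fib k ^ 2 := by
  rw [Nat.fib_two_mul_add_one]; push_cast; ring

lemma fib_no_solution {n : ℕ} (hn : 10 ^ 9 ≤ n) {x y : ℤ} (hy : 2 ≤ |y|)
    (h : ((x - (Nat.fib n : ℤ) * y) * (x - lucas n * y) * x - y ^ 3) ^ 2 = 1) : False := by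
  obtain ⟨k, hk⟩ : ∃ k, n = 2 * k ∨ n = 2 * k + 1 := ⟨n / 2, by omega⟩
  obtain ⟨E, hE, hEk⟩ : ∃ E, 10 ^ 7 ≤ E ∧ 2 * E + 1 ≤ k + 1 := ⟨k / 2, by omega, by omega⟩
  have hQE : (2 : ℝ) ^ E ≤ ((Nat.fib (k + 1) : ℤ) : ℝ) := by
    exact_mod_cast (two_pow_le_fib E).trans (Nat.fib_mono hEk)
  have hPQ1 : (Nat.fib k : ℤ) + 1 ≤ Nat.fib (k + 1) := by
    exact_mod_cast Nat.fib_lt_fib_succ (n := k) (by omega)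
  have hPQ : IsCoprime (Nat.fib k : ℤ) (Nat.fib (k + 1)) :=
    Nat.isCoprime_iff_coprime.2 (Nat.fib_coprime_fib_succ k)
  have hν2 := fib_sq_add_mul_sub_sq_sq k
  have hP : (0 : ℤ) ≤ Nat.fib k := Int.natCast_nonneg _
  have e0 := cast_fib_two_mul k
  have e1 := cast_fib_two_mul_add_one k
  have e2 : (Nat.fib (2 * k + 2) : ℤ) = Nat.fib (2 * k) + Nat.fib (2 * k + 1) := by
    rw [Nat.fib_add_two]; push_cast; ring
  set P : ℤ := (Nat.fib k : ℤ)
  set Q : ℤ := (Nat.fib (k + 1) : ℤ)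
  have hQ10 : (2 : ℝ) ^ 10 ≤ Q := (pow_le_pow_right₀ one_le_two (by omega)).trans hQE
  have hQ : (1000 : ℝ) ≤ Q := le_trans (by norm_num) hQ10
  have hP' : (0 : ℝ) ≤ P := by exact_mod_cast hP
  have hsq : ((P : ℝ) ^ 2 + P * Q - Q ^ 2) ^ 2 = 1 := by exact_mod_cast hν2
  have b1 : (P : ℝ) ^ 2 + P * Q - Q ^ 2 ≤ 1 := by nlinarith
  have b2 : -1 ≤ (P : ℝ) ^ 2 + P * Q - Q ^ 2 := by nlinarith
  have hPl : 123 / 200 * (Q : ℝ) ≤ P := by nlinarith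
  have hPu : (P : ℝ) ≤ 62 / 100 * Q := by nlinarith
  have hPQl : 123 / 200 * (Q : ℝ) ^ 2 ≤ P * Q := by nlinarith
  have hPQu : P * Q ≤ 62 / 100 * (Q : ℝ) ^ 2 := by nlinarith
  have hQ2 : 1000 ≤ (Q : ℝ) ^ 2 := by nlinarith
  have h5 : (√5) ^ 2 = 5 := Real.sq_sqrt (by norm_num)
  obtain ⟨τ, hτ, hτl, hτu⟩ : ∃ τ : ℝ, τ ^ 2 + τ - 1 = 0 ∧ 61 / 100 ≤ τ ∧ τ ≤ 62 / 100 := by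
    refine ⟨(√5 - 1) / 2, by linear_combination h5 / 4, ?_, ?_⟩
    · have : 2.22 ≤ √5 := Real.le_sqrt_of_sq_le (by norm_num)
      linarith
    · have : √5 ≤ 2.24 := Real.sqrt_le_iff.2 (by norm_num)
      linarith
  have hτ2 : τ ^ 2 = 1 - τ := by linarith
  clear hQ10 h5 hsq
  rcases hk with rfl | rfl
  · have hL : lucas (2 * k) = 2 * Q ^ 2 + (-2) * (P * Q) + 3 * P ^ 2 := by
      rw [lucas_eq, e0, e1]; ring
    have hA : (Nat.fib (2 * k) : ℤ) = 0 * Q ^ 2 + 2 * (P * Q) + (-1) * P ^ 2 := by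
      rw [e0]; ring
    have hL' : (lucas (2 * k) : ℝ) = 2 * Q ^ 2 + (-2) * (P * Q) + 3 * P ^ 2 := by exact_mod_cast hL
    have hA' : ((Nat.fib (2 * k) : ℤ) : ℝ) = 0 * Q ^ 2 + 2 * (P * Q) + (-1) * P ^ 2 := by
      rw [hA]; push_cast; ring
    refine no_solution_of_forms hE hQE hP hPQ1 hPQ rfl hν2 hτ (by decide) (by decide) (by decide)
      ?_ ?_ ?_ hA hL ?_ ?_ ?_ ?_ hy h
    · push_cast; rw [hτ2]; apply ne_of_gt; linarith
    · push_cast; rw [hτ2]; apply ne_of_gt; linarith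
    · push_cast; rw [hτ2]; apply ne_of_lt; linarith
    all_goals simp only [hL', hA']; linarith
  · have hL : lucas (2 * k + 1) = 1 * Q ^ 2 + 4 * (P * Q) + (-1) * P ^ 2 := by
      rw [lucas_eq, e2, e0, e1]; ring
    have hA : (Nat.fib (2 * k + 1) : ℤ) = 1 * Q ^ 2 + 0 * (P * Q) + 1 * P ^ 2 := by
      rw [e1]; ring
    have hL' : (lucas (2 * k + 1) : ℝ) = 1 * Q ^ 2 + 4 * (P * Q) + (-1) * P ^ 2 := by
      exact_mod_cast hL
    have hA' : ((Nat.fib (2 * k + 1) : ℤ) : ℝ) = 1 * Q ^ 2 + 0 * (P * Q) + 1 * P ^ 2 := by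
      rw [hA]; push_cast; ring
    refine no_solution_of_forms hE hQE hP hPQ1 hPQ rfl hν2 hτ (by decide) (by decide) (by decide)
      ?_ ?_ ?_ hA hL ?_ ?_ ?_ ?_ hy h
    · push_cast; rw [hτ2]; apply ne_of_gt; linarith
    · push_cast; rw [hτ2]; apply ne_of_gt; linarith
    · push_cast; rw [hτ2]; apply ne_of_lt; linarith
    all_goals simp only [hL', hA']; linarith

end Fibonacci

theorem n_upper_bound (n : ℕ) (hn : 10 ≤ n)
    (h : ∃ x y : ℤ, 2 ≤ |y| ∧
      ((x - (Nat.fib n : ℤ) * y) * (x - lucas n * y) * x - y ^ 3 = 1 ∨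
        (x - (Nat.fib n : ℤ) * y) * (x - lucas n * y) * x - y ^ 3 = -1)) :
    (n : ℝ) ≤ 1.144 * 10 ^ 15 := by
  obtain ⟨x, y, hy, h⟩ := h
  by_contra! hlt
  have hn9 : 10 ^ 9 ≤ n := by
    have : ((10 ^ 9 : ℕ) : ℝ) ≤ n := le_trans (by norm_num) hlt.le
    exact_mod_cast this
  refine fib_no_solution (x := x) hn9 hy ?_
  rcases h with h | h <;> rw [h] <;> norm_num
end

section
/- For every integer n with 49 ≤ n ≤ 132, every pair (x,y) ∈ ℤ² with |y| ≥ 2 satisfying (x − F_n·y)(x − L_n·y)·x − y³ = ±1 obeys |y| ≥ α^{2n}. -/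
open Real

theorem lucas_succ_eq (n : ℕ) :
    lucas (n + 1) = (Nat.fib (n + 1) : ℤ) + 2 * (Nat.fib n : ℤ) := by
  induction n using Nat.strong_induction_on with
  | _ n ih =>
    match n with
    | 0 => simp [lucas]
    | 1 => simp [lucas]
    | k + 2 =>
      have h1 := ih k (by omega)
      have h2 := ih (k + 1) (by omega)
      have e : lucas (k + 2 + 1) = lucas (k + 1 + 1) + lucas (k + 1) := rfl
      have f1 : Nat.fib (k + 2 + 1) = Nat.fib (k + 1) + Nat.fib (k + 1 + 1) := Nat.fib_add_two
      have f2 : Nat.fib (k + 2) = Nat.fib k + Nat.fib (k + 1) := Nat.fib_add_two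
      rw [e, h1, h2, f1, f2]
      push_cast
      ring

theorem alpha_pow_succ (n : ℕ) :
    alpha ^ (n + 1) = (Nat.fib (n + 1) : ℝ) * alpha + (Nat.fib n : ℝ) := by
  have hsq : alpha ^ 2 = alpha + 1 := by
    have h5 : Real.sqrt 5 ^ 2 = 5 := Real.sq_sqrt (by norm_num)
    unfold alpha
    nlinarith
  induction n with
  | zero => simp
  | succ k ih =>
    rw [pow_succ, ih, Nat.fib_add_two (n := k)]
    push_cast
    linear_combination (Nat.fib (k + 1) : ℝ) * hsq

theorem alpha_pow_two_mul_succ_le (n : ℕ) (hn : 1 ≤ n) :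
    alpha ^ (2 * (n + 1)) ≤ 15 * ((Nat.fib (n + 1) : ℝ) * (Nat.fib n : ℝ)) := by
  obtain ⟨m, rfl⟩ : ∃ m, n = m + 1 := ⟨n - 1, by omega⟩
  have h1 : (Nat.fib (m + 1 + 1) : ℝ) = Nat.fib m + Nat.fib (m + 1) := by
    exact_mod_cast Nat.fib_add_two (n := m)
  have h2 : (Nat.fib m : ℝ) ≤ Nat.fib (m + 1) := by exact_mod_cast Nat.fib_le_fib_succ
  have h0 : (0 : ℝ) ≤ Nat.fib m := Nat.cast_nonneg _
  have ha : alpha ≤ 2 := by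
    have : Real.sqrt 5 ≤ 3 := Real.sqrt_le_iff.2 (by norm_num)
    unfold alpha
    linarith
  have ha0 : 0 ≤ alpha := by
    unfold alpha
    positivity
  have hp := alpha_pow_succ (m + 1)
  have hle : (Nat.fib (m + 1 + 1) : ℝ) * alpha ≤ Nat.fib (m + 1 + 1) * 2 :=
    mul_le_mul_of_nonneg_left ha (Nat.cast_nonneg _)
  have hpos : 0 ≤ alpha ^ (m + 1 + 1) := pow_nonneg ha0 _
  calc alpha ^ (2 * (m + 1 + 1)) = alpha ^ (m + 1 + 1) * alpha ^ (m + 1 + 1) := by ring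
    _ ≤ (3 * Nat.fib (m + 1 + 1)) * (5 * Nat.fib (m + 1)) := by
      apply mul_le_mul _ _ hpos (by positivity) <;> linarith
    _ = _ := by ring

theorem add_mul_add_mul_ne_cube_add_one {A B y : ℤ} (hA : 10 ≤ |A|) (hB : 10 ≤ |B|)
    (hAB : A + B ≠ 0) (hy : y ≠ 0) : (1 + A * y) * (1 + B * y) ≠ y ^ 3 + 1 := by
  intro h
  have h1 : y * (y - A * B) = A + B := by
    apply mul_left_cancel₀ hy
    linear_combination -h
  have hz : y - A * B ≠ 0 := by
    intro hz
    rw [hz, mul_zero] at h1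
    exact hAB h1.symm
  have y1 : 1 ≤ |y| := Int.one_le_abs hy
  have z1 : 1 ≤ |y - A * B| := Int.one_le_abs hz
  have h2 : |y| * |y - A * B| ≤ |A| + |B| := by
    rw [← abs_mul, h1]
    exact abs_add_le A B
  have h3 : |A| * |B| ≤ |y| + |y - A * B| := by
    rw [← abs_mul]
    have := abs_sub y (y - A * B)
    simpa using this
  nlinarith

theorem abs_mul_lt_of_cubic_eq {A B t y e : ℤ} (hA : 10 ^ 5 ≤ |A|) (hB : 10 ^ 5 ≤ |B|)
    (hAB : A + B ≠ 0) (hy : 2 ≤ |y|) (he : e = 1 ∨ e = -1)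
    (h : t * (t + A * y) * (t + B * y) = y ^ 3 + e)
    (hta : |t| ≤ |t + A * y|) (htb : |t| ≤ |t + B * y|) :
    15 * (|A| * |B|) < 2 * |y| := by
  have hy0 : y ≠ 0 := by
    rintro rfl
    simp at hy
  have he1 : |e| = 1 := by rcases he with rfl | rfl <;> rfl
  have ht : t ≠ 0 := by
    rintro rfl
    have h1 : |y| ^ 3 = 1 := by
      rw [← abs_pow, show y ^ 3 = -e by linarith, abs_neg, he1]
    nlinarith [pow_le_pow_left₀ (by norm_num) hy 3]
  have ha : |A| * |y| ≤ 2 * |t + A * y| := by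
    rw [← abs_mul]
    have := abs_sub (t + A * y) t
    rw [add_sub_cancel_left] at this
    linarith
  have hb : |B| * |y| ≤ 2 * |t + B * y| := by
    rw [← abs_mul]
    have := abs_sub (t + B * y) t
    rw [add_sub_cancel_left] at this
    linarith
  have hprod : |t| * |t + A * y| * |t + B * y| ≤ |y| ^ 3 + 1 := by
    rw [← abs_mul, ← abs_mul, h, ← abs_pow, ← he1]
    exact abs_add_le _ _
  have hK : |t| * (|A| * |B|) ≤ 5 * |y| := by
    have h1 : (|A| * |y|) * (|B| * |y|) ≤ (2 * |t + A * y|) * (2 * |t + B * y|) :=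
      mul_le_mul ha hb (by positivity) (by positivity)
    have h2 := mul_le_mul_of_nonneg_left h1 (abs_nonneg t)
    have h3 : 8 ≤ |y| ^ 3 := by simpa using pow_le_pow_left₀ (by norm_num) hy 3
    have hpos : 0 < |y| ^ 2 := by positivity
    refine le_of_mul_le_mul_right ?_ hpos
    nlinarith
  by_contra! hlt
  have hKbig : 10 ^ 10 ≤ |A| * |B| := by nlinarith
  have htle : |t| ≤ 37 := by
    by_contra! hgt
    nlinarith
  have ht1 : 1 ≤ |t| := Int.one_le_abs ht
  have hybig : 2 * 10 ^ 9 ≤ |y| := by nlinarith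
  have hdvd : y ∣ t ^ 3 - e :=
    ⟨y ^ 2 - (t ^ 2 * (A + B) + t * A * B * y), by linear_combination h⟩
  have hte : t ^ 3 = e := by
    by_contra hne
    have h1 : |y| ≤ |t ^ 3 - e| :=
      Int.le_of_dvd (abs_pos.2 (sub_ne_zero.2 hne)) ((abs_dvd_abs _ _).2 hdvd)
    have h2 : |t ^ 3 - e| ≤ |t| ^ 3 + |e| := by
      rw [← abs_pow]
      exact abs_sub _ _
    have h3 := pow_le_pow_left₀ (abs_nonneg t) htle 3
    norm_num at h3
    linarith
  have hA' : 10 ≤ |A| := by linarith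
  have hB' : 10 ≤ |B| := by linarith
  rcases he with rfl | rfl
  · have : t = 1 := by
      have h1 : t ∣ 1 := ⟨t ^ 2, by linear_combination -hte⟩
      rcases Int.isUnit_iff.1 (isUnit_of_dvd_one h1) with rfl | rfl
      · rfl
      · norm_num at hte
    subst this
    exact add_mul_add_mul_ne_cube_add_one hA' hB' hAB hy0 (by linear_combination h)
  · have : t = -1 := by
      have h1 : t ∣ 1 := ⟨-t ^ 2, by linear_combination hte⟩
      rcases Int.isUnit_iff.1 (isUnit_of_dvd_one h1) with rfl | rfl
      · norm_num at hte
      · rfl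
    subst this
    exact add_mul_add_mul_ne_cube_add_one hA' hB' hAB (neg_ne_zero.2 hy0)
      (by linear_combination -h)

theorem y_large_for_middle_n (n : ℕ) (hn1 : 49 ≤ n) (hn2 : n ≤ 132) (x y : ℤ)
    (hy : 2 ≤ |y|)
    (heq : (x - (Nat.fib n : ℤ) * y) * (x - lucas n * y) * x - y ^ 3 = 1 ∨
      (x - (Nat.fib n : ℤ) * y) * (x - lucas n * y) * x - y ^ 3 = -1) :
    alpha ^ (2 * n) ≤ |(y : ℝ)| := by
  obtain ⟨m, rfl⟩ : ∃ m, n = m + 1 := ⟨n - 1, by omega⟩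
  have hα := alpha_pow_two_mul_succ_le m (by omega)
  have hfib : (10 ^ 5 : ℤ) ≤ Nat.fib m := by
    have h1 : Nat.fib 48 ≤ Nat.fib m := Nat.fib_mono (by omega)
    have h2 : 10 ^ 5 ≤ Nat.fib 48 := by norm_num
    exact_mod_cast h2.trans h1
  have hlt : (Nat.fib m : ℤ) < Nat.fib (m + 1) := by
    exact_mod_cast Nat.fib_lt_fib_succ (by omega)
  have hlt2 : (Nat.fib (m + 1) : ℤ) < 2 * Nat.fib m := by
    obtain ⟨k, rfl⟩ : ∃ k, m = k + 1 := ⟨m - 1, by omega⟩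
    have h1 : Nat.fib k < Nat.fib (k + 1) := Nat.fib_lt_fib_succ (by omega)
    have h2 : Nat.fib (k + 1 + 1) = Nat.fib k + Nat.fib (k + 1) := Nat.fib_add_two
    omega
  rw [lucas_succ_eq] at heq
  set F : ℤ := (Nat.fib (m + 1) : ℤ) with hF
  set G : ℤ := (Nat.fib m : ℤ) with hG
  obtain ⟨e, he, h⟩ : ∃ e : ℤ, (e = 1 ∨ e = -1) ∧
      (x - F * y) * (x - (F + 2 * G) * y) * x = y ^ 3 + e := by
    rcases heq with h | h
    · exact ⟨1, Or.inl rfl, by linarith⟩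
    · exact ⟨-1, Or.inr rfl, by linarith⟩
  have aF : |F| = F := abs_of_pos (by linarith)
  have aG : |2 * G| = 2 * G := abs_of_pos (by linarith)
  have aL : |F + 2 * G| = F + 2 * G := abs_of_pos (by linarith)
  have key : 15 * (F * G) < |y| := by
    by_cases h1 : |x| ≤ |x - F * y| ∧ |x| ≤ |x - (F + 2 * G) * y|
    · have := abs_mul_lt_of_cubic_eq (A := -F) (B := -(F + 2 * G)) (t := x) (y := y) (e := e)
        (by rw [abs_neg]; linarith) (by rw [abs_neg]; linarith) (by linarith) hy he
        (by linear_combination h) (by convert h1.1 using 2; ring) (by convert h1.2 using 2; ring)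
      rw [abs_neg, abs_neg, aF, aL] at this
      nlinarith
    by_cases h2 : |x - F * y| ≤ |x - (F + 2 * G) * y|
    · have h3 : |x - F * y| ≤ |x| := by
        by_contra! hc
        exact h1 ⟨hc.le, hc.le.trans h2⟩
      have := abs_mul_lt_of_cubic_eq (A := F) (B := -(2 * G)) (t := x - F * y) (y := y) (e := e)
        (by linarith) (by rw [abs_neg]; linarith) (by linarith) hy he
        (by linear_combination h) (by convert h3 using 2; ring) (by convert h2 using 2; ring)
      rw [abs_neg, aF, aG] at this
      nlinarith
    · push Not at h2
      have h3 : |x - (F + 2 * G) * y| ≤ |x| := by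
        by_contra! hc
        exact h1 ⟨(hc.trans h2).le, hc.le⟩
      have := abs_mul_lt_of_cubic_eq (A := F + 2 * G) (B := 2 * G) (t := x - (F + 2 * G) * y)
        (y := y) (e := e) (by linarith) (by linarith) (by linarith) hy he
        (by linear_combination h) (by convert h3 using 2; ring) (h2.le.trans_eq (congrArg _ (by ring)))
      rw [aL, aG] at this
      nlinarith
  have keyR : 15 * ((Nat.fib (m + 1) : ℝ) * (Nat.fib m : ℝ)) < |(y : ℝ)| := by
    rw [hF, hG] at key
    exact_mod_cast key
  exact hα.trans keyR.le
end
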